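/- Let (R,m) be a Noetherian local domain whose m-adic completion is an integral domain (i.e. R is analytically irreducible), and let f = (f₁,…,f_r) ⊆ R[X₁,…,X_N]. Suppose each fᵢ admits a factorization fᵢ = f_{i1}···f_{ik_i} with all f_{ij} ∈ R[X₁,…,X_N], and suppose that for every choice of indices 1 ≤ j₁ ≤ k₁, …, 1 ≤ j_r ≤ k_r the system (f_{1j₁},…,f_{rj_r}) admits an Artin bound that is bounded above by a linear function of n. Then the system f itself admits an Artin bound bounded above by a linear function of n. -/

import Mathlib

section Header
open MvPolynomial IsLocalRing

/-- `β` is an Artin bound for the system `f` with respect to the ideal `I`. -/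
def IsArtinBound {R : Type*} [CommRing R] (I : Ideal R) {N r : ℕ}
    (f : Fin r → MvPolynomial (Fin N) R) (β : ℕ → ℕ) : Prop :=
  ∀ n : ℕ, ∀ a : Fin N → R, (∀ i, eval a (f i) ∈ I ^ β n) →
    ∃ b : Fin N → R, (∀ i, eval b (f i) = 0) ∧ ∀ j, a j - b j ∈ I ^ n

end Header

section PartP2c
open IsLocalRing
set_option linter.unusedSectionVars false

namespace CohP

/-- monomial in the elements `β i`. -/
noncomputable def mon {S ι : Type*} [CommRing S] (β : ι → S) (f : ι →₀ ℕ) : S := f.prod fun i e => β i ^ e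

lemma mon_add {S ι : Type*} [CommRing S] (β : ι → S) (f g : ι →₀ ℕ) : mon β (f + g) = mon β f * mon β g := by
  classical
  exact Finsupp.prod_add_index' (by simp) (by intros; rw [pow_add])

lemma mon_zero {S ι : Type*} [CommRing S] (β : ι → S) : mon β 0 = 1 := by simp [mon]

lemma mon_single {S ι : Type*} [CommRing S] (β : ι → S) (i : ι) (e : ℕ) : mon β (Finsupp.single i e) = β i ^ e := by
  simp [mon]

lemma mon_smul {S ι : Type*} [CommRing S] (β : ι → S) (n : ℕ) (f : ι →₀ ℕ) : mon β (n • f) = mon β f ^ n := by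
  induction n with
  | zero => simp [mon_zero]
  | succ n ih => rw [succ_nsmul, mon_add, ih, pow_succ]

/-- support in `B`. -/
def Sup {ι : Type*} (B : Set ι) (f : ι →₀ ℕ) : Prop := ∀ i, f i ≠ 0 → i ∈ B

/-- reduced exponents supported in `B`. -/
def Red {ι : Type*} (p : ℕ) (B : Set ι) (f : ι →₀ ℕ) : Prop := ∀ i, f i < p ∧ (f i ≠ 0 → i ∈ B)

lemma mon_mem {S ι : Type*} [CommRing S] {β : ι → S} {T : Subring S} {B : Set ι} (hβ : ∀ b ∈ B, β b ∈ T) {f : ι →₀ ℕ}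
    (hf : Sup B f) : mon β f ∈ T :=
  Subring.prod_mem _ fun i hi => Subring.pow_mem _ (hβ i (hf i (Finsupp.mem_support_iff.1 hi))) _

/-- the next subring -/
def nxt {S ι : Type*} [CommRing S] (p : ℕ) (β : ι → S) (B : Set ι) (T : Subring S) : Subring S :=
  Subring.closure ({x | ∃ a ∈ T, x = a ^ p} ∪ {x | ∃ a ∈ T, x = p * a} ∪ β '' B)

/-- normal form. -/
def NF {S ι : Type*} [CommRing S] (p : ℕ) (β : ι → S) (B : Set ι) (T : Subring S) (x : S) : Prop :=
  ∃ (Fs : Finset (ι →₀ ℕ)) (y : (ι →₀ ℕ) → S) (z : S), (∀ f ∈ Fs, Red p B f) ∧ (∀ f, y f ∈ T) ∧ (∀ f, f ∉ Fs → y f = 0) ∧ z ∈ T ∧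
    x = ∑ f ∈ Fs, y f ^ p * mon β f + p * z

variable {S ι : Type*} [CommRing S] {p : ℕ} [hp : Fact p.Prime] {β : ι → S} {B : Set ι} {T : Subring S}

lemma pow_nxt {a : S} (ha : a ∈ T) : a ^ p ∈ nxt p β B T := Subring.subset_closure (Or.inl (Or.inl ⟨a, ha, rfl⟩))
lemma p_nxt {a : S} (ha : a ∈ T) : (p : S) * a ∈ nxt p β B T := Subring.subset_closure (Or.inl (Or.inr ⟨a, ha, rfl⟩))
lemma b_nxt {b : ι} (hb : b ∈ B) : β b ∈ nxt p β B T := Subring.subset_closure (Or.inr ⟨b, hb, rfl⟩)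

lemma nxt_le (hβ : ∀ b ∈ B, β b ∈ T) : nxt p β B T ≤ T := by
  rw [nxt, Subring.closure_le]
  rintro x ((⟨a, ha, rfl⟩ | ⟨a, ha, rfl⟩) | ⟨b, hb, rfl⟩)
  · exact T.pow_mem ha p
  · exact T.mul_mem (natCast_mem T p) ha
  · exact hβ b hb

lemma nxt_mono {T' : Subring S} (h : T ≤ T') : nxt p β B T ≤ nxt p β B T' := by
  rw [nxt, Subring.closure_le]
  rintro x ((⟨a, ha, rfl⟩ | ⟨a, ha, rfl⟩) | ⟨b, hb, rfl⟩)
  · exact pow_nxt (h ha)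
  · exact p_nxt (h ha)
  · exact b_nxt hb

lemma Red.sup {f : ι →₀ ℕ} (h : Red p B f) : Sup B f := fun i => (h i).2

lemma exists_add_pow (T : Subring S) {a b : S} (ha : a ∈ T) (hb : b ∈ T) : ∃ c ∈ T, (a + b) ^ p = a ^ p + b ^ p + p * c := by
  obtain ⟨r, hr⟩ := exists_add_pow_prime_eq hp.out (⟨a, ha⟩ : T) ⟨b, hb⟩
  refine ⟨a * b * r, T.mul_mem (T.mul_mem ha hb) r.2, ?_⟩
  have := congrArg Subtype.val hr
  simpa [mul_assoc] using this

lemma NF.mem (hβ : ∀ b ∈ B, β b ∈ T) {x : S} (h : NF p β B T x) : x ∈ T := by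
  obtain ⟨Fs, y, z, h1, h2, -, h3, rfl⟩ := h
  exact T.add_mem (T.sum_mem fun f hf => T.mul_mem (T.pow_mem (h2 f) p) (mon_mem hβ (h1 f hf).sup)) (T.mul_mem (natCast_mem T p) h3)

lemma NF.pmul {z : S} (hz : z ∈ T) : NF p β B T (p * z) :=
  ⟨∅, 0, z, by simp, fun _ => T.zero_mem, fun _ _ => rfl, hz, by simp⟩

lemma NF.gen (hβ : ∀ b ∈ B, β b ∈ T) {a : S} (ha : a ∈ T) {f : ι →₀ ℕ} (hf : Sup B f) : NF p β B T (a ^ p * mon β f) := by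
  classical
  let r : ι →₀ ℕ := f.mapRange (fun n => n % p) (Nat.zero_mod p)
  let g : ι →₀ ℕ := f.mapRange (fun n => n / p) (Nat.zero_div p)
  have hg : p • g + r = f := by ext i; simp [g, r, Nat.div_add_mod]
  refine ⟨{r}, fun h => if h = r then a * mon β g else 0, 0, ?_, ?_, ?_, T.zero_mem, ?_⟩
  · intro h hh
    rw [Finset.mem_singleton] at hh
    subst hh
    intro i
    refine ⟨Nat.mod_lt _ hp.out.pos, fun h => hf i fun h0 => h ?_⟩
    simp [r, h0]
  · intro h
    dsimp only
    split_ifs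
    · refine T.mul_mem ha (mon_mem hβ fun i h => hf i fun h0 => h ?_)
      simp [g, h0]
    · exact T.zero_mem
  · intro h hh
    rw [Finset.mem_singleton] at hh
    exact if_neg hh
  · simp only [Finset.sum_singleton, if_true, mul_zero, add_zero]
    rw [← hg, mon_add, mon_smul, mul_pow, mul_assoc]

lemma NF.add (hβ : ∀ b ∈ B, β b ∈ T) {x x' : S} (h : NF p β B T x) (h' : NF p β B T x') : NF p β B T (x + x') := by
  classical
  obtain ⟨Fs, y, z, h1, h2, h2', h3, rfl⟩ := h
  obtain ⟨Fs', y', z', h1', h2'', h2''', h3', rfl⟩ := h'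
  choose c hc hc2 using fun f => exists_add_pow (p := p) T (h2 f) (h2'' f)
  have e1 : ∑ f ∈ Fs, y f ^ p * mon β f = ∑ f ∈ Fs ∪ Fs', y f ^ p * mon β f :=
    Finset.sum_subset Finset.subset_union_left fun f _ hf => by rw [h2' f hf, zero_pow hp.out.ne_zero, zero_mul]
  have e2 : ∑ f ∈ Fs', y' f ^ p * mon β f = ∑ f ∈ Fs ∪ Fs', y' f ^ p * mon β f :=
    Finset.sum_subset Finset.subset_union_right fun f _ hf => by rw [h2''' f hf, zero_pow hp.out.ne_zero, zero_mul]
  have hred : ∀ f ∈ Fs ∪ Fs', Red p B f := fun f hf => (Finset.mem_union.1 hf).elim (h1 f) (h1' f)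
  refine ⟨Fs ∪ Fs', fun f => y f + y' f, z + z' - ∑ f ∈ Fs ∪ Fs', c f * mon β f, hred,
    fun f => T.add_mem (h2 f) (h2'' f), ?_, ?_, ?_⟩
  · intro f hf
    rw [Finset.mem_union, not_or] at hf
    simp [h2' f hf.1, h2''' f hf.2]
  · exact T.sub_mem (T.add_mem h3 h3') (T.sum_mem fun f hf => T.mul_mem (hc f) (mon_mem hβ (hred f hf).sup))
  · rw [e1, e2]
    simp_rw [hc2, add_mul, Finset.sum_add_distrib, mul_assoc, ← Finset.mul_sum]
    ring

lemma NF.sum (hβ : ∀ b ∈ B, β b ∈ T) {α : Type*} (s : Finset α) (x : α → S) (h : ∀ a ∈ s, NF p β B T (x a)) :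
    NF p β B T (∑ a ∈ s, x a) := by
  classical
  induction s using Finset.induction_on with
  | empty => simpa using NF.pmul (p := p) (β := β) (B := B) T.zero_mem
  | insert a s ha ih =>
    rw [Finset.sum_insert ha]
    exact NF.add hβ (h a (Finset.mem_insert_self _ _)) (ih fun b hb => h b (Finset.mem_insert_of_mem hb))

lemma NF.mul (hβ : ∀ b ∈ B, β b ∈ T) {x x' : S} (h : NF p β B T x) (h' : NF p β B T x') : NF p β B T (x * x') := by
  have hx' := h'.mem hβ
  obtain ⟨Fs, y, z, h1, h2, h2', h3, rfl⟩ := h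
  rw [add_mul]
  refine NF.add hβ ?_ (by rw [mul_assoc]; exact NF.pmul (T.mul_mem h3 hx'))
  rw [Finset.sum_mul]
  refine NF.sum hβ _ _ fun f hf => ?_
  obtain ⟨Fs', y', z', h1', h2'', h2''', h3', rfl⟩ := h'
  rw [mul_add]
  refine NF.add hβ ?_ ?_
  · rw [Finset.mul_sum]
    refine NF.sum hβ _ _ fun g hg => ?_
    have : y f ^ p * mon β f * (y' g ^ p * mon β g) = (y f * y' g) ^ p * mon β (f + g) := by
      rw [mon_add]; ring
    rw [this]
    refine NF.gen hβ (T.mul_mem (h2 f) (h2'' g)) fun i hi => ?_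
    by_cases hfi : f i = 0
    · exact (h1' g hg).sup i fun h0 => hi (by simp [hfi, h0])
    · exact (h1 f hf).sup i hfi
  · have : y f ^ p * mon β f * (p * z') = p * (y f ^ p * mon β f * z') := by ring
    rw [this]
    exact NF.pmul (T.mul_mem (T.mul_mem (T.pow_mem (h2 f) p) (mon_mem hβ (h1 f hf).sup)) h3')

lemma NF.pow (hβ : ∀ b ∈ B, β b ∈ T) {a : S} (ha : a ∈ T) : NF p β B T (a ^ p) := by
  have := NF.gen (p := p) hβ ha (f := 0) (fun i hi => absurd rfl hi)
  rwa [mon_zero, mul_one] at this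

lemma NF.one (hβ : ∀ b ∈ B, β b ∈ T) : NF p β B T 1 := by
  simpa using NF.pow (p := p) hβ T.one_mem

lemma NF.neg_one (hβ : ∀ b ∈ B, β b ∈ T) : NF p β B T (-1) := by
  rcases hp.out.eq_two_or_odd' with h | h
  · have := NF.add hβ (NF.one (p := p) hβ) (NF.pmul (p := p) (β := β) (B := B) (T.neg_mem T.one_mem))
    have e : (1 : S) + p * -1 = -1 := by subst h; push_cast; ring
    rwa [e] at this
  · have := NF.pow (p := p) hβ (T.neg_mem T.one_mem)
    rwa [h.neg_one_pow] at this

theorem nf_of_mem (hβ : ∀ b ∈ B, β b ∈ T) {x : S} (hx : x ∈ nxt p β B T) : NF p β B T x := by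
  rw [nxt] at hx
  induction hx using Subring.closure_induction with
  | mem x h =>
    rcases h with (⟨a, ha, rfl⟩ | ⟨a, ha, rfl⟩) | ⟨b, hb, rfl⟩
    · exact NF.pow hβ ha
    · exact NF.pmul ha
    · have := NF.gen (p := p) hβ T.one_mem (f := Finsupp.single b 1) (fun i hi => by
        classical
        rw [Finsupp.single_apply] at hi
        by_cases h : b = i
        · exact h ▸ hb
        · simp [h] at hi)
      simpa [mon_single] using this
  | zero => simpa using NF.pmul (p := p) (β := β) (B := B) T.zero_mem
  | one => exact NF.one hβ
  | add x y _ _ h1 h2 => exact NF.add hβ h1 h2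
  | neg x _ h => rw [← neg_one_mul]; exact NF.mul hβ (NF.neg_one hβ) h
  | mul x y _ _ h1 h2 => exact NF.mul hβ h1 h2

end CohP
end PartP2c

section PartP2d
open IsLocalRing
set_option linter.unusedSectionVars false

namespace CohP

/-- `p`-independence. -/
def Indep {k : Type*} [Field k] (p : ℕ) (B : Set k) : Prop :=
  ∀ (Fs : Finset (k →₀ ℕ)) (y : (k →₀ ℕ) → k), (∀ f ∈ Fs, Red p B f) → ∑ f ∈ Fs, y f ^ p * mon id f = 0 → ∀ f ∈ Fs, y f = 0

variable {k : Type*} [Field k] {p : ℕ} [hp : Fact p.Prime] [CharP k p]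

/-- the subfield generated by `p`-th powers and `B`. -/
def LL (k : Type*) [Field k] (p : ℕ) [hp : Fact p.Prime] (B : Set k) : Subfield k :=
  { nxt p id B ⊤ with
    inv_mem' := by
      intro x hx
      by_cases h : x = 0
      · subst h; simp
      have h1 : x⁻¹ = x ^ (p - 1) * (x⁻¹) ^ p := by
        obtain ⟨q, hq⟩ : ∃ q, p = q + 1 := ⟨p - 1, by have := hp.out.pos; omega⟩
        rw [hq, Nat.add_sub_cancel, pow_succ, ← mul_assoc, ← mul_pow, mul_inv_cancel₀ h, one_pow, one_mul]
      have h2 : x ^ (p - 1) * (x⁻¹) ^ p ∈ nxt p (id : k → k) B ⊤ :=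
        Subring.mul_mem _ (Subring.pow_mem _ hx _) (pow_nxt (Subring.mem_top _))
      show x⁻¹ ∈ nxt p (id : k → k) B ⊤
      rw [h1]; exact h2 }

lemma mem_LL {B : Set k} {x : k} : x ∈ LL k p B ↔ x ∈ nxt p id B ⊤ := Iff.rfl

lemma lin_indep {B : Set k} {c : k} (hc : c ∉ LL k p B) (l : ℕ → k) (hl : ∀ i, l i ∈ LL k p B)
    (h0 : ∑ i ∈ Finset.range p, l i * c ^ i = 0) : ∀ i < p, l i = 0 := by
  let a : LL k p B := ⟨c ^ p, pow_nxt (Subring.mem_top _)⟩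
  have hirr : Irreducible (Polynomial.X ^ p - Polynomial.C a) := by
    rw [X_pow_sub_C_irreducible_iff_of_prime hp.out]
    intro b hb
    have h1 : (b : k) ^ p = c ^ p := congrArg Subtype.val hb
    have h2 : (b : k) = c := frobenius_inj k p h1
    exact hc (h2 ▸ b.2)
  have hroot : Polynomial.aeval c (Polynomial.X ^ p - Polynomial.C a) = 0 := by
    simp only [map_sub, map_pow, Polynomial.aeval_X, Polynomial.aeval_C]
    exact sub_self _
  have hmin := minpoly.eq_of_irreducible_of_monic hirr hroot (Polynomial.monic_X_pow_sub_C a hp.out.ne_zero)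
  let q : Polynomial (LL k p B) := ∑ i ∈ Finset.range p, Polynomial.C (⟨l i, hl i⟩ : LL k p B) * Polynomial.X ^ i
  have hq0 : Polynomial.aeval c q = 0 := by
    simp only [q, map_sum, map_mul, map_pow, Polynomial.aeval_X, Polynomial.aeval_C]
    exact h0
  have hdeg : q.degree < p := by
    refine (Polynomial.degree_sum_le _ _).trans_lt ((Finset.sup_lt_iff (WithBot.bot_lt_coe p)).2 fun i hi => ?_)
    exact (Polynomial.degree_C_mul_X_pow_le i _).trans_lt (Nat.cast_lt.2 (Finset.mem_range.1 hi))
  have hq : q = 0 := by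
    by_contra hne
    have := minpoly.degree_le_of_ne_zero _ c hne hq0
    rw [← hmin, Polynomial.degree_X_pow_sub_C hp.out.pos] at this
    exact absurd hdeg (not_lt.2 this)
  intro i hi
  have h1 : q.coeff i = ⟨l i, hl i⟩ := by
    simp only [q, Polynomial.finsetSum_coeff, Polynomial.coeff_C_mul_X_pow]
    rw [Finset.sum_ite_eq, if_pos (Finset.mem_range.2 hi)]
  rw [hq, Polynomial.coeff_zero] at h1
  exact (congrArg Subtype.val h1).symm

lemma indep_insert {B : Set k} (hB : Indep p B) {c : k} (hc : c ∉ LL k p B) : Indep p (insert c B) := by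
  classical
  intro Fs y hred hsum
  have hred' : ∀ f ∈ Fs, Red p B (f.erase c) := by
    intro f hf i
    by_cases hi : i = c
    · subst hi; simp [hp.out.pos]
    · rw [Finsupp.erase_ne hi]
      exact ⟨(hred f hf i).1, fun h => ((hred f hf i).2 h).resolve_left hi⟩
  have hmon : ∀ f : k →₀ ℕ, mon (id : k → k) f = c ^ f c * mon id (f.erase c) := by
    intro f
    conv_lhs => rw [← Finsupp.single_add_erase c f]
    rw [mon_add, mon_single]; rfl
  let l : ℕ → k := fun i => ∑ f ∈ Fs with f c = i, y f ^ p * mon id (f.erase c)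
  have hl : ∀ i, l i ∈ LL k p B := by
    intro i
    refine Subfield.sum_mem _ fun f hf => ?_
    refine Subfield.mul_mem _ (pow_nxt (Subring.mem_top _)) ?_
    exact mon_mem (T := nxt p id B ⊤) (fun b hb => b_nxt hb) (hred' f (Finset.mem_filter.1 hf).1).sup
  have hl0 : ∑ i ∈ Finset.range p, l i * c ^ i = 0 := by
    rw [← hsum, ← Finset.sum_fiberwise_of_maps_to (s := Fs) (t := Finset.range p) (g := fun f => f c)
      (fun f hf => Finset.mem_range.2 (hred f hf c).1)]
    refine Finset.sum_congr rfl fun i _ => ?_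
    rw [Finset.sum_mul]
    refine Finset.sum_congr rfl fun f hf => ?_
    rw [hmon f, (Finset.mem_filter.1 hf).2]; ring
  have hz := lin_indep hc l hl hl0
  intro f hf
  have hi := hz (f c) (hred f hf c).1
  have key : ∀ g : k →₀ ℕ, g c = f c → g.erase c + Finsupp.single c (f c) = g := by
    intro g hg
    rw [← hg, Finsupp.erase_add_single]
  have := hB ((Fs.filter fun g => g c = f c).image (Finsupp.erase c)) (fun g => y (g + Finsupp.single c (f c))) ?_ ?_ (f.erase c) ?_
  · simpa [key f rfl] using this
  · intro g hg
    obtain ⟨g', hg', rfl⟩ := Finset.mem_image.1 hg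
    exact hred' g' (Finset.mem_filter.1 hg').1
  · rw [Finset.sum_image]
    · rw [← hi]
      refine Finset.sum_congr rfl fun g hg => ?_
      rw [key g (Finset.mem_filter.1 hg).2]
    · intro g hg g' hg' h
      rw [← key g (Finset.mem_filter.1 hg).2, ← key g' (Finset.mem_filter.1 hg').2, h]
  · exact Finset.mem_image_of_mem _ (Finset.mem_filter.2 ⟨hf, rfl⟩)

variable (k p) in
theorem exists_pbasis : ∃ B : Set k, Indep p B ∧ ∀ c, c ∈ nxt p id B ⊤ := by
  classical
  obtain ⟨B, hB⟩ := zorn_subset {B : Set k | Indep p B} (by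
    intro C hC hch
    by_cases hne : C.Nonempty
    · refine ⟨⋃₀ C, ?_, fun s hs => Set.subset_sUnion_of_mem hs⟩
      intro Fs y hred hsum
      obtain ⟨A, hA, hAs⟩ : ∃ A ∈ C, (↑(Fs.biUnion fun f => f.support) : Set k) ⊆ A := by
        refine DirectedOn.exists_mem_subset_of_finset_subset_biUnion hne hch.directedOn ?_
        intro x hx
        simp only [Finset.coe_biUnion, Set.mem_iUnion] at hx
        obtain ⟨f, hf, hx⟩ := hx
        have := (hred f hf x).2 (Finsupp.mem_support_iff.1 hx)
        simpa using this
      refine hC hA Fs y (fun f hf i => ⟨(hred f hf i).1, fun h => hAs ?_⟩) hsum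
      exact Finset.mem_coe.2 (Finset.mem_biUnion.2 ⟨f, hf, Finsupp.mem_support_iff.2 h⟩)
    · rw [Set.not_nonempty_iff_eq_empty] at hne
      subst hne
      refine ⟨∅, ?_, by simp⟩
      intro Fs y hred hsum f hf
      have h0 : ∀ g ∈ Fs, g = 0 := fun g hg => by
        ext i
        by_contra h
        exact (hred g hg i).2 h
      have : Fs = {0} := by
        ext g
        rw [Finset.mem_singleton]
        refine ⟨h0 g, ?_⟩
        rintro rfl
        exact h0 f hf ▸ hf
      subst this
      rw [Finset.sum_singleton, mon_zero, mul_one] at hsum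
      rw [h0 f hf]
      exact pow_eq_zero_iff hp.out.ne_zero |>.1 hsum)
  refine ⟨B, hB.prop, fun c => ?_⟩
  by_contra hc
  have h1 := indep_insert hB.prop (c := c) hc
  have h2 : insert c B ⊆ B := hB.le_of_ge h1 (Set.subset_insert c B)
  exact hc (b_nxt (β := (id : k → k)) (h2 (Set.mem_insert c B)))

end CohP
end PartP2d

section PartP2e
open IsLocalRing
set_option linter.unusedSectionVars false

namespace CohP

lemma exists_lim {S : Type*} [CommRing S] {I : Ideal S} (hS : IsAdicComplete I S) (n : ℕ) (a : ℕ → S)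
    (ha : ∀ j, a j - a (j + 1) ∈ I ^ (n + j)) : ∃ L, ∀ j, a j - L ∈ I ^ (n + j) := by
  have h1 : ∀ j i, a j - a (j + i) ∈ I ^ (n + j) := by
    intro j i
    induction i with
    | zero => simp
    | succ i ih =>
      have : a j - a (j + (i + 1)) = (a j - a (j + i)) + (a (j + i) - a (j + i + 1)) := by rw [← add_assoc]; ring
      rw [this]
      exact Ideal.add_mem _ ih (Ideal.pow_le_pow_right (by omega) (ha _))
  obtain ⟨L, hL⟩ := IsPrecomplete.prec' (I := I) (M := S) a (by
    intro i j hij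
    rw [SModEq.sub_mem, smul_eq_mul, Ideal.mul_top]
    obtain ⟨c, rfl⟩ := Nat.exists_eq_add_of_le hij
    exact Ideal.pow_le_pow_right (by omega) (h1 i c))
  refine ⟨L, fun j => ?_⟩
  have h2 := hL (j + n)
  rw [SModEq.sub_mem, smul_eq_mul, Ideal.mul_top] at h2
  have : a j - L = (a j - a (j + n)) + (a (j + n) - L) := by ring
  rw [this]
  exact Ideal.add_mem _ (h1 j n) (Ideal.pow_le_pow_right (by omega) h2)

lemma haus0 {S : Type*} [CommRing S] {I : Ideal S} (hS : IsAdicComplete I S) (x : S) (h : ∀ n, x ∈ I ^ n) : x = 0 := by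
  refine IsHausdorff.haus hS.toIsHausdorff x fun n => ?_
  rw [SModEq.zero, smul_eq_mul, Ideal.mul_top]
  exact h n

/-- the sequence of subrings -/
def Lam {S ι : Type*} [CommRing S] (p : ℕ) (β : ι → S) (B : Set ι) : ℕ → Subring S
  | 0 => ⊤
  | n + 1 => nxt p β B (Lam p β B n)

lemma Lam_succ {S ι : Type*} [CommRing S] (p : ℕ) (β : ι → S) (B : Set ι) (n : ℕ) :
    Lam p β B (n + 1) = nxt p β B (Lam p β B n) := rfl

lemma b_Lam {S ι : Type*} [CommRing S] (p : ℕ) [Fact p.Prime] (β : ι → S) (B : Set ι) (n : ℕ) : ∀ b ∈ B, β b ∈ Lam p β B n := by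
  intro b hb
  cases n with
  | zero => exact Subring.mem_top _
  | succ n => exact b_nxt hb

lemma Lam_anti {S ι : Type*} [CommRing S] (p : ℕ) [Fact p.Prime] (β : ι → S) (B : Set ι) : Antitone (Lam p β B) :=
  antitone_nat_of_succ_le fun n => nxt_le (b_Lam p β B n)

/-- the limit ring -/
def Lim {S ι : Type*} [CommRing S] (I : Ideal S) (p : ℕ) (β : ι → S) (B : Set ι) : Subring S where
  carrier := {x | ∀ n, ∃ a ∈ Lam p β B n, x - a ∈ I ^ (n + 1)}
  mul_mem' := by
    intro x y hx hy n
    obtain ⟨a, ha, hxa⟩ := hx n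
    obtain ⟨b, hb, hyb⟩ := hy n
    refine ⟨a * b, Subring.mul_mem _ ha hb, ?_⟩
    have : x * y - a * b = x * (y - b) + b * (x - a) := by ring
    rw [this]
    exact Ideal.add_mem _ (Ideal.mul_mem_left _ _ hyb) (Ideal.mul_mem_left _ _ hxa)
  add_mem' := by
    intro x y hx hy n
    obtain ⟨a, ha, hxa⟩ := hx n
    obtain ⟨b, hb, hyb⟩ := hy n
    refine ⟨a + b, Subring.add_mem _ ha hb, ?_⟩
    have : x + y - (a + b) = (x - a) + (y - b) := by ring
    rw [this]
    exact Ideal.add_mem _ hxa hyb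
  neg_mem' := by
    intro x hx n
    obtain ⟨a, ha, hxa⟩ := hx n
    refine ⟨-a, Subring.neg_mem _ ha, ?_⟩
    have : -x - -a = -(x - a) := by ring
    rw [this]
    exact Ideal.neg_mem_iff _ |>.2 hxa
  one_mem' := fun n => ⟨1, Subring.one_mem _, by simp⟩
  zero_mem' := fun n => ⟨0, Subring.zero_mem _, by simp⟩

lemma Lim_closed {S ι : Type*} [CommRing S] {I : Ideal S} {p : ℕ} {β : ι → S} {B : Set ι} {x : S}
    (h : ∀ n, ∃ l ∈ Lim I p β B, x - l ∈ I ^ n) : x ∈ Lim I p β B := by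
  intro n
  obtain ⟨l, hl, hxl⟩ := h (n + 1)
  obtain ⟨a, ha, hla⟩ := hl n
  refine ⟨a, ha, ?_⟩
  have : x - a = (x - l) + (l - a) := by ring
  rw [this]
  exact Ideal.add_mem _ hxl hla

variable {S : Type*} [CommRing S] [IsLocalRing S] {p : ℕ} [hp : Fact p.Prime] {β : ResidueField S → S} {B : Set (ResidueField S)}

lemma residue_mon (hβ : ∀ b, residue S (β b) = b) (f : ResidueField S →₀ ℕ) : residue S (mon β f) = mon id f := by
  simp [mon, Finsupp.prod, map_prod, map_pow, hβ]

lemma mem_max_iff (x : S) : x ∈ maximalIdeal S ↔ residue S x = 0 := (residue_eq_zero_iff x).symm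

/-- standing data -/
structure PD (p : ℕ) (β : ResidueField S → S) (B : Set (ResidueField S)) : Prop where
  pm : (p : S) ∈ maximalIdeal S
  lift : ∀ b, residue S (β b) = b
  ind : Indep p B
  span : ∀ c, c ∈ nxt p id B ⊤
  compl : IsAdicComplete (maximalIdeal S) S

lemma PD.y_mem (h : PD p β B) {Fs : Finset (ResidueField S →₀ ℕ)} {y : (ResidueField S →₀ ℕ) → S} {z x : S}
    (h1 : ∀ f ∈ Fs, Red p B f) (hx : x ∈ maximalIdeal S) (e : x = ∑ f ∈ Fs, y f ^ p * mon β f + p * z) :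
    ∀ f ∈ Fs, y f ∈ maximalIdeal S := by
  have hp0 : residue S (p : S) = 0 := (mem_max_iff _).1 h.pm
  have := congrArg (residue S) e
  rw [(mem_max_iff _).1 hx, map_add, map_mul, hp0, zero_mul, add_zero, map_sum] at this
  simp_rw [map_mul, map_pow, residue_mon h.lift] at this
  intro f hf
  rw [mem_max_iff]
  exact h.ind Fs (fun f => residue S (y f)) h1 this.symm f hf

lemma PD.K (h : PD p β B) (n : ℕ) : ∀ x ∈ Lam p β B (n + 1), x ∈ maximalIdeal S →
    ∃ u ∈ Lam p β B n, x - p * u ∈ maximalIdeal S ^ (n + 2) := by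
  induction n with
  | zero =>
    intro x hx hxm
    obtain ⟨Fs, y, z, h1, h2, -, h3, e⟩ := nf_of_mem (b_Lam p β B 0) hx
    refine ⟨z, h3, ?_⟩
    have hy := h.y_mem h1 hxm e
    rw [e, add_sub_cancel_right]
    refine Ideal.sum_mem _ fun f hf => Ideal.mul_mem_right _ _ ?_
    exact Ideal.pow_le_pow_right hp.out.two_le (Ideal.pow_mem_pow (hy f hf) p)
  | succ n ih =>
    intro x hx hxm
    obtain ⟨Fs, y, z, h1, h2, -, h3, e⟩ := nf_of_mem (b_Lam p β B (n + 1)) hx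
    have hy := h.y_mem h1 hxm e
    have key : ∀ f, ∃ t ∈ Lam p β B (n + 1), f ∈ Fs → y f ^ p - p * t ∈ maximalIdeal S ^ (n + 3) := by
      intro f
      by_cases hf : f ∈ Fs
      · obtain ⟨u, hu, huv⟩ := ih (y f) (h2 f) (hy f hf)
        obtain ⟨r, hr⟩ := exists_add_pow_prime_eq hp.out ((p : S) * u) (y f - p * u)
        refine ⟨(p : S) ^ (p - 1) * u ^ p, Subring.mul_mem _ (Subring.pow_mem _ (natCast_mem _ p) _) (pow_nxt hu), fun _ => ?_⟩
        have e1 : (p : S) * ((p : S) ^ (p - 1) * u ^ p) = (p * u) ^ p := by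
          rw [mul_pow, ← mul_assoc, mul_pow_sub_one hp.out.ne_zero]
        rw [add_sub_cancel] at hr
        rw [e1, hr]
        have e2 : (p * u) ^ p + (y f - p * u) ^ p + p * (p * u) * (y f - p * u) * r - (p * u) ^ p
          = (y f - p * u) ^ p + p * (y f - p * u) * (p * u * r) := by ring
        rw [e2]
        refine Ideal.add_mem _ ?_ (Ideal.mul_mem_right _ _ ?_)
        · have := Ideal.pow_mem_pow huv p
          rw [← pow_mul] at this
          refine Ideal.pow_le_pow_right ?_ this
          have := hp.out.two_le
          nlinarith
        · have := Ideal.mul_mem_mul h.pm huv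
          rw [← pow_succ'] at this
          exact this
      · exact ⟨0, Subring.zero_mem _, fun h => absurd h hf⟩
    choose t ht ht2 using key
    refine ⟨∑ f ∈ Fs, t f * mon β f + z, Subring.add_mem _ (Subring.sum_mem _ fun f hf =>
      Subring.mul_mem _ (ht f) (mon_mem (b_Lam p β B (n + 1)) (h1 f hf).sup)) h3, ?_⟩
    have : x - p * (∑ f ∈ Fs, t f * mon β f + z) = ∑ f ∈ Fs, (y f ^ p - p * t f) * mon β f := by
      rw [e]
      simp_rw [sub_mul, Finset.sum_sub_distrib, mul_assoc, ← Finset.mul_sum]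
      ring
    rw [this]
    exact Ideal.sum_mem _ fun f hf => Ideal.mul_mem_right _ _ (ht2 f hf)

lemma PD.R (h : PD p β B) (n : ℕ) : ∀ x, x ∈ Lam p β B n → ∃ x', x' ∈ Lam p β B (n + 1) ∧ x - x' ∈ maximalIdeal S ^ (n + 1) := by
  have hp0 : residue S (p : S) = 0 := (mem_max_iff _).1 h.pm
  induction n with
  | zero =>
    intro x _
    obtain ⟨Fs, y, z, h1, h2, -, h3, e⟩ := nf_of_mem (T := ⊤) (fun _ _ => Subring.mem_top _) (h.span (residue S x))
    refine ⟨∑ f ∈ Fs, β (y f) ^ p * mon β f, Subring.sum_mem _ fun f hf =>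
      Subring.mul_mem _ (pow_nxt (Subring.mem_top _)) (mon_mem (fun b hb => b_nxt hb) (h1 f hf).sup), ?_⟩
    have hp1 : ((p : ℕ) : ResidueField S) = 0 := by rw [← hp0, map_natCast]
    rw [zero_add, pow_one, mem_max_iff, map_sub, map_sum, e, hp1, zero_mul, add_zero, sub_eq_zero]
    refine Finset.sum_congr rfl fun f _ => ?_
    rw [map_mul, map_pow, h.lift, residue_mon h.lift]
  | succ n ih =>
    intro x hx
    obtain ⟨Fs, y, z, h1, h2, -, h3, e⟩ := nf_of_mem (b_Lam p β B n) hx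
    choose y' hy' hyy using fun f => ih (y f) (h2 f)
    obtain ⟨z', hz', hzz⟩ := ih z h3
    refine ⟨∑ f ∈ Fs, y' f ^ p * mon β f + p * z', Subring.add_mem _ (Subring.sum_mem _ fun f hf =>
      Subring.mul_mem _ (pow_nxt (hy' f)) (mon_mem (fun b hb => b_nxt hb) (h1 f hf).sup)) (p_nxt hz'), ?_⟩
    have : x - (∑ f ∈ Fs, y' f ^ p * mon β f + p * z') = ∑ f ∈ Fs, (y f ^ p - y' f ^ p) * mon β f + p * (z - z') := by
      rw [e]
      simp_rw [sub_mul, Finset.sum_sub_distrib]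
      ring
    rw [this]
    refine Ideal.add_mem _ (Ideal.sum_mem _ fun f hf => Ideal.mul_mem_right _ _ ?_) ?_
    · obtain ⟨r, hr⟩ := exists_add_pow_prime_eq hp.out (y' f) (y f - y' f)
      rw [add_sub_cancel] at hr
      rw [hr]
      have e2 : y' f ^ p + (y f - y' f) ^ p + p * y' f * (y f - y' f) * r - y' f ^ p
          = (y f - y' f) ^ p + p * (y f - y' f) * (y' f * r) := by ring
      rw [e2]
      refine Ideal.add_mem _ ?_ (Ideal.mul_mem_right _ _ ?_)
      · have := Ideal.pow_mem_pow (hyy f) p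
        rw [← pow_mul] at this
        refine Ideal.pow_le_pow_right ?_ this
        have := hp.out.two_le
        nlinarith
      · have := Ideal.mul_mem_mul h.pm (hyy f)
        rw [← pow_succ'] at this
        exact this
    · have := Ideal.mul_mem_mul h.pm hzz
      rw [← pow_succ'] at this
      exact this

lemma PD.D (h : PD p β B) (n : ℕ) (x : S) (hx : x ∈ Lam p β B n) :
    ∃ l ∈ Lim (maximalIdeal S) p β B, x - l ∈ maximalIdeal S ^ (n + 1) := by
  choose! r hr hr2 using h.R
  let a : ℕ → S := fun j => Nat.rec x (fun j y => r (n + j) y) j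
  have ha : ∀ j, a j ∈ Lam p β B (n + j) := by
    intro j
    induction j with
    | zero => exact hx
    | succ j ih => exact hr (n + j) (a j) ih
  obtain ⟨L, hL⟩ := exists_lim h.compl (n + 1) a (fun j => by
    have := hr2 (n + j) (a j) (ha j)
    exact Ideal.pow_le_pow_right (by omega) this)
  refine ⟨L, fun N => ⟨a (N - n), Lam_anti p β B (by omega) (ha (N - n)), ?_⟩, hL 0⟩
  rw [← neg_sub]
  exact (Ideal.neg_mem_iff _).2 (Ideal.pow_le_pow_right (by omega) (hL (N - n)))

lemma PD.E (h : PD p β B) (n : ℕ) (x : S) (hx : x ∈ Lim (maximalIdeal S) p β B) (hxm : x ∈ maximalIdeal S) :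
    ∃ l ∈ Lim (maximalIdeal S) p β B, x - p * l ∈ maximalIdeal S ^ n := by
  obtain ⟨a, ha, hxa⟩ := hx (n + 1)
  have ham : a ∈ maximalIdeal S := by
    have : a = x - (x - a) := by ring
    rw [this]
    exact Ideal.sub_mem _ hxm (Ideal.pow_le_self (by omega) hxa)
  obtain ⟨u, hu, hau⟩ := h.K n a ha ham
  obtain ⟨l, hl, hul⟩ := h.D n u hu
  refine ⟨l, hl, ?_⟩
  have : x - p * l = (x - a) + (a - p * u) + p * (u - l) := by ring
  rw [this]
  refine Ideal.add_mem _ (Ideal.add_mem _ (Ideal.pow_le_pow_right (by omega) hxa) (Ideal.pow_le_pow_right (by omega) hau))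
    (Ideal.mul_mem_left _ _ (Ideal.pow_le_pow_right (by omega) hul))

lemma PD.surj (h : PD p β B) (s : S) : ∃ l ∈ Lim (maximalIdeal S) p β B, s - l ∈ maximalIdeal S := by
  simpa using h.D 0 s (Subring.mem_top _)

lemma PD.inv (h : PD p β B) {x y : S} (hx : x ∈ Lim (maximalIdeal S) p β B) (hxy : x * y = 1) :
    y ∈ Lim (maximalIdeal S) p β B := by
  obtain ⟨l, hl, hyl⟩ := h.surj y
  have he : 1 - x * l ∈ maximalIdeal S := by
    have : 1 - x * l = x * (y - l) := by rw [mul_sub, hxy]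
    rw [this]; exact Ideal.mul_mem_left _ _ hyl
  have heL : 1 - x * l ∈ Lim (maximalIdeal S) p β B := Subring.sub_mem _ (Subring.one_mem _) (Subring.mul_mem _ hx hl)
  refine Lim_closed fun n => ⟨l * ∑ i ∈ Finset.range n, (1 - x * l) ^ i, Subring.mul_mem _ hl
    (Subring.sum_mem _ fun i _ => Subring.pow_mem _ heL i), ?_⟩
  have h1 := mul_neg_geom_sum (1 - x * l) n
  have : y - l * ∑ i ∈ Finset.range n, (1 - x * l) ^ i = y * (1 - x * l) ^ n := by
    rw [sub_sub_cancel] at h1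
    have h2 : (1 - x * l) ^ n = 1 - x * l * ∑ i ∈ Finset.range n, (1 - x * l) ^ i := by rw [h1]; ring
    generalize ∑ i ∈ Finset.range n, (1 - x * l) ^ i = Q at *
    rw [h2]
    linear_combination (l * Q) * hxy
  rw [this]
  exact Ideal.mul_mem_left _ _ (Ideal.pow_mem_pow he n)

lemma PD.inv' (h : PD p β B) {x : S} (hx : x ∈ Lim (maximalIdeal S) p β B) (hxm : x ∉ maximalIdeal S) :
    ∃ y ∈ Lim (maximalIdeal S) p β B, x * y = 1 := by
  have : IsUnit x := by
    by_contra hu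
    exact hxm ((mem_maximalIdeal x).2 hu)
  obtain ⟨y, hy⟩ := this.exists_right_inv
  exact ⟨y, h.inv hx hy, hy⟩

end CohP
end PartP2e

section PartP7a
open IsLocalRing

/-- A complete two-dimensional regular local ring with regular parameters `X`, `s`. -/
structure TwoDim (O : Type*) [CommRing O] [IsDomain O] [IsNoetherianRing O] [IsLocalRing O]
    (X s : O) : Prop where
  max_eq : maximalIdeal O = Ideal.span {X, s}
  primeX : Prime X
  not_dvd : ¬ X ∣ s
  complete : IsAdicComplete (maximalIdeal O) O

namespace TwoDim
variable {O : Type*} [CommRing O] [IsDomain O] [IsNoetherianRing O] [IsLocalRing O] {X s : O}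

lemma memX (h : TwoDim O X s) : X ∈ maximalIdeal O := by
  rw [h.max_eq]; exact Ideal.subset_span (by simp)

lemma mems (h : TwoDim O X s) : s ∈ maximalIdeal O := by
  rw [h.max_eq]; exact Ideal.subset_span (by simp)

lemma isPrime (h : TwoDim O X s) : (Ideal.span {X} : Ideal O).IsPrime :=
  (Ideal.span_singleton_prime h.primeX.ne_zero).2 h.primeX

lemma dvr (h : TwoDim O X s) :
    ∃ _ : IsDomain (O ⧸ Ideal.span {X}), ∃ _ : IsDiscreteValuationRing (O ⧸ Ideal.span {X}),
      Irreducible (Ideal.Quotient.mk (Ideal.span {X}) s) := by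
  have := h.isPrime
  have hd : IsDomain (O ⧸ Ideal.span {X}) := Ideal.Quotient.isDomain _
  have : IsLocalRing (O ⧸ Ideal.span {X}) :=
    IsLocalRing.of_surjective' (Ideal.Quotient.mk (Ideal.span {X})) Ideal.Quotient.mk_surjective
  have hm : maximalIdeal (O ⧸ Ideal.span {X}) =
      Ideal.span {Ideal.Quotient.mk (Ideal.span {X}) s} := by
    have h1 : maximalIdeal (O ⧸ Ideal.span {X}) =
      (maximalIdeal O).map (Ideal.Quotient.mk (Ideal.span {X})) := by
      symm
      refine IsLocalRing.eq_maximalIdeal ?_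
      refine (Ideal.map_eq_top_or_isMaximal_of_surjective _ Ideal.Quotient.mk_surjective
        (maximalIdeal.isMaximal O)).resolve_left ?_
      intro ht
      have h2 := congrArg (Ideal.comap (Ideal.Quotient.mk (Ideal.span {X}))) ht
      rw [Ideal.comap_map_of_surjective _ Ideal.Quotient.mk_surjective] at h2
      have h3 : Ideal.comap (Ideal.Quotient.mk (Ideal.span {X})) ⊥ ≤ maximalIdeal O := by
        rw [← RingHom.ker_eq_comap_bot, Ideal.mk_ker, Ideal.span_le]
        simpa using h.memX
      rw [sup_eq_left.2 h3, Ideal.comap_top] at h2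
      exact (maximalIdeal.isMaximal O).ne_top h2
    rw [h1, h.max_eq, Ideal.map_span, Set.image_pair]
    rw [Ideal.span_pair_eq_span_right_iff_dvd]
    rw [Ideal.Quotient.eq_zero_iff_mem.2 (Ideal.mem_span_singleton_self X)]
    simp
  have hs : Ideal.Quotient.mk (Ideal.span {X}) s ≠ 0 := by
    rw [Ne, Ideal.Quotient.eq_zero_iff_mem, Ideal.mem_span_singleton]; exact h.not_dvd
  have hnf : ¬ IsField (O ⧸ Ideal.span {X}) := by
    intro hf
    rw [IsLocalRing.isField_iff_maximalIdeal_eq, hm, Ideal.span_singleton_eq_bot] at hf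
    exact hs hf
  have hdvr : IsDiscreteValuationRing (O ⧸ Ideal.span {X}) := by
    refine ((IsDiscreteValuationRing.TFAE _ hnf).out 4 0).1 ?_
    exact ⟨⟨_, hm⟩⟩
  exact ⟨hd, hdvr, (IsDiscreteValuationRing.irreducible_iff_uniformizer _).2 hm⟩

/-- Elements not divisible by `X` are, modulo `X`, a unit times a power of `s`. -/
lemma exists_form (h : TwoDim O X s) {f : O} (hf : ¬ X ∣ f) :
    ∃ (v : ℕ) (c : O) (z : O), IsUnit c ∧ f = s ^ v * c + X * z := by
  obtain ⟨_, _, hirr⟩ := h.dvr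
  have hf0 : Ideal.Quotient.mk (Ideal.span {X}) f ≠ 0 := by
    rw [Ne, Ideal.Quotient.eq_zero_iff_mem, Ideal.mem_span_singleton]; exact hf
  obtain ⟨n, u, hu⟩ := IsDiscreteValuationRing.eq_unit_mul_pow_irreducible hf0 hirr
  obtain ⟨c, hc⟩ := Ideal.Quotient.mk_surjective (u : O ⧸ Ideal.span {X})
  rw [← hc, ← map_pow, ← map_mul, Ideal.Quotient.eq, Ideal.mem_span_singleton] at hu
  obtain ⟨z, hz⟩ := hu
  refine ⟨n, c, z, ?_, ?_⟩
  · by_contra hnu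
    have hcm : c ∈ maximalIdeal O := hnu
    rw [h.max_eq, Ideal.mem_span_pair] at hcm
    obtain ⟨a, b, hab⟩ := hcm
    have : IsUnit (Ideal.Quotient.mk (Ideal.span {X}) c) := by rw [hc]; exact u.isUnit
    rw [← hab, map_add, map_mul, Ideal.Quotient.eq_zero_iff_mem.2
      (Ideal.mem_span_singleton_self X), mul_zero, zero_add, map_mul] at this
    exact hirr.not_isUnit (isUnit_of_mul_isUnit_right this)
  · linear_combination hz

lemma not_dvd_pow (h : TwoDim O X s) (n : ℕ) : ¬ X ∣ s ^ n := fun hd =>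
  h.not_dvd (h.primeX.dvd_of_dvd_pow hd)

/-- comparing valuations modulo `X` -/
lemma val_le (h : TwoDim O X s) {n v : ℕ} {c z t : O} (hc : IsUnit c)
    (hh : s ^ v * c + X * z = s ^ n * t) : n ≤ v := by
  by_contra hlt
  push Not at hlt
  obtain ⟨d, rfl⟩ := Nat.exists_eq_add_of_lt hlt
  have h1 : X ∣ s ^ v * (s * s ^ d * t - c) := ⟨z, by linear_combination -hh⟩
  rcases h.primeX.dvd_or_dvd h1 with h2 | h2
  · exact h.not_dvd_pow _ h2
  · have : c ∈ maximalIdeal O := by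
      have e : c = s * s ^ d * t - (s * s ^ d * t - c) := by ring
      rw [e]
      exact Ideal.sub_mem _ (Ideal.mul_mem_right _ _ (Ideal.mul_mem_right _ _ h.mems))
        (Ideal.mem_of_dvd _ h2 h.memX)
    exact this hc

lemma mem_pow_succ (h : TwoDim O X s) {j : ℕ} {z : O} (hz : z ∈ maximalIdeal O ^ j) :
    ∃ w ∈ maximalIdeal O ^ (j - 1), ∃ t, z = X * w + s ^ j * t := by
  induction j generalizing z with
  | zero => exact ⟨0, by simp, z, by simp⟩
  | succ j ih =>
    rw [pow_succ] at hz
    refine Submodule.mul_induction_on hz ?_ ?_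
    · intro a ha b hb
      obtain ⟨w, hw, t, rfl⟩ := ih ha
      rw [h.max_eq, Ideal.mem_span_pair] at hb
      obtain ⟨p, q, rfl⟩ := hb
      refine ⟨(X * w + s ^ j * t) * p + w * (q * s), ?_, t * q, by ring⟩
      refine Ideal.add_mem _ (Ideal.mul_mem_right _ _ ha) ?_
      rcases j with _ | j
      · simp
      · simp only [Nat.add_sub_cancel] at hw ⊢
        rw [pow_succ]
        exact Ideal.mul_mem_mul hw (Ideal.mul_mem_left _ _ h.mems)
    · rintro _ _ ⟨w, hw, t, rfl⟩ ⟨w', hw', t', rfl⟩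
      exact ⟨w + w', Ideal.add_mem _ hw hw', t + t', by ring⟩

lemma cancelX (h : TwoDim O X s) {j : ℕ} {z : O} (hz : X * z ∈ maximalIdeal O ^ (j + 1)) :
    z ∈ maximalIdeal O ^ j := by
  obtain ⟨w, hw, t, ht⟩ := h.mem_pow_succ hz
  have h1 : X ∣ s ^ (j + 1) * t := ⟨z - w, by linear_combination -ht⟩
  obtain ⟨t', rfl⟩ := (h.primeX.dvd_or_dvd h1).resolve_left (h.not_dvd_pow _)
  have : z = w + s ^ (j+1) * t' := by
    apply mul_left_cancel₀ h.primeX.ne_zero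
    rw [ht]; ring
  rw [this]
  exact Ideal.add_mem _ hw (Ideal.mul_mem_right _ _
    (Ideal.pow_le_pow_right (Nat.le_succ j) (Ideal.pow_mem_pow h.mems _)))

lemma cancelXpow (h : TwoDim O X s) (c : ℕ) {j : ℕ} {z : O}
    (hz : X ^ c * z ∈ maximalIdeal O ^ (j + c)) : z ∈ maximalIdeal O ^ j := by
  induction c with
  | zero => simpa using hz
  | succ c ih =>
    apply ih
    apply h.cancelX
    rw [← mul_assoc, ← pow_succ']; exact hz

/-- factor out the powers of `X` -/
lemma exists_Xpow (h : TwoDim O X s) {f : O} (hf : f ≠ 0) :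
    ∃ (c : ℕ) (g : O), f = X ^ c * g ∧ ¬ X ∣ g := by
  obtain ⟨n, g, hg, hf⟩ := WfDvdMonoid.max_power_factor hf h.primeX.irreducible
  exact ⟨n, g, hf, hg⟩

/-- `X`-adic closedness of ideals -/
lemma mem_of_forall_X (h : TwoDim O X s) (I : Ideal O) {g : O}
    (hg : ∀ i : ℕ, ∃ a, g - X ^ i * a ∈ I) : g ∈ I := by
  by_contra hng
  have h1 := Ideal.iInf_pow_smul_eq_bot_of_isLocalRing (R := O) (M := O ⧸ I) (maximalIdeal O)
    (maximalIdeal.isMaximal O).ne_top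
  have h2 : (Ideal.Quotient.mk I g) ∈ (⨅ i : ℕ, maximalIdeal O ^ i • ⊤ : Submodule O (O ⧸ I)) := by
    rw [Submodule.mem_iInf]
    intro i
    obtain ⟨a, ha⟩ := hg i
    rw [Ideal.Quotient.eq.2 ha]
    have : (Ideal.Quotient.mk I) (X ^ i * a) = X ^ i • (Ideal.Quotient.mk I a) := rfl
    rw [this]
    exact Submodule.smul_mem_smul (Ideal.pow_mem_pow h.memX _) trivial
  rw [h1, Submodule.mem_bot, Ideal.Quotient.eq_zero_iff_mem] at h2
  exact hng h2

/-- key normality step -/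
lemma almost_int (h : TwoDim O X s) {g k d : O} (hk : ¬ X ∣ k) (hd : ¬ X ∣ d)
    (H : ∀ n : ℕ, k ^ n ∣ d * g ^ n) : ∃ q g1, g = k * q + X * g1 := by
  by_cases hg : X ∣ g
  · obtain ⟨g1, rfl⟩ := hg
    exact ⟨0, g1, by ring⟩
  obtain ⟨vk, ck, zk, hck, rfl⟩ := h.exists_form hk
  obtain ⟨vd, cd, zd, hcd, rfl⟩ := h.exists_form hd
  obtain ⟨vg, cg, zg, hcg, rfl⟩ := h.exists_form hg
  have hle : vk ≤ vg := by
    by_contra hlt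
    push Not at hlt
    obtain ⟨e, he⟩ := Nat.exists_eq_add_of_lt hlt
    obtain ⟨t, ht⟩ := H (vd + 1)
    obtain ⟨a, ha⟩ : X ∣ (s ^ vg * cg + X * zg) ^ (vd + 1) - (s ^ vg * cg) ^ (vd + 1) :=
      (Dvd.intro _ (by ring_nf : X * zg = (s ^ vg * cg + X * zg) - (s ^ vg * cg))).trans
        (sub_dvd_pow_sub_pow _ _ _)
    obtain ⟨b, hb⟩ : X ∣ (s ^ vk * ck + X * zk) ^ (vd + 1) - (s ^ vk * ck) ^ (vd + 1) :=
      (Dvd.intro _ (by ring_nf : X * zk = (s ^ vk * ck + X * zk) - (s ^ vk * ck))).trans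
        (sub_dvd_pow_sub_pow _ _ _)
    have hu : IsUnit (cd * cg ^ (vd + 1)) := hcd.mul (hcg.pow _)
    have := h.val_le (n := vk * (vd + 1)) (v := vd + vg * (vd + 1)) (t := ck ^ (vd+1) * t)
      (z := s ^ vd * cd * a + zd * (s ^ vg * cg + X * zg) ^ (vd + 1) - b * t) hu (by
        have e1 := sub_eq_iff_eq_add.1 ha
        have e2 := sub_eq_iff_eq_add.1 hb
        have e3 : s ^ (vk * (vd+1)) * (ck ^ (vd+1) * t) = (s ^ vk * ck) ^ (vd + 1) * t := by
          rw [mul_pow, ← pow_mul]; ring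
        have e4 : s ^ (vd + vg * (vd + 1)) * (cd * cg ^ (vd + 1)) =
          s ^ vd * cd * (s ^ vg * cg) ^ (vd + 1) := by
          rw [mul_pow, ← pow_mul, pow_add]; ring
        rw [e3, e4]
        linear_combination ht + t * hb - s ^ vd * cd * ha)
    subst he
    nlinarith
  obtain ⟨e, rfl⟩ := Nat.exists_eq_add_of_le hle
  obtain ⟨u, rfl⟩ := hck
  refine ⟨s ^ e * (↑u⁻¹ * cg), zg - zk * (s ^ e * (↑u⁻¹ * cg)), ?_⟩
  have : (u : O) * ↑u⁻¹ = 1 := u.mul_inv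
  rw [pow_add]
  linear_combination -s ^ vk * s ^ e * cg * this

lemma almost_int' (h : TwoDim O X s) {k d : O} (hk : ¬ X ∣ k) (hd : ¬ X ∣ d) (i : ℕ) :
    ∀ g : O, (∀ n : ℕ, k ^ n ∣ d * g ^ n) → ∃ a, g - X ^ i * a ∈ Ideal.span {k} := by
  induction i with
  | zero => intro g _; exact ⟨g, by simp⟩
  | succ i ih =>
    intro g H
    obtain ⟨q, g1, hg⟩ := h.almost_int hk hd H
    have H1 : ∀ n : ℕ, k ^ n ∣ d * g1 ^ n := by
      intro n
      have h1 : k ^ n ∣ d * (X * g1) ^ n := by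
        have e : X * g1 = g + (-q) * k := by rw [hg]; ring
        rw [e, add_pow, Finset.mul_sum]
        refine Finset.dvd_sum fun m hm => ?_
        have hmn : m ≤ n := Nat.lt_succ_iff.1 (Finset.mem_range.1 hm)
        obtain ⟨t, ht⟩ := H m
        refine ⟨t * (-q) ^ (n - m) * (n.choose m), ?_⟩
        have : k ^ n = k ^ m * k ^ (n - m) := by rw [← pow_add, Nat.add_sub_cancel' hmn]
        rw [this, mul_pow]
        linear_combination (-q) ^ (n - m) * k ^ (n - m) * (n.choose m) * ht
      obtain ⟨z, hz⟩ := h1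
      have h2 : X ^ n ∣ k ^ n * z := ⟨d * g1 ^ n, by rw [← hz, mul_pow]; ring⟩
      obtain ⟨z', rfl⟩ : X ^ n ∣ z := by
        refine h.primeX.pow_dvd_of_dvd_mul_left n ?_ h2
        exact fun hh => hk (h.primeX.dvd_of_dvd_pow hh)
      refine ⟨z', ?_⟩
      apply mul_left_cancel₀ (pow_ne_zero n h.primeX.ne_zero)
      rw [mul_pow] at hz
      linear_combination hz
    obtain ⟨a, ha⟩ := ih g1 H1
    refine ⟨a, ?_⟩
    have e : g - X ^ (i + 1) * a = k * q + X * (g1 - X ^ i * a) := by rw [hg]; ring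
    rw [e]
    exact Ideal.add_mem _ (Ideal.mul_mem_right _ _ (Ideal.mem_span_singleton_self k))
      (Ideal.mul_mem_left _ _ ha)

theorem normal (h : TwoDim O X s) : IsIntegrallyClosed O := by
  rw [isIntegrallyClosed_iff (FractionRing O)]
  intro x hx
  -- write x = g / k with X not dividing both
  obtain ⟨g, k, hk0, hxe⟩ := IsFractionRing.div_surjective (A := O) x
  have hk0' : k ≠ 0 := nonZeroDivisors.ne_zero hk0
  have dl : ∀ g k : O, algebraMap O (FractionRing O) k ≠ 0 →
      IsIntegral O (algebraMap O (FractionRing O) g / algebraMap O (FractionRing O) k) →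
      ∃ d : O, d ≠ 0 ∧ ∀ n : ℕ, k ^ n ∣ d * g ^ n := by
    intro g k hka hintg
    have hfg := hintg.fg_adjoin_singleton
    obtain ⟨S, hS⟩ := hfg
    obtain ⟨b, hb⟩ := IsLocalization.exist_integer_multiples_of_finset (nonZeroDivisors O) S
    refine ⟨b, nonZeroDivisors.ne_zero b.2, fun n => ?_⟩
    have hm : ∀ z ∈ Submodule.span O (S : Set (FractionRing O)),
        IsLocalization.IsInteger O (((b : O)) • z) := by
      intro z hz
      refine Submodule.span_induction ?_ ?_ ?_ ?_ hz
      · intro z hz; exact hb z hz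
      · exact ⟨0, by simp⟩
      · rintro x y _ _ ⟨a, ha⟩ ⟨b', hb'⟩; exact ⟨a + b', by rw [map_add, ha, hb', smul_add]⟩
      · rintro r x _ ⟨a, ha⟩; exact ⟨r * a, by rw [map_mul, ha, smul_comm, Algebra.smul_def r]⟩
    have hz : (algebraMap O (FractionRing O) g / algebraMap O (FractionRing O) k) ^ n ∈
        Submodule.span O (S : Set (FractionRing O)) := by
      rw [hS]
      exact Subalgebra.pow_mem _ (Algebra.self_mem_adjoin_singleton _ _) n
    obtain ⟨t, ht⟩ := hm _ hz
    refine ⟨t, ?_⟩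
    apply IsFractionRing.injective O (FractionRing O)
    rw [map_mul, map_mul, map_pow, map_pow, ht, Algebra.smul_def, div_pow]
    field_simp
  have key : ∀ (c : ℕ) (g k : O), k ≠ 0 → (∃ k0, k = X ^ c * k0 ∧ ¬ X ∣ k0) →
      IsIntegral O (algebraMap O (FractionRing O) g / algebraMap O (FractionRing O) k) →
      ∃ y, algebraMap O (FractionRing O) y =
        algebraMap O (FractionRing O) g / algebraMap O (FractionRing O) k := by
    intro c
    induction c with
    | zero =>
      rintro g k hk ⟨k0, hk1, hk2⟩ hintg
      simp only [pow_zero, one_mul] at hk1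
      subst hk1
      have hka : algebraMap O (FractionRing O) k ≠ 0 := by simpa using hk
      obtain ⟨d, hd0, hd⟩ := dl g k hka hintg
      obtain ⟨e, d0, rfl, hd0'⟩ := h.exists_Xpow hd0
      have hd' : ∀ n : ℕ, k ^ n ∣ d0 * g ^ n := by
        intro n
        obtain ⟨t, ht⟩ := hd n
        have h2 : X ^ e ∣ k ^ n * t := ⟨d0 * g ^ n, by rw [← ht]; ring⟩
        obtain ⟨z', rfl⟩ : X ^ e ∣ t := by
          refine h.primeX.pow_dvd_of_dvd_mul_left e ?_ h2
          exact fun hh => hk2 (h.primeX.dvd_of_dvd_pow hh)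
        refine ⟨z', ?_⟩
        apply mul_left_cancel₀ (pow_ne_zero e h.primeX.ne_zero)
        linear_combination ht
      have := h.mem_of_forall_X (Ideal.span {k}) (fun i => h.almost_int' hk2 hd0' i g hd')
      rw [Ideal.mem_span_singleton] at this
      obtain ⟨q, rfl⟩ := this
      exact ⟨q, by rw [map_mul]; field_simp⟩
    | succ c ih =>
      rintro g k hk ⟨k0, rfl, hk2⟩ hintg
      have hX0 : algebraMap O (FractionRing O) X ≠ 0 := by simpa using h.primeX.ne_zero
      have hk0 : k0 ≠ 0 := by rintro rfl; simp at hk2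
      have hk0a : algebraMap O (FractionRing O) k0 ≠ 0 := by simpa using hk0
      have hXg : X ∣ g := by
        by_contra hXg
        obtain ⟨d, hd0, hd⟩ := dl g _ (by simpa using hk) hintg
        obtain ⟨e, d0, rfl, hd0'⟩ := h.exists_Xpow hd0
        have h1 : X ^ (e + 1) ∣ X ^ e * d0 * g ^ (e + 1) :=
          (pow_dvd_pow_of_dvd (Dvd.intro (X ^ c * k0) (by ring)) _).trans (hd (e + 1))
        have h2 : X ^ (e + 1) ∣ X ^ e * d0 :=
          h.primeX.pow_dvd_of_dvd_mul_right _ (fun hh => hXg (h.primeX.dvd_of_dvd_pow hh)) h1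
        rw [pow_succ] at h2
        exact hd0' ((mul_dvd_mul_iff_left (pow_ne_zero e h.primeX.ne_zero)).1 h2)
      obtain ⟨g', rfl⟩ := hXg
      have e : algebraMap O (FractionRing O) (X * g') /
          algebraMap O (FractionRing O) (X ^ (c + 1) * k0) =
          algebraMap O (FractionRing O) g' / algebraMap O (FractionRing O) (X ^ c * k0) := by
        simp only [map_mul, map_pow, pow_succ]
        field_simp
      rw [e] at hintg ⊢
      exact ih g' _ (mul_ne_zero (pow_ne_zero _ h.primeX.ne_zero) hk0) ⟨k0, rfl, hk2⟩ hintg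
  obtain ⟨c, k0, hc, hk0''⟩ := h.exists_Xpow hk0'
  obtain ⟨y, hy⟩ := key c g k hk0' ⟨k0, hc, hk0''⟩ (by rw [hxe]; exact hx)
  exact ⟨y, by rw [hy, hxe]⟩

end TwoDim
end PartP7a

section PartP7b
open IsLocalRing

section series
variable {R : Type*} [CommRing R] {M : Type*} [AddCommGroup M] [Module R M]

lemma series_ring (I : Ideal R) [IsPrecomplete I R] (d : ℕ → R) (hd : ∀ n, d n ∈ I ^ n) :
    ∃ L, ∀ n, L - ∑ i ∈ Finset.range n, d i ∈ I ^ n := by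
  have hp := IsPrecomplete.prec (I := I) (M := R) inferInstance
    (f := fun n => ∑ i ∈ Finset.range n, d i) ?_
  · obtain ⟨L, hL⟩ := hp
    refine ⟨L, fun n => ?_⟩
    have := (hL n).symm
    rw [SModEq.sub_mem] at this
    simpa using this
  · intro m n hmn
    symm
    rw [SModEq.sub_mem]
    rw [← Finset.sum_range_add_sum_Ico _ hmn, add_sub_cancel_left]
    simp only [smul_eq_mul, Ideal.mul_top]
    exact Ideal.sum_mem _ fun i hi => Ideal.pow_le_pow_right (Finset.mem_Ico.1 hi).1 (hd i)

lemma series_module (I : Ideal R) [IsPrecomplete I R] [Module.Finite R M] (d : ℕ → M)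
    (hd : ∀ n, d n ∈ (I ^ n • ⊤ : Submodule R M)) :
    ∃ L, ∀ n, L - ∑ i ∈ Finset.range n, d i ∈ (I ^ n • ⊤ : Submodule R M) := by
  obtain ⟨k, g, hg⟩ := Module.Finite.exists_fin (R := R) (M := M)
  have hc : ∀ n, ∃ c : Fin k → R, (∀ i, c i ∈ I ^ n) ∧ ∑ i, c i • g i = d n := by
    intro n
    have := hd n
    rw [← hg, Submodule.mem_ideal_smul_span_iff_exists_sum] at this
    obtain ⟨a, ha, hs⟩ := this
    refine ⟨a, ha, ?_⟩
    rw [← hs, Finsupp.sum_fintype]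
    simp
  choose c hc hcs using hc
  choose L hL using fun i => series_ring I (fun n => c n i) (fun n => hc n i)
  refine ⟨∑ i, L i • g i, fun n => ?_⟩
  have : ∑ i, L i • g i - ∑ j ∈ Finset.range n, d j =
      ∑ i, (L i - ∑ j ∈ Finset.range n, c j i) • g i := by
    simp only [← hcs, sub_smul, Finset.sum_sub_distrib, Finset.sum_smul]
    rw [Finset.sum_comm]
  rw [this]
  exact Submodule.sum_mem _ fun i _ => Submodule.smul_mem_smul (hL i n) trivial

end series

/-- Chevalley's theorem. -/
lemma chevalley {R : Type*} [CommRing R] [IsLocalRing R] [IsNoetherianRing R]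
    [IsAdicComplete (maximalIdeal R) R] {M : Type*} [AddCommGroup M] [Module R M]
    [Module.Finite R M] (J : ℕ → Submodule R M) (hJ : Antitone J) (h0 : ⨅ n, J n = ⊥) (l : ℕ) :
    ∃ n, J n ≤ maximalIdeal R ^ l • ⊤ := by
  classical
  by_contra hcon
  push Not at hcon
  set m := maximalIdeal R with hm
  have hst : ∀ l, ∃ N, ∀ n, N ≤ n → J N ≤ J n ⊔ m ^ l • ⊤ := by
    intro l
    have : IsArtinian R (M ⧸ (m ^ l • ⊤ : Submodule R M)) := by
      have : IsArtinianRing (R ⧸ m ^ l) := by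
        rcases Nat.eq_zero_or_pos l with rfl | hl
        · have : Subsingleton (R ⧸ m ^ 0) := by
            rw [pow_zero, Ideal.one_eq_top]; exact Ideal.Quotient.subsingleton_iff.2 rfl
          infer_instance
        have hne : m ^ l ≠ ⊤ := fun h =>
          (maximalIdeal.isMaximal R).ne_top (top_le_iff.1 (h ▸ Ideal.pow_le_self hl.ne'))
        have : Nontrivial (R ⧸ m ^ l) := Ideal.Quotient.nontrivial_iff.2 hne
        have : IsLocalRing (R ⧸ m ^ l) :=
          IsLocalRing.of_surjective' (Ideal.Quotient.mk (m ^ l)) Ideal.Quotient.mk_surjective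
        rw [isArtinianRing_iff_isNilpotent_maximalIdeal]
        refine ⟨l, ?_⟩
        have : maximalIdeal (R ⧸ m ^ l) ≤ m.map (Ideal.Quotient.mk (m ^ l)) := by
          intro x hx
          obtain ⟨y, rfl⟩ := Ideal.Quotient.mk_surjective x
          refine Ideal.mem_map_of_mem _ ?_
          by_contra hy
          have hy' : IsUnit y := by simpa [hm] using hy
          exact hx (hy'.map _)
        refine le_bot_iff.1 ((Ideal.pow_right_mono this l).trans ?_)
        rw [← Ideal.map_pow, Ideal.map_quotient_self]
      have hfin : Module.Finite (R ⧸ m ^ l) (M ⧸ (m ^ l • ⊤ : Submodule R M)) :=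
        Module.Finite.of_restrictScalars_finite R _ _
      have hA : IsArtinian (R ⧸ m ^ l) (M ⧸ (m ^ l • ⊤ : Submodule R M)) := inferInstance
      exact isArtinian_of_surjective_algebraMap (S := R) (R := R ⧸ m ^ l) (M := M ⧸ (m ^ l • ⊤ : Submodule R M))
        Ideal.Quotient.mk_surjective
    obtain ⟨N, hN⟩ := IsArtinian.monotone_stabilizes
      (R := R) (M := M ⧸ (m ^ l • ⊤ : Submodule R M))
      ⟨fun n => OrderDual.toDual ((J n).map (Submodule.mkQ _)),
        fun a b hab => Submodule.map_mono (hJ hab)⟩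
    refine ⟨N, fun n hn => ?_⟩
    have h1 := hN n hn
    have h2 : (J N).map (Submodule.mkQ (m ^ l • ⊤)) = (J n).map (Submodule.mkQ (m ^ l • ⊤)) := h1
    intro x hx
    have hx' : Submodule.mkQ (m ^ l • ⊤) x ∈ (J n).map (Submodule.mkQ (m ^ l • ⊤)) := by
      rw [← h2]; exact Submodule.mem_map_of_mem hx
    obtain ⟨y, hy, hxy⟩ := hx'
    have : x - y ∈ (m ^ l • ⊤ : Submodule R M) := by
      simpa using (Submodule.Quotient.eq _).1 hxy.symm
    rw [← add_sub_cancel y x]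
    exact Submodule.add_mem_sup hy this
  choose N0 hN0 using hst
  -- make it monotone
  let N : ℕ → ℕ := fun l => ∑ i ∈ Finset.range (l + 1), N0 i
  have hNmono : Monotone N := fun a b hab => Finset.sum_le_sum_of_subset
    (Finset.range_mono (by omega))
  have hN0N : ∀ l, N0 l ≤ N l := fun l => Finset.single_le_sum (f := N0) (fun _ _ => Nat.zero_le _)
    (Finset.mem_range.2 (Nat.lt_succ_self l))
  have hN : ∀ l n, J (N l) ≤ J n ⊔ m ^ l • ⊤ := by
    intro l n
    rcases le_total (N0 l) n with h | h
    · exact (hJ (hN0N l)).trans (hN0 l n h)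
    · exact (hJ (h.trans (hN0N l))).trans le_sup_left
  obtain ⟨b0, hb0, hb0n⟩ := Set.not_subset.1 (hcon (N l))
  have step : ∀ k, ∀ b : J (N (l + k)), ∃ b' : J (N (l + (k + 1))),
      (b' : M) - b ∈ (m ^ (l + k) • ⊤ : Submodule R M) := by
    rintro k ⟨b, hb⟩
    obtain ⟨y, hy, z, hz, hyz⟩ := Submodule.mem_sup.1 (hN (l + k) (N (l + (k+1))) hb)
    refine ⟨⟨y, hy⟩, ?_⟩
    have : y - b = -z := by rw [← hyz]; abel
    simp only [this]
    exact Submodule.neg_mem _ hz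
  choose nxt hnxt using step
  let b : (k : ℕ) → J (N (l + k)) := fun k =>
    Nat.rec (motive := fun k => J (N (l + k))) ⟨b0, hb0⟩ (fun k b => nxt k b) k
  have hb : ∀ k, ((b (k + 1) : J (N (l + (k + 1)))) : M) - ((b k : J (N (l + k))) : M) ∈ (m ^ (l + k) • ⊤ : Submodule R M) := fun k => hnxt k (b k)
  obtain ⟨L, hL⟩ := series_module m (fun k => (b (k + 1) : M) - b k)
    (fun n => Submodule.smul_mono_left (Ideal.pow_le_pow_right (by omega)) (hb n))
  have hsum : ∀ n, ∑ i ∈ Finset.range n, ((b (i + 1) : M) - b i) = b n - b0 := by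
    intro n
    rw [Finset.sum_range_sub (fun i => (b i : M))]
    rfl
  simp only [hsum] at hL
  have hL0 : L + b0 ∈ ⨅ n, J n := by
    rw [Submodule.mem_iInf]
    intro n
    have h1 : ∀ k, L + b0 ∈ J n ⊔ m ^ k • ⊤ := by
      intro k
      have e : L + b0 = b k + (L - (b k - b0)) := by abel
      rw [e]
      have h5 : J n ⊔ m ^ (l + k) • ⊤ ≤ J n ⊔ m ^ k • ⊤ :=
        sup_le_sup_left (Submodule.smul_mono_left (Ideal.pow_le_pow_right (by omega))) _
      exact Submodule.add_mem _ (h5 (hN (l + k) n (b k).2)) (Submodule.mem_sup_right (hL k))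
    have hk := Ideal.iInf_pow_smul_eq_bot_of_isLocalRing (R := R) (M := M ⧸ J n) m
      (maximalIdeal.isMaximal R).ne_top
    have : Submodule.mkQ (J n) (L + b0) ∈ (⨅ i : ℕ, m ^ i • ⊤ : Submodule R (M ⧸ J n)) := by
      rw [Submodule.mem_iInf]
      intro k
      obtain ⟨y, hy, z, hz, hyz⟩ := Submodule.mem_sup.1 (h1 k)
      rw [← hyz, map_add, Submodule.mkQ_apply, (Submodule.Quotient.mk_eq_zero _).2 hy, zero_add]
      have := Submodule.mem_map_of_mem (f := Submodule.mkQ (J n)) hz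
      rw [Submodule.map_smul''] at this
      exact Submodule.smul_mono le_rfl le_top this
    rw [hk, Submodule.mem_bot, Submodule.mkQ_apply, Submodule.Quotient.mk_eq_zero] at this
    exact this
  rw [h0, Submodule.mem_bot] at hL0
  apply hb0n
  -- L = -b0; need sharper: b l ...
  have h2 := hL l
  have h3 : ∀ k, (b k : M) - b0 ∈ (m ^ l • ⊤ : Submodule R M) := by
    intro k
    rw [← hsum]
    exact Submodule.sum_mem _ fun i _ =>
      Submodule.smul_mono_left (Ideal.pow_le_pow_right (by omega)) (hb i)
  have h4 := Submodule.neg_mem _ (Submodule.add_mem _ h2 (h3 l))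
  have e : b0 = -(L - (↑(b l) - b0) + (↑(b l) - b0)) := by
    rw [sub_add_cancel]; exact (neg_eq_of_add_eq_zero_right hL0).symm
  show b0 ∈ (m ^ l • ⊤ : Submodule R M)
  rw [e]; exact h4
end PartP7b

section PartP6a
open IsLocalRing

namespace Dense
variable {O T : Type*} [CommRing O] [CommRing T] [IsLocalRing T]

lemma mem_pow_pair {O : Type*} [CommRing O] (X s : O) {j : ℕ} {z : O} (hz : z ∈ Ideal.span {X, s} ^ j) :
    ∃ w ∈ Ideal.span {X, s} ^ (j - 1), ∃ t, z = X * w + s ^ j * t := by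
  induction j generalizing z with
  | zero => exact ⟨0, by simp, z, by simp⟩
  | succ j ih =>
    rw [pow_succ'] at hz
    refine Submodule.mul_induction_on hz ?_ ?_
    · intro a ha b hb
      obtain ⟨p, q, rfl⟩ := Ideal.mem_span_pair.1 ha
      obtain ⟨w, hw, t, rfl⟩ := ih hb
      refine ⟨p * (X * w + s ^ j * t) + q * s * w, ?_, q * t, by ring⟩
      refine Ideal.add_mem _ (Ideal.mul_mem_left _ _ hb) ?_
      rcases j with _ | j
      · simp
      · simp only [Nat.add_sub_cancel] at hw ⊢
        rw [pow_succ']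
        refine Ideal.mul_mem_mul (Ideal.mul_mem_left _ _ (Ideal.subset_span (by simp))) hw
    · rintro a b ⟨w, hw, t, rfl⟩ ⟨w', hw', t', rfl⟩
      exact ⟨w + w', Ideal.add_mem _ hw hw', t + t', by ring⟩

lemma cancel {O : Type*} [CommRing O] {X s : O} (hreg : ∀ a, X * a = 0 → a = 0)
    (hs : ∀ a, X ∣ s * a → X ∣ a) {j : ℕ} {z : O} (hz : X * z ∈ Ideal.span {X, s} ^ (j + 1)) :
    z ∈ Ideal.span {X, s} ^ j := by
  obtain ⟨w, hw, t, ht⟩ := mem_pow_pair X s hz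
  have h1 : ∀ n, X ∣ s ^ n * t → X ∣ t := by
    intro n
    induction n with
    | zero => simp
    | succ n ih => intro h; rw [pow_succ', mul_assoc] at h; exact ih (hs _ h)
  obtain ⟨t', rfl⟩ := h1 (j + 1) ⟨z - w, by linear_combination -ht⟩
  have h2 : z = w + s ^ (j + 1) * t' := by
    rw [← sub_eq_zero]
    apply hreg; linear_combination ht
  rw [h2]
  refine Ideal.add_mem _ hw (Ideal.mul_mem_right _ _ ?_)
  exact Ideal.pow_le_pow_right (Nat.le_succ j) (Ideal.pow_mem_pow (Ideal.subset_span (by simp)) _)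

theorem twoDim_of_dense (i : O →+* T) (X s : O)
    (hreg : ∀ a, X * a = 0 → a = 0) (hs : ∀ a, X ∣ s * a → X ∣ a)
    (hform : ∀ f, ¬ X ∣ f → ∃ (v : ℕ) (c z : O), IsUnit c ∧ f = s ^ v * c + X * z)
    (hmax : maximalIdeal T = Ideal.span {i X, i s})
    [hcomp : IsAdicComplete (maximalIdeal T) T]
    (hdense : ∀ (t : T) (j : ℕ), ∃ o, t - i o ∈ maximalIdeal T ^ j)
    (hcontr : ∀ (o : O) (j : ℕ), i o ∈ maximalIdeal T ^ j → o ∈ Ideal.span {X, s} ^ j) :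
    ∃ (_ : IsDomain T) (_ : IsNoetherianRing T), TwoDim T (i X) (i s) := by
  set m := maximalIdeal T with hm
  have hXm : i X ∈ m := by rw [hmax]; exact Ideal.subset_span (by simp)
  have hsm : i s ∈ m := by rw [hmax]; exact Ideal.subset_span (by simp)
  have hmap : ∀ (o : O) (j : ℕ), o ∈ Ideal.span {X, s} ^ j → i o ∈ m ^ j := by
    intro o j ho
    have : (Ideal.span {X, s}).map i = m := by
      rw [hmax, Ideal.map_span, Set.image_pair]
    rw [← this, ← Ideal.map_pow]
    exact Ideal.mem_map_of_mem _ ho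
  have haus : ∀ t : T, (∀ j, t ∈ m ^ j) → t = 0 := by
    intro t ht
    exact IsHausdorff.haus hcomp.toIsHausdorff t (fun n => by
      rw [SModEq.zero, smul_eq_mul, Ideal.mul_top]; exact ht n)
  -- cancellation in T
  have hcancel : ∀ (z : T) (j : ℕ), i X * z ∈ m ^ (j + 1) → z ∈ m ^ j := by
    intro z j hz
    obtain ⟨o, ho⟩ := hdense z (j + 1)
    have h1 : i (X * o) ∈ m ^ (j + 1) := by
      rw [map_mul, show i X * i o = i X * z - i X * (z - i o) by ring]
      exact Ideal.sub_mem _ hz (Ideal.mul_mem_left _ _ ho)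
    have h2 := hmap _ _ (cancel hreg hs (hcontr _ _ h1))
    rw [show z = (z - i o) + i o by ring]
    exact Ideal.add_mem _ (Ideal.pow_le_pow_right (Nat.le_succ j) ho) h2
  have hregT : ∀ z : T, i X * z = 0 → z = 0 := by
    intro z hz
    exact haus z fun j => hcancel z j (by rw [hz]; exact zero_mem _)
  -- closedness of (X)
  have hclosed : ∀ f : T, (∀ j, ∃ g, f - i X * g ∈ m ^ j) → i X ∣ f := by
    intro f hf
    choose g hg using fun j => hf (j + 1)
    obtain ⟨L, hL⟩ := hcomp.toIsPrecomplete.prec (f := g) (by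
      intro a b hab
      rw [SModEq.sub_mem, smul_eq_mul, Ideal.mul_top]
      apply hcancel
      rw [show i X * (g a - g b) = (f - i X * g b) - (f - i X * g a) by ring]
      exact Ideal.sub_mem _ (Ideal.pow_le_pow_right (by omega) (hg b)) (hg a))
    refine ⟨L, ?_⟩
    rw [← sub_eq_zero]
    apply haus
    intro j
    have := hL j
    rw [SModEq.sub_mem, smul_eq_mul, Ideal.mul_top] at this
    rw [show f - i X * L = (f - i X * g j) + i X * (g j - L) by ring]
    exact Ideal.add_mem _ (Ideal.pow_le_pow_right (by omega) (hg j)) (Ideal.mul_mem_left _ _ this)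
  have hformT : ∀ f : T, ¬ i X ∣ f → ∃ (v : ℕ) (c z : T), IsUnit c ∧ f = i s ^ v * c + i X * z := by
    intro f hf
    have : ∃ j, ∀ g, f - i X * g ∉ m ^ j := by
      by_contra hh; push Not at hh; exact hf (hclosed f hh)
    obtain ⟨j, hj⟩ := this
    obtain ⟨o, ho⟩ := hdense f j
    have ho' : ¬ X ∣ o := by
      rintro ⟨g, rfl⟩
      exact hj (i g) (by simpa using ho)
    obtain ⟨v, c, z, hc, rfl⟩ := hform o ho'
    have hvj : v < j := by
      by_contra hle
      push Not at hle
      apply hj (i z)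
      rw [show f - i X * i z = (f - i (s ^ v * c + X * z)) + i s ^ v * i c by
        simp only [map_add, map_mul, map_pow]; ring]
      exact Ideal.add_mem _ ho (Ideal.mul_mem_right _ _ (Ideal.pow_le_pow_right hle
        (Ideal.pow_mem_pow hsm _)))
    rw [hmax] at ho
    obtain ⟨w, -, t, ht⟩ := mem_pow_pair _ _ ho
    obtain ⟨d, rfl⟩ := Nat.exists_eq_add_of_lt hvj
    refine ⟨v, i c + i s ^ (d + 1) * t, i z + w, ?_, ?_⟩
    · have h1 : i s ^ (d + 1) * t ∈ m :=
        Ideal.mul_mem_right _ _ (Ideal.pow_mem_of_mem _ hsm _ (Nat.succ_pos d))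
      by_contra hnu
      have h2 := (mem_maximalIdeal _).2 hnu
      have h3 := Ideal.sub_mem _ h2 h1
      rw [add_sub_cancel_right] at h3
      exact (mem_maximalIdeal _).1 h3 (hc.map i)
    · simp only [map_add, map_mul, map_pow] at ht
      linear_combination ht
  have hnd : ∀ (v : ℕ) (c : T), IsUnit c → ¬ i X ∣ i s ^ v * c := by
    intro v c hc hd
    have h1 : i X ∣ i s ^ v := (IsUnit.dvd_mul_right hc).1 hd
    obtain ⟨g, hg⟩ := h1
    obtain ⟨o, ho⟩ := hdense g (v + 1)
    have h2 : i (s ^ v - X * o) ∈ m ^ (v + 1) := by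
      rw [map_sub, map_pow, hg, map_mul, ← mul_sub]
      exact Ideal.mul_mem_left _ _ ho
    obtain ⟨w, -, t, ht⟩ := mem_pow_pair _ _ (hcontr _ _ h2)
    have h3 : ∀ n a, X ∣ s ^ n * a → X ∣ a := by
      intro n a
      induction n with
      | zero => simp
      | succ n ih => intro h; rw [pow_succ', mul_assoc] at h; exact ih (hs _ h)
    obtain ⟨q, hq⟩ := h3 v (1 - s * t) ⟨o + w, by linear_combination ht⟩
    have h4 : i (X * q + s * t) = 1 := by rw [← hq]; simp
    have h5 : (1 : T) ∈ m := by
      rw [← h4, map_add, map_mul, map_mul]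
      exact Ideal.add_mem _ (Ideal.mul_mem_right _ _ hXm) (Ideal.mul_mem_right _ _ hsm)
    exact (mem_maximalIdeal _).1 h5 isUnit_one
  have hprime : ∀ a b, i X ∣ a * b → i X ∣ a ∨ i X ∣ b := by
    intro a b hab
    by_contra hh
    push Not at hh
    obtain ⟨v, c, z, hc, rfl⟩ := hformT a hh.1
    obtain ⟨v', c', z', hc', rfl⟩ := hformT b hh.2
    apply hnd (v + v') (c * c') (hc.mul hc')
    have : i X ∣ i X * (z * (i s ^ v' * c' + i X * z') + i s ^ v * c * z') := dvd_mul_right _ _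
    refine (dvd_sub hab this).trans (dvd_of_eq ?_)
    ring
  have hX0 : i X ≠ 0 := by
    intro h0
    exact hnd 0 1 isUnit_one (by
      have := hregT 1 (by rw [h0, zero_mul])
      rw [pow_zero, one_mul, this]; exact dvd_zero _)
  have hfac : ∀ f : T, f ≠ 0 → ∃ (n : ℕ) (g : T), f = i X ^ n * g ∧ ¬ i X ∣ g := by
    intro f hf
    by_contra hh
    push Not at hh
    have : ∀ n, i X ^ n ∣ f := by
      intro n
      induction n with
      | zero => simp
      | succ n ih =>
        obtain ⟨g, hg⟩ := ih
        obtain ⟨g', rfl⟩ := hh n g hg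
        exact ⟨g', by rw [hg]; ring⟩
    apply hf
    apply haus
    intro j
    obtain ⟨g, rfl⟩ := this j
    exact Ideal.mul_mem_right _ _ (Ideal.pow_mem_pow hXm _)
  have hregn : ∀ n (z : T), i X ^ n * z = 0 → z = 0 := by
    intro n z
    induction n with
    | zero => simp
    | succ n ih => intro h; rw [pow_succ', mul_assoc] at h; exact ih (hregT _ h)
  have hnzd : NoZeroDivisors T := ⟨by
    intro a b hab
    by_contra hh
    push Not at hh
    obtain ⟨n, a', rfl, ha⟩ := hfac a hh.1
    obtain ⟨n', b', rfl, hb⟩ := hfac b hh.2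
    have : a' * b' = 0 := hregn (n + n') _ (by rw [← hab]; ring)
    rcases hprime a' b' (this ▸ dvd_zero _) with h | h
    · exact ha h
    · exact hb h⟩
  have hdom : IsDomain T := NoZeroDivisors.to_isDomain T
  have hXprime : Prime (i X) := ⟨hX0, fun hu => (mem_maximalIdeal _).1 hXm hu, hprime⟩
  have hsnd : ¬ i X ∣ i s := by simpa using hnd 1 1 isUnit_one
  have hnoeth : IsNoetherianRing T := by
    apply IsNoetherianRing.of_prime
    intro P hP
    by_cases hXP : i X ∈ P
    · by_cases hle : P ≤ Ideal.span {i X}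
      · have : P = Ideal.span {i X} := le_antisymm hle (by
          rw [Ideal.span_singleton_le_iff_mem]; exact hXP)
        rw [this]; exact ⟨{i X}, by simp⟩
      · obtain ⟨f, hfP, hf⟩ := SetLike.not_le_iff_exists.1 hle
        rw [Ideal.mem_span_singleton] at hf
        obtain ⟨v, c, z, hc, rfl⟩ := hformT f hf
        have h1 : i s ^ v * c ∈ P := by
          have := P.sub_mem hfP (P.mul_mem_right z hXP)
          rwa [add_sub_cancel_right] at this
        have h2 : i s ^ v ∈ P := (hP.mem_or_mem h1).resolve_right
          (fun h => hP.ne_top (P.eq_top_of_isUnit_mem h hc))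
        have h3 : i s ∈ P := hP.mem_of_pow_mem _ h2
        have : P = Ideal.span {i X, i s} := by
          refine le_antisymm ?_ ?_
          · rw [← hmax]; exact le_maximalIdeal hP.ne_top
          · rw [Ideal.span_le]; intro y hy
            rcases hy with rfl | rfl <;> assumption
        classical
        rw [this]; exact ⟨{i X, i s}, by simp⟩
    · by_cases hle : P ≤ Ideal.span {i X}
      · have : P = ⊥ := by
          rw [eq_bot_iff]
          intro f hf
          by_contra hf0
          obtain ⟨n, g, rfl, hg⟩ := hfac f hf0
          rcases hP.mem_or_mem hf with h | h
          · exact hXP (hP.mem_of_pow_mem _ h)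
          · exact hg (Ideal.mem_span_singleton.1 (hle h))
        rw [this]; exact Submodule.fg_bot
      · classical
        have hex : ∃ v : ℕ, ∃ c z : T, IsUnit c ∧ i s ^ v * c + i X * z ∈ P := by
          obtain ⟨f, hfP, hf⟩ := SetLike.not_le_iff_exists.1 hle
          rw [Ideal.mem_span_singleton] at hf
          obtain ⟨v, c, z, hc, rfl⟩ := hformT f hf
          exact ⟨v, c, z, hc, hfP⟩
        obtain ⟨c, z, hc, hfP⟩ := Nat.find_spec hex
        have hmin := fun v (hv : v < Nat.find hex) => Nat.find_min hex hv
        set v := Nat.find hex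
        set f := i s ^ v * c + i X * z with hf
        have hdiv : ∀ g ∈ P, ∃ q, ∃ g1 ∈ P, g = f * q + i X * g1 := by
          intro g hg
          have : ∃ q g1, g = f * q + i X * g1 := by
            by_cases hXg : i X ∣ g
            · obtain ⟨g1, rfl⟩ := hXg
              exact ⟨0, g1, by ring⟩
            · obtain ⟨v', c', z', hc', rfl⟩ := hformT g hXg
              have hvv : v ≤ v' := by
                by_contra hlt
                push Not at hlt
                exact hmin v' hlt ⟨c', z', hc', hg⟩
              obtain ⟨d, rfl⟩ := Nat.exists_eq_add_of_le hvv
              obtain ⟨c, rfl⟩ := hc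
              refine ⟨i s ^ d * c' * ↑c⁻¹, z' - z * (i s ^ d * c' * ↑c⁻¹), ?_⟩
              have : (c : T) * ↑c⁻¹ = 1 := by simp
              rw [hf]
              linear_combination (-(i s ^ (v + d) * c')) * this
          obtain ⟨q, g1, hg1⟩ := this
          refine ⟨q, g1, ?_, hg1⟩
          have h1 : i X * g1 ∈ P := by
            rw [show i X * g1 = g - f * q by rw [hg1]; ring]
            exact P.sub_mem hg (P.mul_mem_right _ hfP)
          exact (hP.mem_or_mem h1).resolve_left hXP
        have : P = Ideal.span {f} := by
          refine le_antisymm ?_ (by rw [Ideal.span_singleton_le_iff_mem]; exact hfP)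
          intro g hg
          choose! q g1 hg1P hg1 using hdiv
          let G : ℕ → T := fun n => g1^[n] g
          have hG : ∀ n, G n ∈ P := by
            intro n
            induction n with
            | zero => exact hg
            | succ n ih => simp only [G, Function.iterate_succ_apply']; exact hg1P _ ih
          have hG' : ∀ n, G n = f * q (G n) + i X * G (n + 1) := by
            intro n
            have := hg1 _ (hG n)
            simp only [G, Function.iterate_succ_apply'] at this ⊢
            exact this
          obtain ⟨L, hL⟩ := series_ring m (fun n => i X ^ n * q (G n)) (fun n =>
            Ideal.mul_mem_right _ _ (Ideal.pow_mem_pow hXm _))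
          have hsum : ∀ n, g = f * ∑ k ∈ Finset.range n, i X ^ k * q (G k) + i X ^ n * G n := by
            intro n
            induction n with
            | zero => simp [G]
            | succ n ih =>
              rw [Finset.sum_range_succ]
              conv_lhs => rw [ih, hG' n]
              ring
          rw [Ideal.mem_span_singleton]
          refine ⟨L, ?_⟩
          rw [← sub_eq_zero]
          apply haus
          intro j
          have h1 := hL j
          have h2 := hsum j
          rw [show g - f * L = i X ^ j * G j - f * (L - ∑ k ∈ Finset.range j, i X ^ k * q (G k)) by
            conv_lhs => rw [h2]
            ring]
          exact Ideal.sub_mem _ (Ideal.mul_mem_right _ _ (Ideal.pow_mem_pow hXm _))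
            (Ideal.mul_mem_left _ _ h1)
        rw [this]; exact ⟨{f}, by simp⟩
  exact ⟨hdom, hnoeth, ⟨hmax, hXprime, hsnd, hcomp⟩⟩

end Dense
end PartP6a

section PartP6b
open IsLocalRing

/-- The data of the (extended Rees type) deformation of a local ring `A` to its tangent cone,
which is assumed to be a polynomial ring. -/
structure BlowData {A Q k σ : Type*} [CommRing A] [IsLocalRing A] [CommRing Q] [Field k]
    (x : σ → A) (u : σ → Q) (t : Q) (φ : A →+* Q) (ψ : Q →+* MvPolynomial σ k) (res : A →+* k) :
    Prop where
  span_x : maximalIdeal A = Ideal.span (Set.range x)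
  hx : ∀ i, φ (x i) = t * u i
  hu : ∀ i, ψ (u i) = MvPolynomial.X i
  hφ : ∀ a, ψ (φ a) = MvPolynomial.C (res a)
  res_ker : ∀ a, res a = 0 ↔ a ∈ maximalIdeal A
  res_surj : Function.Surjective res
  surj : Function.Surjective ψ
  ker : ∀ r, ψ r = 0 ↔ t ∣ r
  reg : ∀ a, t * a = 0 → a = 0

namespace AdicAux
variable {O : Type*} [CommRing O] [IsLocalRing O]

lemma mem_pow_iff (hfg : (maximalIdeal O).FG) [IsLocalRing (AdicCompletion (maximalIdeal O) O)]
    (z : AdicCompletion (maximalIdeal O) O) (j : ℕ) :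
    z ∈ maximalIdeal (AdicCompletion (maximalIdeal O) O) ^ j ↔
      AdicCompletion.eval (maximalIdeal O) O j z = 0 := by
  rw [AdicCompletion.maximalIdeal_eq_map_of_fg hfg, ← Ideal.map_pow, ← LinearMap.mem_ker,
    ← AdicCompletion.pow_smul_top_eq_ker_eval hfg, Ideal.smul_top_eq_map]
  rfl

lemma dense (hfg : (maximalIdeal O).FG) [IsLocalRing (AdicCompletion (maximalIdeal O) O)]
    (z : AdicCompletion (maximalIdeal O) O) (j : ℕ) :
    ∃ o : O, z - algebraMap O _ o ∈ maximalIdeal (AdicCompletion (maximalIdeal O) O) ^ j := by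
  obtain ⟨o, ho⟩ := Submodule.mkQ_surjective _ (AdicCompletion.eval (maximalIdeal O) O j z)
  refine ⟨o, ?_⟩
  rw [mem_pow_iff hfg, map_sub, sub_eq_zero, ← ho]
  rfl

lemma contr (hfg : (maximalIdeal O).FG) [IsLocalRing (AdicCompletion (maximalIdeal O) O)] (o : O) (j : ℕ)
    (h : algebraMap O (AdicCompletion (maximalIdeal O) O) o ∈
      maximalIdeal (AdicCompletion (maximalIdeal O) O) ^ j) : o ∈ maximalIdeal O ^ j := by
  rw [mem_pow_iff hfg] at h
  have h2 : Submodule.mkQ (maximalIdeal O ^ j • ⊤ : Submodule O O) o = 0 := h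
  rw [Submodule.mkQ_apply, Submodule.Quotient.mk_eq_zero, smul_eq_mul, Ideal.mul_top] at h2
  exact h2

end AdicAux

universe w
theorem BlowData.chart {A k σ : Type*} {Q : Type w} [CommRing A] [IsLocalRing A] [CommRing Q] [Field k]
    {x : σ → A} {u : σ → Q} {t : Q} {φ : A →+* Q} {ψ : Q →+* MvPolynomial σ k} {res : A →+* k}
    (h : BlowData x u t φ ψ res) (π : MvPolynomial σ k) (hπ : Prime π) :
    ∃ (T : Type w) (_ : CommRing T) (_ : IsLocalRing T) (_ : IsDomain T) (_ : IsNoetherianRing T)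
      (j : Q →+* T) (s0 : Q), ψ s0 = π ∧ TwoDim T (j t) (j s0) ∧
      ∀ r n, j r ∈ Ideal.span {j t, j s0 ^ n} → π ^ n ∣ ψ r := by
  obtain ⟨s0, hs0⟩ := h.surj π
  let 𝔭 : Ideal Q := (Ideal.span {π}).comap ψ
  have hpi : (Ideal.span {π}).IsPrime := (Ideal.span_singleton_prime hπ.ne_zero).2 hπ
  have hp : 𝔭.IsPrime := Ideal.comap_isPrime _ _
  have hmem : ∀ a, a ∈ 𝔭 ↔ π ∣ ψ a := fun a => by
    rw [Ideal.mem_comap, Ideal.mem_span_singleton]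
  let O := Localization.AtPrime 𝔭
  let i0 : Q →+* O := algebraMap Q O
  have hne0 : ∀ c : 𝔭.primeCompl, ψ c ≠ 0 := by
    intro c hc
    exact c.2 ((hmem _).2 (hc ▸ dvd_zero _))
  have hψt : ψ t = 0 := (h.ker t).2 dvd_rfl
  have hdvd : ∀ a, i0 t ∣ i0 a → t ∣ a := by
    rintro a ⟨e, he⟩
    obtain ⟨e, b, rfl⟩ := IsLocalization.exists_mk'_eq 𝔭.primeCompl e
    have h1 : i0 (a * b) = i0 (t * e) := by
      rw [map_mul, he, map_mul, mul_assoc]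
      congr 1
      exact IsLocalization.mk'_spec _ _ _
    obtain ⟨c, hc⟩ := (IsLocalization.eq_iff_exists 𝔭.primeCompl O).1 h1
    have h2 := congrArg ψ hc
    simp only [map_mul, hψt, zero_mul, mul_zero] at h2
    rw [← h.ker]
    simpa [hne0 c, hne0 b] using h2
  have hunit : ∀ b : 𝔭.primeCompl, IsUnit (i0 b) := fun b => IsLocalization.map_units O b
  have hpspan : 𝔭 = Ideal.span {t, s0} := by
    apply le_antisymm
    · intro a ha
      obtain ⟨q, hq⟩ := (hmem a).1 ha
      obtain ⟨q', rfl⟩ := h.surj q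
      obtain ⟨z, hz⟩ := (h.ker (a - s0 * q')).1 (by rw [map_sub, map_mul, hs0, hq, sub_self])
      rw [Ideal.mem_span_pair]
      exact ⟨z, q', by linear_combination -hz⟩
    · rw [Ideal.span_le]
      rintro a (rfl | rfl)
      · exact (hmem _).2 (hψt ▸ dvd_zero _)
      · exact (hmem _).2 (hs0 ▸ dvd_rfl)
  have hmaxO : maximalIdeal O = Ideal.span {i0 t, i0 s0} := by
    have e1 : 𝔭.map i0 = Ideal.span {i0 t, i0 s0} := by
      have := congrArg (Ideal.map i0) hpspan
      rw [Ideal.map_span, Set.image_pair] at this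
      exact this
    rw [← Localization.AtPrime.map_eq_maximalIdeal]
    exact e1
  have hfg : (maximalIdeal O).FG := by
    classical
    rw [hmaxO]; exact ⟨{i0 t, i0 s0}, by simp⟩
  have hreg : ∀ a : O, i0 t * a = 0 → a = 0 := by
    intro a ha
    obtain ⟨e, b, rfl⟩ := IsLocalization.exists_mk'_eq 𝔭.primeCompl a
    have h1 : i0 (t * e) = i0 0 := by
      rw [map_mul, ← IsLocalization.mk'_spec O e b, ← mul_assoc, ha, zero_mul, map_zero]
    obtain ⟨c, hc⟩ := (IsLocalization.eq_iff_exists 𝔭.primeCompl O).1 h1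
    rw [IsLocalization.mk'_eq_zero_iff]
    exact ⟨c, h.reg _ (by linear_combination hc)⟩
  have hs : ∀ a : O, i0 t ∣ i0 s0 * a → i0 t ∣ a := by
    intro a ha
    obtain ⟨e, b, rfl⟩ := IsLocalization.exists_mk'_eq 𝔭.primeCompl a
    have h1 : i0 t ∣ i0 (s0 * e) := by
      rw [map_mul, ← IsLocalization.mk'_spec O e b, ← mul_assoc]
      exact Dvd.dvd.mul_right ha _
    have h2 := (h.ker _).2 (hdvd _ h1)
    rw [map_mul, hs0] at h2
    have h3 := (mul_eq_zero.1 h2).resolve_left hπ.ne_zero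
    have h4 : i0 t ∣ i0 e := map_dvd i0 ((h.ker _).1 h3)
    rw [← IsLocalization.mk'_spec O e b] at h4
    exact ((hunit b).dvd_mul_right).1 h4
  have hform : ∀ f : O, ¬ i0 t ∣ f → ∃ (v : ℕ) (c z : O), IsUnit c ∧
      f = i0 s0 ^ v * c + i0 t * z := by
    intro f hf
    obtain ⟨e, b, rfl⟩ := IsLocalization.exists_mk'_eq 𝔭.primeCompl f
    have he : ψ e ≠ 0 := by
      intro h0
      have h4 : i0 t ∣ i0 e := map_dvd i0 ((h.ker _).1 h0)
      rw [← IsLocalization.mk'_spec O e b] at h4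
      exact hf (((hunit b).dvd_mul_right).1 h4)
    obtain ⟨v, g, hg, hge⟩ := WfDvdMonoid.max_power_factor he hπ.irreducible
    obtain ⟨g', rfl⟩ := h.surj g
    obtain ⟨z, hz⟩ := (h.ker (e - s0 ^ v * g')).1 (by
      rw [map_sub, map_mul, map_pow, hs0, hge, sub_self])
    have hg' : g' ∈ 𝔭.primeCompl := fun hh => hg ((hmem _).1 hh)
    obtain ⟨ub, hub⟩ := hunit b
    refine ⟨v, i0 g' * ↑ub⁻¹, i0 z * ↑ub⁻¹, ?_, ?_⟩
    · exact (hunit ⟨g', hg'⟩).mul (Units.isUnit _)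
    · have h1 := IsLocalization.mk'_spec O e b
      have h2 : e = s0 ^ v * g' + t * z := by linear_combination hz
      change _ * i0 b = i0 e at h1
      rw [← hub] at h1
      have h3 : i0 e = i0 s0 ^ v * i0 g' + i0 t * i0 z := by
        rw [h2]; simp only [map_add, map_mul, map_pow]
      rw [h3] at h1
      have h4 : (ub : O) * ↑ub⁻¹ = 1 := by simp
      linear_combination (↑ub⁻¹ : O) * h1 - (IsLocalization.mk' O e b) * h4
  let T := AdicCompletion (maximalIdeal O) O
  have hloc : IsLocalRing T := AdicCompletion.isLocalRing_of_fg hfg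
  have hcomp : IsAdicComplete (maximalIdeal T) T := AdicCompletion.isAdicComplete_of_fg hfg
  let i : O →+* T := algebraMap O T
  have hmaxT : maximalIdeal T = Ideal.span {i (i0 t), i (i0 s0)} := by
    have e1 : (maximalIdeal O).map i = Ideal.span {i (i0 t), i (i0 s0)} := by
      have := congrArg (Ideal.map i) hmaxO
      rw [Ideal.map_span, Set.image_pair] at this
      exact this
    rw [AdicCompletion.maximalIdeal_eq_map_of_fg hfg]
    exact e1
  have hcontr : ∀ (o : O) (j : ℕ), i o ∈ maximalIdeal T ^ j → o ∈ Ideal.span {i0 t, i0 s0} ^ j := by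
    intro o j hh
    rw [← hmaxO]
    exact AdicAux.contr hfg o j hh
  obtain ⟨hd, hn, h2⟩ := Dense.twoDim_of_dense i (i0 t) (i0 s0) hreg hs hform hmaxT
    (AdicAux.dense hfg) hcontr
  refine ⟨T, inferInstance, hloc, hd, hn, i.comp i0, s0, hs0, h2, ?_⟩
  intro r n hr
  obtain ⟨a, b, hab⟩ := Ideal.mem_span_pair.1 hr
  simp only [RingHom.comp_apply] at hab
  obtain ⟨o, ho⟩ := AdicAux.dense hfg a n
  have h3 : i (i0 r - i0 t * o) ∈ maximalIdeal T ^ n := by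
    rw [map_sub, map_mul, ← hab,
      show a * i (i0 t) + b * i (i0 s0) ^ n - i (i0 t) * i o =
        (a - i o) * i (i0 t) + b * i (i0 s0) ^ n by ring]
    exact Ideal.add_mem _ (Ideal.mul_mem_right _ _ ho) (Ideal.mul_mem_left _ _
      (Ideal.pow_mem_pow h2.mems _))
  obtain ⟨w, -, c, hw⟩ := Dense.mem_pow_pair _ _ (hcontr _ _ h3)
  obtain ⟨e, b', rfl⟩ := IsLocalization.exists_mk'_eq 𝔭.primeCompl c
  have h5 : i0 t ∣ i0 (b' * r - s0 ^ n * e) := by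
    refine ⟨i0 b' * (o + w), ?_⟩
    have := IsLocalization.mk'_spec O e b'
    change _ * i0 b' = i0 e at this
    rw [map_sub, map_mul, map_mul, map_pow, ← this]
    linear_combination i0 b' * hw
  have h6 := (h.ker _).2 (hdvd _ h5)
  rw [map_sub, map_mul, map_mul, map_pow, hs0, sub_eq_zero] at h6
  have h7 : π ^ n ∣ ψ b' * ψ r := ⟨_, h6⟩
  exact (hπ.pow_dvd_of_dvd_mul_left n (fun hh => b'.2 ((hmem _).2 hh)) h7)
end PartP6b

section PartP6c
open IsLocalRing

namespace BlowData
variable {A Q k σ : Type*} [CommRing A] [IsLocalRing A] [CommRing Q] [Field k]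
    {x : σ → A} {u : σ → Q} {t : Q} {φ : A →+* Q} {ψ : Q →+* MvPolynomial σ k} {res : A →+* k}

lemma regpow (h : BlowData x u t φ ψ res) (n : ℕ) {a b : Q} (hab : t ^ n * a = t ^ n * b) : a = b := by
  induction n with
  | zero => simpa using hab
  | succ n ih =>
    apply ih
    have := h.reg (t ^ n * a - t ^ n * b) (by linear_combination hab)
    exact sub_eq_zero.1 this

lemma psi_t (h : BlowData x u t φ ψ res) : ψ t = 0 := (h.ker t).2 dvd_rfl

lemma eval_form (h : BlowData x u t φ ψ res) (p : MvPolynomial σ A) (n : ℕ) (hp : p.IsHomogeneous n) :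
    φ (MvPolynomial.eval x p) = t ^ n * MvPolynomial.eval₂ φ u p := by
  rw [MvPolynomial.eval_eq, map_sum, MvPolynomial.eval₂_eq, Finset.mul_sum]
  refine Finset.sum_congr rfl fun d hd => ?_
  rw [map_mul, map_prod]
  have hdeg : d.degree = n := by
    have := hp (MvPolynomial.mem_support_iff.1 hd)
    exact (DFunLike.congr_fun Finsupp.degree_eq_weight_one d).trans this
  simp_rw [map_pow, h.hx, mul_pow]
  rw [Finset.prod_mul_distrib, Finset.prod_pow_eq_pow_sum, ← hdeg, Finsupp.degree_apply]
  ring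

lemma psi_eval (h : BlowData x u t φ ψ res) (p : MvPolynomial σ A) :
    ψ (MvPolynomial.eval₂ φ u p) = MvPolynomial.map res p := by
  have : (ψ.comp (MvPolynomial.eval₂Hom φ u)) = MvPolynomial.map res := by
    apply MvPolynomial.ringHom_ext
    · intro r; simp [h.hφ]
    · intro i; simp [h.hu]
  exact RingHom.congr_fun this p

lemma form_of_mem (h : BlowData x u t φ ψ res) {n : ℕ} {f : A} (hf : f ∈ maximalIdeal A ^ n) :
    ∃ g, φ f = t ^ n * g ∧ (ψ g).IsHomogeneous n ∧ (ψ g = 0 → f ∈ maximalIdeal A ^ (n+1)) := by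
  rw [h.span_x, Ideal.mem_span_pow_iff_exists_isHomogeneous] at hf
  obtain ⟨p, hp, rfl⟩ := hf
  refine ⟨_, h.eval_form p n hp, ?_, ?_⟩
  · rw [h.psi_eval]; exact hp.map _
  · rw [h.psi_eval]
    intro h0
    rw [MvPolynomial.eval_eq]
    refine Ideal.sum_mem _ fun d hd => ?_
    rw [pow_succ']
    refine Ideal.mul_mem_mul ?_ ?_
    · rw [← h.res_ker, ← MvPolynomial.coeff_map, h0, MvPolynomial.coeff_zero]
    · have hdeg : d.degree = n := by
        have := hp (MvPolynomial.mem_support_iff.1 hd)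
        exact (DFunLike.congr_fun Finsupp.degree_eq_weight_one d).trans this
      rw [← hdeg, Finsupp.degree_apply, ← Finset.prod_pow_eq_pow_sum]
      refine Ideal.prod_mem_prod fun i _ => Ideal.pow_mem_pow ?_ _
      rw [h.span_x]
      exact Ideal.subset_span ⟨i, rfl⟩

lemma mem_of_form (h : BlowData x u t φ ψ res) {n : ℕ} {f : A} {g : Q} (hf : φ f = t ^ n * g) :
    f ∈ maximalIdeal A ^ n := by
  induction n generalizing g with
  | zero => simp
  | succ n ih =>
    obtain ⟨g', h1, -, h3⟩ := h.form_of_mem (ih (g := t * g) (by rw [hf]; ring))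
    apply h3
    rw [h.ker]
    refine ⟨g, h.regpow n ?_⟩
    rw [← h1, hf]; ring

lemma mem_succ_of_form (h : BlowData x u t φ ψ res) {n : ℕ} {f : A} {g : Q} (hf : φ f = t ^ n * g)
    (hg : ψ g = 0) : f ∈ maximalIdeal A ^ (n+1) := by
  obtain ⟨g', rfl⟩ := (h.ker g).1 hg
  exact h.mem_of_form (g := g') (by rw [hf]; ring)

lemma homog_of_form (h : BlowData x u t φ ψ res) {n : ℕ} {f : A} {g : Q} (hf : φ f = t ^ n * g) :
    (ψ g).IsHomogeneous n := by
  obtain ⟨g', h1, h2, -⟩ := h.form_of_mem (h.mem_of_form hf)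
  rwa [h.regpow n (hf.symm.trans h1)]

lemma not_mem_of_form (h : BlowData x u t φ ψ res) {n : ℕ} {f : A} {g : Q} (hf : φ f = t ^ n * g)
    (hg : ψ g ≠ 0) : f ∉ maximalIdeal A ^ (n+1) := by
  intro hh
  obtain ⟨g', h1, -⟩ := h.form_of_mem hh
  apply hg
  rw [h.ker]
  refine ⟨g', h.regpow n ?_⟩
  rw [← hf, h1]; ring

lemma lift (h : BlowData x u t φ ψ res) {n : ℕ} (F : MvPolynomial σ k) (hF : F.IsHomogeneous n) :
    ∃ f g, φ f = t ^ n * g ∧ ψ g = F := by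
  classical
  obtain ⟨p, hp⟩ := MvPolynomial.map_surjective res h.res_surj F
  refine ⟨_, _, h.eval_form (MvPolynomial.homogeneousComponent n p) n
    (MvPolynomial.homogeneousComponent_isHomogeneous n p), ?_⟩
  rw [h.psi_eval]
  have : MvPolynomial.map res (MvPolynomial.homogeneousComponent n p) =
    MvPolynomial.homogeneousComponent n (MvPolynomial.map res p) := by
    ext d
    simp only [MvPolynomial.coeff_map, MvPolynomial.coeff_homogeneousComponent]
    split_ifs <;> simp
  rw [this, hp, MvPolynomial.homogeneousComponent_of_mem hF, if_pos rfl]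

lemma exists_ord (H : ∀ f : A, (∀ n, f ∈ maximalIdeal A ^ n) → f = 0) {f : A} (hf : f ≠ 0) :
    ∃ n, f ∈ maximalIdeal A ^ n ∧ f ∉ maximalIdeal A ^ (n+1) := by
  by_contra! hc
  apply hf
  apply H
  intro n
  induction n with
  | zero => simp
  | succ n ih => exact hc n ih

lemma exists_form (h : BlowData x u t φ ψ res) (H : ∀ f : A, (∀ n, f ∈ maximalIdeal A ^ n) → f = 0)
    {f : A} (hf : f ≠ 0) : ∃ n g, φ f = t ^ n * g ∧ ψ g ≠ 0 := by
  obtain ⟨n, h1, h2⟩ := exists_ord H hf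
  obtain ⟨g, h3, -, h5⟩ := h.form_of_mem h1
  exact ⟨n, g, h3, fun h0 => h2 (h5 h0)⟩

lemma inj (h : BlowData x u t φ ψ res) (H : ∀ f : A, (∀ n, f ∈ maximalIdeal A ^ n) → f = 0) :
    Function.Injective φ := by
  rw [injective_iff_map_eq_zero]
  intro f hf
  exact H f fun n => h.mem_of_form (g := 0) (by rw [hf, mul_zero])

lemma mul_mem (h : BlowData x u t φ ψ res) {n N : ℕ} {f g : A} (hf : f ∉ maximalIdeal A ^ (n+1))
    (hfg : f * g ∈ maximalIdeal A ^ (N + n)) : g ∈ maximalIdeal A ^ N := by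
  by_contra hg
  have key : ∀ n (f : A), f ∉ maximalIdeal A ^ n →
      ∃ m < n, f ∈ maximalIdeal A ^ m ∧ f ∉ maximalIdeal A ^ (m+1) := by
    intro n f hf
    by_contra! hc
    apply hf
    have : ∀ m ≤ n, f ∈ maximalIdeal A ^ m := by
      intro m
      induction m with
      | zero => simp
      | succ m ih => intro hm; exact hc m (by omega) (ih (by omega))
    exact this n le_rfl
  obtain ⟨a, ha, ha1, ha2⟩ := key _ _ hf
  obtain ⟨b, hb, hb1, hb2⟩ := key _ _ hg
  obtain ⟨f', h1, -, h2⟩ := h.form_of_mem ha1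
  obtain ⟨g', h3, -, h4⟩ := h.form_of_mem hb1
  refine h.not_mem_of_form (n := a + b) (f := f * g) (g := f' * g') ?_ ?_ ?_
  · rw [map_mul, h1, h3]; ring
  · rw [map_mul]
    exact mul_ne_zero (fun h0 => ha2 (h2 h0)) (fun h0 => hb2 (h4 h0))
  · exact Ideal.pow_le_pow_right (by omega) hfg

lemma isDomain (h : BlowData x u t φ ψ res) (H : ∀ f : A, (∀ n, f ∈ maximalIdeal A ^ n) → f = 0) :
    IsDomain A := by
  have : NoZeroDivisors A := ⟨by
    intro a b hab
    by_contra! hc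
    obtain ⟨n, _, hn⟩ := exists_ord H hc.1
    apply hc.2
    apply H
    intro N
    exact h.mul_mem hn (by rw [hab]; exact zero_mem _)⟩
  exact NoZeroDivisors.to_isDomain A

end BlowData
end PartP6c

section PartP7c
open IsLocalRing Polynomial

/-- The Casimir (trace) trick. -/
lemma casimir {O B : Type*} [CommRing O] [Nontrivial O] [CommRing B] [Algebra O B] (θ : B)
    (hθ : ∀ b : B, ∃ q : O[X], b = aeval θ q) (p : O[X]) (hp : aeval θ p = 0)
    (I : Ideal B) [Module.Finite O I] [Module.Free O I] :
    ∃ (n : ℕ) (e : Fin n → I) (Λ : Fin n → (I →ₗ[B] B)),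
      ∀ z : I, ∑ i, (e i : B) * Λ i z = aeval θ (derivative p) * z := by
  classical
  let bs := Module.finBasis O I
  let T : (I →ₗ[O] O) → I → B := fun l z =>
    ∑ i ∈ Finset.range (p.natDegree + 1), algebraMap O B (p.coeff i) *
      ∑ j ∈ Finset.range i, θ ^ (i - 1 - j) * algebraMap O B (l (θ ^ j • z))
  have T_add : ∀ l z z', T l (z + z') = T l z + T l z' := by
    intro l z z'
    simp only [T, smul_add, map_add, mul_add, Finset.sum_add_distrib]
  have T_smul : ∀ l (r : O) z, T l (r • z) = algebraMap O B r * T l z := by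
    intro l r z
    simp only [T, Finset.mul_sum]
    refine Finset.sum_congr rfl fun i _ => Finset.sum_congr rfl fun j _ => ?_
    rw [smul_comm, map_smul, smul_eq_mul, map_mul]; ring
  have T_θ : ∀ l z, T l (θ • z) = θ * T l z := by
    intro l z
    have key : ∀ i, ∑ j ∈ Finset.range i, θ ^ (i - 1 - j) * algebraMap O B (l (θ ^ j • θ • z)) -
        θ * ∑ j ∈ Finset.range i, θ ^ (i - 1 - j) * algebraMap O B (l (θ ^ j • z)) =
        algebraMap O B (l (θ ^ i • z)) - θ ^ i * algebraMap O B (l z) := by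
      intro i
      have : ∀ j ∈ Finset.range i, θ ^ (i - 1 - j) * algebraMap O B (l (θ ^ j • θ • z)) -
          θ * (θ ^ (i - 1 - j) * algebraMap O B (l (θ ^ j • z))) =
          (fun j => θ ^ (i - j) * algebraMap O B (l (θ ^ j • z))) (j + 1) -
          (fun j => θ ^ (i - j) * algebraMap O B (l (θ ^ j • z))) j := by
        intro j hj
        have hj' := Finset.mem_range.1 hj
        have e1 : i - j = (i - 1 - j) + 1 := by omega
        have e2 : i - (j + 1) = i - 1 - j := by omega
        simp only [e1, e2, smul_smul, pow_succ]; ring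
      rw [Finset.mul_sum, ← Finset.sum_sub_distrib, Finset.sum_congr rfl this,
        Finset.sum_range_sub (fun j => θ ^ (i - j) * algebraMap O B (l (θ ^ j • z)))]
      simp
    rw [← sub_eq_zero]
    simp only [T]
    rw [Finset.mul_sum, ← Finset.sum_sub_distrib]
    have : ∀ i ∈ Finset.range (p.natDegree + 1),
      (algebraMap O B) (p.coeff i) * ∑ j ∈ Finset.range i, θ ^ (i - 1 - j) *
        (algebraMap O B) (l (θ ^ j • θ • z)) -
      θ * ((algebraMap O B) (p.coeff i) * ∑ j ∈ Finset.range i, θ ^ (i - 1 - j) *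
        (algebraMap O B) (l (θ ^ j • z))) =
      algebraMap O B (l ((algebraMap O B (p.coeff i) * θ ^ i) • z)) -
        algebraMap O B (p.coeff i) * θ ^ i * algebraMap O B (l z) := by
      intro i _
      have e : (algebraMap O B (p.coeff i) * θ ^ i) • z = p.coeff i • (θ ^ i • z) := by
        rw [mul_smul, algebraMap_smul]
      rw [e, map_smul, smul_eq_mul, map_mul]
      linear_combination (algebraMap O B) (p.coeff i) * key i
    rw [Finset.sum_congr rfl this, Finset.sum_sub_distrib, ← Finset.sum_mul, ← map_sum, ← map_sum,
      ← Finset.sum_smul]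
    have e2 : ∑ i ∈ Finset.range (p.natDegree + 1), algebraMap O B (p.coeff i) * θ ^ i = 0 := by
      rw [← hp, aeval_eq_sum_range]
      simp only [Algebra.smul_def]
    rw [e2]; simp
  have T_B : ∀ l (b : B) z, T l (b • z) = b * T l z := by
    intro l b
    obtain ⟨q, rfl⟩ := hθ b
    induction q using Polynomial.induction_on' with
    | add q r hq hr => intro z; rw [map_add, add_smul, T_add, hq, hr, add_mul]
    | monomial n a =>
      intro z
      rw [aeval_monomial, mul_smul, algebraMap_smul, T_smul, mul_assoc]
      congr 1
      induction n with
      | zero => simp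
      | succ n ih => rw [pow_succ', mul_smul, T_θ, ih, mul_assoc]
  refine ⟨_, bs, fun i => { toFun := T (bs.coord i), map_add' := T_add _, map_smul' := T_B _ }, ?_⟩
  intro z
  simp only [LinearMap.coe_mk, AddHom.coe_mk, T]
  have hexp : ∀ y : I, ∑ i, algebraMap O B (bs.coord i y) * (bs i : B) = y := by
    intro y
    have := congrArg (Subtype.val) (bs.sum_repr y)
    rw [← this, Submodule.coe_sum]
    refine Finset.sum_congr rfl fun i _ => ?_
    rw [Submodule.coe_smul_of_tower, Algebra.smul_def]
    rfl
  calc _ = ∑ i ∈ Finset.range (p.natDegree + 1), algebraMap O B (p.coeff i) *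
        ∑ j ∈ Finset.range i, θ ^ (i - 1 - j) * ∑ k,
          algebraMap O B (bs.coord k (θ ^ j • z)) * (bs k : B) := by
        simp only [Finset.mul_sum]
        rw [Finset.sum_comm]
        refine Finset.sum_congr rfl fun i _ => ?_
        rw [Finset.sum_comm]
        refine Finset.sum_congr rfl fun j _ => Finset.sum_congr rfl fun k _ => ?_
        ring
    _ = ∑ i ∈ Finset.range (p.natDegree + 1), algebraMap O B (p.coeff i) * (i * θ ^ (i - 1) * z) := by
        refine Finset.sum_congr rfl fun i _ => ?_
        congr 1
        have : ∀ j ∈ Finset.range i, θ ^ (i - 1 - j) * ∑ k,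
          algebraMap O B (bs.coord k (θ ^ j • z)) * (bs k : B) = θ ^ (i - 1) * z := by
          intro j hj
          have hj' := Finset.mem_range.1 hj
          rw [hexp]
          have e1 : i - 1 = (i - 1 - j) + j := by omega
          rw [Submodule.coe_smul, smul_eq_mul, ← mul_assoc, ← pow_add, ← e1]
        rw [Finset.sum_congr rfl this, Finset.sum_const, Finset.card_range, nsmul_eq_mul, mul_assoc]
    _ = _ := by
        conv_rhs => rw [p.as_sum_range]
        rw [map_sum, map_sum, Finset.sum_mul]
        refine Finset.sum_congr rfl fun i _ => ?_
        rw [derivative_monomial, aeval_monomial, map_mul, map_natCast]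
        ring
end PartP7c

section PartP7d
open IsLocalRing Polynomial
set_option linter.unusedSectionVars false

namespace ThmT
variable {O B Ω : Type*} [CommRing O] [IsDomain O] [IsNoetherianRing O] [IsLocalRing O]
  {x s : O} [CommRing B] [IsDomain B] [Algebra O B] [Field Ω]

/-- the ideal of elements of value at least `x ^ M` -/
def IM (ι : B →+* Ω) (V : ValuationSubring Ω) (hV : ∀ b, ι b ∈ V) (x : O) (M : ℕ) : Ideal B where
  carrier := {b | ∃ v ∈ V, ι b = ι (algebraMap O B x) ^ M * v}
  add_mem' := by
    rintro a b ⟨v, hv, h⟩ ⟨w, hw, h'⟩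
    exact ⟨v + w, V.add_mem _ _ hv hw, by rw [map_add, h, h']; ring⟩
  zero_mem' := ⟨0, V.zero_mem, by simp⟩
  smul_mem' := by
    rintro c a ⟨v, hv, h⟩
    exact ⟨ι c * v, V.mul_mem _ _ (hV c) hv, by rw [smul_eq_mul, map_mul, h]; ring⟩

variable {ι : B →+* Ω} {V : ValuationSubring Ω} {hV : ∀ b, ι b ∈ V}

lemma mem_IM {M : ℕ} {b : B} : b ∈ IM ι V hV x M ↔
    ∃ v ∈ V, ι b = ι (algebraMap O B x) ^ M * v := Iff.rfl

lemma IM_anti : Antitone (IM ι V hV x) := by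
  intro M N h b hb
  obtain ⟨v, hv, hb⟩ := hb
  obtain ⟨k, rfl⟩ := Nat.exists_eq_add_of_le h
  exact ⟨ι (algebraMap O B x) ^ k * v, V.mul_mem _ _ (V.toSubring.pow_mem (hV _) k) hv,
    by rw [hb]; ring⟩

lemma dvd_of_IM (h : TwoDim O x s) (hinj : Function.Injective ι)
    (hfaith : Function.Injective (algebraMap O B))
    (hu : ∀ a : O, ¬ x ∣ a → (ι (algebraMap O B a))⁻¹ ∈ V)
    (hx : (ι (algebraMap O B x))⁻¹ ∉ V) {n : ℕ} {a : O}
    (ha : algebraMap O B a ∈ IM ι V hV x n) : x ^ n ∣ a := by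
  by_cases h0 : a = 0
  · simp [h0]
  obtain ⟨c, g, rfl, hg⟩ := h.exists_Xpow h0
  by_cases hc : n ≤ c
  · exact Dvd.dvd.mul_right (pow_dvd_pow _ hc) _
  exfalso
  push Not at hc
  obtain ⟨k, rfl⟩ := Nat.exists_eq_add_of_lt hc
  obtain ⟨v, hv, ha⟩ := ha
  have hx0 : ι (algebraMap O B x) ≠ 0 := by
    rw [Ne, map_eq_zero_iff ι hinj, map_eq_zero_iff _ hfaith]; exact h.primeX.ne_zero
  have hg0 : ι (algebraMap O B g) ≠ 0 := by
    rw [Ne, map_eq_zero_iff ι hinj, map_eq_zero_iff _ hfaith]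
    rintro rfl; exact hg (dvd_zero _)
  apply hx
  simp only [map_mul, map_pow] at ha
  have e : ι (algebraMap O B g) = ι (algebraMap O B x) ^ (k + 1) * v := by
    apply mul_left_cancel₀ (pow_ne_zero c hx0)
    rw [ha]; ring
  have : (ι (algebraMap O B x))⁻¹ = ι (algebraMap O B x) ^ k * v * (ι (algebraMap O B g))⁻¹ := by
    rw [inv_eq_iff_eq_inv, eq_comm]
    apply inv_eq_of_mul_eq_one_left
    rw [show ι (algebraMap O B x) * (ι (algebraMap O B x) ^ k * v * (ι (algebraMap O B g))⁻¹) =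
      (ι (algebraMap O B x) ^ (k + 1) * v) * (ι (algebraMap O B g))⁻¹ by ring, ← e,
      mul_inv_cancel₀ hg0]
  rw [this]
  exact V.mul_mem _ _ (V.mul_mem _ _ (V.toSubring.pow_mem (hV _) k) hv) (hu g hg)

lemma IM_finite [Module.Finite O B] (M : ℕ) : Module.Finite O (IM ι V hV x M) := by
  have : IsNoetherian O B := inferInstance
  have : IsNoetherian O (IM ι V hV x M) :=
    isNoetherian_of_injective ((IM ι V hV x M).subtype.restrictScalars O) Subtype.val_injective
  infer_instance

open Pointwise in
lemma IM_free (h : TwoDim O x s) (hinj : Function.Injective ι) (pb : PowerBasis O B)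
    (hu : ∀ a : O, ¬ x ∣ a → (ι (algebraMap O B a))⁻¹ ∈ V) (M : ℕ) :
    Module.Free O (IM ι V hV x M) := by
  have : Module.Finite O B := pb.finite
  have := IM_finite (O := O) (ι := ι) (V := V) (hV := hV) (x := x) M
  have hfree : Module.Free O B := Module.Free.of_basis pb.basis
  have hfaith : Function.Injective (algebraMap O B) := by
    have := pb.finite
    exact FaithfulSMul.algebraMap_injective O B
  have hx0 : algebraMap O B x ≠ 0 := by
    rw [Ne, map_eq_zero_iff _ hfaith]; exact h.primeX.ne_zero
  obtain ⟨hd, hdvr, _⟩ := h.dvr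
  have mem : x ∈ (⊥ : Ideal O).jacobson := by
    rw [IsLocalRing.jacobson_eq_maximalIdeal _ bot_ne_top]; exact h.memX
  have reg : IsSMulRegular (IM ι V hV x M) x := by
    intro a b hab
    have := congrArg Subtype.val hab
    simp only [Submodule.coe_smul_of_tower, Algebra.smul_def] at this
    exact Subtype.ext (mul_left_cancel₀ hx0 this)
  have := Module.finitePresentation_of_finite O (IM ι V hV x M)
  rw [← Module.free_quotSMulTop_iff_free O _ mem reg]
  have : Module.Finite (O ⧸ Ideal.span {x}) (QuotSMulTop x (IM ι V hV x M)) :=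
    Module.Finite.of_restrictScalars_finite O (O ⧸ Ideal.span {x}) _
  have tf : Module.IsTorsionFree (O ⧸ Ideal.span {x}) (QuotSMulTop x (IM ι V hV x M)) := by
    rw [Module.isTorsionFree_iff_smul_eq_zero]
    intro r m hrm
    obtain ⟨f, rfl⟩ := Ideal.Quotient.mk_surjective r
    obtain ⟨b, rfl⟩ := Submodule.mkQ_surjective _ m
    by_cases hf : x ∣ f
    · left; rw [Ideal.Quotient.eq_zero_iff_mem, Ideal.mem_span_singleton]; exact hf
    right
    have h1 : f • b ∈ (x • (⊤ : Submodule O (IM ι V hV x M))) := by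
      rw [← Submodule.Quotient.mk_eq_zero]; exact hrm
    obtain ⟨b', -, hb'⟩ := h1
    change x • b' = f • b at hb'
    have h2 : x • (b' : B) = f • (b : B) := by
      have := congrArg Subtype.val hb'
      simpa only [Submodule.coe_smul_of_tower] using this
    have h3 : ∀ i, x ∣ pb.basis.repr (b : B) i := by
      intro i
      have := congrArg (fun z => pb.basis.repr z i) h2
      simp only [map_smul, Finsupp.smul_apply, smul_eq_mul] at this
      exact (h.primeX.dvd_or_dvd ⟨_, this.symm⟩).resolve_left hf
    choose q hq using h3
    have h4 : (b : B) = x • ∑ i, q i • pb.basis i := by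
      rw [← pb.basis.sum_repr (b : B), Finset.smul_sum]
      refine Finset.sum_congr rfl fun i _ => ?_
      rw [hq, mul_smul]
    set b'' : B := ∑ i, q i • pb.basis i
    have h5 : (b' : B) = algebraMap O B f * b'' := by
      apply mul_left_cancel₀ hx0
      rw [← Algebra.smul_def, h2, h4]
      simp only [Algebra.smul_def]; ring
    have hf0 : ι (algebraMap O B f) ≠ 0 := by
      rw [Ne, map_eq_zero_iff ι hinj, map_eq_zero_iff _ hfaith]
      rintro rfl; exact hf (dvd_zero _)
    have h6 : b'' ∈ IM ι V hV x M := by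
      obtain ⟨v, hv, hv'⟩ := b'.2
      refine ⟨(ι (algebraMap O B f))⁻¹ * v, V.mul_mem _ _ (hu f hf) hv, ?_⟩
      rw [h5, map_mul] at hv'
      rw [mul_left_comm, ← hv', inv_mul_cancel_left₀ hf0]
    refine (Submodule.Quotient.mk_eq_zero _).2 ⟨⟨b'', h6⟩, trivial, ?_⟩
    apply Subtype.ext
    change x • b'' = _
    rw [h4]
  exact Module.free_of_finite_type_torsion_free'

lemma IM_iInf (h : TwoDim O x s) (hinj : Function.Injective ι) (pb : PowerBasis O B)
    (hu : ∀ a : O, ¬ x ∣ a → (ι (algebraMap O B a))⁻¹ ∈ V)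
    (hx : (ι (algebraMap O B x))⁻¹ ∉ V) {b : B} (hb : ∀ M, b ∈ IM ι V hV x M) : b = 0 := by
  have : Module.Finite O B := pb.finite
  have hfree : Module.Free O B := Module.Free.of_basis pb.basis
  have hfaith : Function.Injective (algebraMap O B) := FaithfulSMul.algebraMap_injective O B
  by_contra hb0
  obtain ⟨r, hr, hdvd⟩ := (Algebra.IsIntegral.isIntegral (R := O) b).isAlgebraic.exists_nonzero_dvd
    (mem_nonZeroDivisors_of_ne_zero hb0)
  obtain ⟨c, g, rfl, hg⟩ := h.exists_Xpow hr
  have h1 : algebraMap O B (x ^ c * g) ∈ IM ι V hV x (c + 1) := by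
    obtain ⟨q, hq⟩ := hdvd
    rw [hq]; exact Ideal.mul_mem_right _ _ (hb _)
  have h2 := dvd_of_IM h hinj hfaith hu hx h1
  rw [pow_succ] at h2
  exact hg ((mul_dvd_mul_iff_left (pow_ne_zero c h.primeX.ne_zero)).1 h2)

lemma step (h : TwoDim O x s) (hinj : Function.Injective ι) (pb : PowerBasis O B)
    (hu : ∀ a : O, ¬ x ∣ a → (ι (algebraMap O B a))⁻¹ ∈ V)
    (P : O[X]) (hP : aeval pb.gen P = 0) {M N : ℕ} {z : B} (hz : z ∈ IM ι V hV x (M + N)) :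
    aeval pb.gen (derivative P) * z ∈ IM ι V hV x M * IM ι V hV x N := by
  have : Module.Finite O B := pb.finite
  have hfree : Module.Free O B := Module.Free.of_basis pb.basis
  have hfaith : Function.Injective (algebraMap O B) := FaithfulSMul.algebraMap_injective O B
  have := IM_finite (O := O) (ι := ι) (V := V) (hV := hV) (x := x) M
  have := IM_free (hV := hV) h hinj pb hu M
  have hx0 : ι (algebraMap O B x) ≠ 0 := by
    rw [Ne, map_eq_zero_iff ι hinj, map_eq_zero_iff _ hfaith]; exact h.primeX.ne_zero
  obtain ⟨n, e, Λ, hΛ⟩ := casimir pb.gen (fun b => pb.exists_eq_aeval' b) P hP (IM ι V hV x M)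
  have hz' : z ∈ IM ι V hV x M := IM_anti (Nat.le_add_right _ _) hz
  have hxm : (algebraMap O B x) ^ M ∈ IM ι V hV x M := ⟨1, V.one_mem, by simp⟩
  have := hΛ ⟨z, hz'⟩
  rw [← this]
  refine Ideal.sum_mem _ fun i _ => Ideal.mul_mem_mul (e i).2 ?_
  have h1 : algebraMap O B x ^ M * Λ i ⟨z, hz'⟩ = z * Λ i ⟨_, hxm⟩ := by
    rw [← smul_eq_mul, ← map_smul, ← smul_eq_mul z, ← map_smul]
    congr 1
    apply Subtype.ext
    simp [mul_comm]
  obtain ⟨v, hv, hzv⟩ := hz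
  refine ⟨v * ι (Λ i ⟨_, hxm⟩), V.mul_mem _ _ hv (hV _), ?_⟩
  have h2 := congrArg ι h1
  rw [map_mul, map_mul, map_pow, hzv] at h2
  apply mul_left_cancel₀ (pow_ne_zero M hx0)
  rw [h2]; ring

lemma steps (h : TwoDim O x s) (hinj : Function.Injective ι) (pb : PowerBasis O B)
    (hu : ∀ a : O, ¬ x ∣ a → (ι (algebraMap O B a))⁻¹ ∈ V)
    (P : O[X]) (hP : aeval pb.gen P = 0) (M k : ℕ) : ∀ {z : B}, z ∈ IM ι V hV x (M * k) →
    aeval pb.gen (derivative P) ^ k * z ∈ IM ι V hV x M ^ k := by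
  induction k with
  | zero => intro z _; simp
  | succ k ih =>
    intro z hz
    have h1 := step h hinj pb hu P hP (M := M) (N := M * k) (z := z)
      (by rwa [show M + M * k = M * (k + 1) by ring])
    rw [pow_succ (aeval pb.gen (derivative P)), mul_assoc, pow_succ' (IM ι V hV x M)]
    generalize aeval pb.gen (derivative P) * z = y at h1
    refine Submodule.mul_induction_on h1 ?_ ?_
    · intro a ha b hb
      rw [mul_left_comm]
      exact Ideal.mul_mem_mul ha (ih hb)
    · intro a b ha hb
      rw [mul_add]; exact Ideal.add_mem _ ha hb

lemma coord_mem (J : Ideal O) (φ : B →ₗ[O] O) {z : B} (hz : z ∈ J.map (algebraMap O B)) :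
    φ z ∈ J := by
  have : z ∈ (J • (⊤ : Submodule O B)) := by rw [Ideal.smul_top_eq_map]; exact hz
  refine Submodule.smul_induction_on this ?_ ?_
  · intro r hr n _
    rw [map_smul, smul_eq_mul]; exact J.mul_mem_right _ hr
  · intro a b ha hb; rw [map_add]; exact J.add_mem ha hb

lemma final (h : TwoDim O x s) {d0 k : ℕ} {u z f : O} (hu : IsUnit u)
    (hm : (s ^ d0 * u + x * z) ^ k * f ∈ maximalIdeal O ^ ((d0 + 1) * k)) :
    f ∈ Ideal.span {x, s ^ k} := by
  obtain ⟨w, -, t, ht⟩ := h.mem_pow_succ hm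
  obtain ⟨q, hq⟩ : x ∣ (s ^ d0 * u + x * z) ^ k - (s ^ d0 * u) ^ k := by
    refine (Dvd.intro z ?_ : x ∣ (s ^ d0 * u + x * z) - (s ^ d0 * u)).trans (sub_dvd_pow_sub_pow _ _ k)
    ring
  have h1 : x ∣ s ^ (d0 * k) * (u ^ k * f - s ^ k * t) := by
    refine ⟨w - q * f, ?_⟩
    have e1 : s ^ ((d0 + 1) * k) = s ^ (d0 * k) * s ^ k := by rw [← pow_add]; ring
    have e2 : (s ^ d0 * u) ^ k = s ^ (d0 * k) * u ^ k := by rw [mul_pow, pow_mul]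
    rw [e1] at ht
    rw [e2] at hq
    linear_combination ht - f * hq
  obtain ⟨r, hr⟩ := (h.primeX.dvd_or_dvd h1).resolve_left (h.not_dvd_pow _)
  obtain ⟨uk, huk⟩ := (hu.pow k)
  rw [Ideal.mem_span_pair]
  refine ⟨r * ↑uk⁻¹, t * ↑uk⁻¹, ?_⟩
  have h2 : u ^ k * ↑uk⁻¹ = 1 := by rw [← huk]; simp
  linear_combination (-(↑uk⁻¹ : O)) * hr + f * h2

theorem thmT' (h : TwoDim O x s) (hinj : Function.Injective ι) (pb : PowerBasis O B)
    (hV : ∀ b, ι b ∈ V) (hdim : 2 ≤ pb.dim)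
    (hu : ∀ a : O, ¬ x ∣ a → (ι (algebraMap O B a))⁻¹ ∈ V)
    (hx : (ι (algebraMap O B x))⁻¹ ∉ V)
    (P : O[X]) (hP : aeval pb.gen P = 0) (hP' : aeval pb.gen (derivative P) ≠ 0) :
    ∃ M : ℕ, ∀ (k : ℕ) (f y : O), algebraMap O B y - algebraMap O B f * pb.gen ∈ IM ι V hV x (M * k) →
      f ∈ Ideal.span {x, s ^ k} := by
  have : Module.Finite O B := pb.finite
  have hfree : Module.Free O B := Module.Free.of_basis pb.basis
  have hcompl := h.complete
  obtain ⟨δ, hδ, σ', hσ⟩ := (Algebra.IsIntegral.isIntegral (R := O)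
    (aeval pb.gen (derivative P))).isAlgebraic.exists_nonzero_dvd
    (mem_nonZeroDivisors_of_ne_zero hP')
  obtain ⟨c, δ0, rfl, hδ0⟩ := h.exists_Xpow hδ
  obtain ⟨d0, u, z0, huu, rfl⟩ := h.exists_form hδ0
  obtain ⟨M, hM⟩ := chevalley (R := O) (M := B) (fun M => (IM ι V hV x M).restrictScalars O)
    (fun a b hab => IM_anti (hV := hV) hab) (by
      rw [eq_bot_iff]
      intro b hb
      rw [Submodule.mem_iInf] at hb
      exact IM_iInf (hV := hV) h hinj pb hu hx hb) (c + d0 + 1)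
  refine ⟨M, fun k f y hz => ?_⟩
  have h1 := steps h hinj pb hu P hP M k hz
  have h2 : IM ι V hV x M ≤ (maximalIdeal O ^ (c + d0 + 1)).map (algebraMap O B) := by
    rw [Ideal.smul_top_eq_map] at hM; exact hM
  have h3 := Ideal.pow_right_mono h2 k h1
  rw [← Ideal.map_pow, ← pow_mul] at h3
  have h4 := Ideal.mul_mem_left _ (σ' ^ k) h3
  rw [← mul_assoc, ← mul_pow, mul_comm σ', ← hσ] at h4
  have h5 := coord_mem _ (pb.basis.coord ⟨1, hdim⟩) h4
  rw [← map_pow, ← Algebra.smul_def, map_smul, map_sub] at h5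
  have e1 : pb.basis.coord ⟨1, hdim⟩ (algebraMap O B y) = 0 := by
    have : algebraMap O B y = y • pb.basis ⟨0, by omega⟩ := by
      rw [pb.basis_eq_pow]; simp [Algebra.smul_def]
    rw [this, map_smul, Module.Basis.coord_apply, Module.Basis.repr_self, Finsupp.single_apply]; simp
  have e2 : pb.basis.coord ⟨1, hdim⟩ (algebraMap O B f * pb.gen) = f := by
    have : algebraMap O B f * pb.gen = f • pb.basis ⟨1, hdim⟩ := by
      rw [pb.basis_eq_pow]; simp [Algebra.smul_def]
    rw [this, map_smul, Module.Basis.coord_apply, Module.Basis.repr_self, Finsupp.single_apply]; simp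
  rw [e1, e2, zero_sub, smul_neg, neg_mem_iff, smul_eq_mul, mul_pow, ← pow_mul, mul_assoc,
    show (c + d0 + 1) * k = (d0 + 1) * k + c * k by ring] at h5
  exact final h huu (h.cancelXpow _ h5)

lemma mem_of_integral [Algebra O Ω] (V : ValuationSubring Ω) (hV : ∀ a : O, algebraMap O Ω a ∈ V)
    {α : Ω} (hα : IsIntegral O α) : α ∈ V := by
  obtain ⟨p, hp, hp0⟩ := hα
  let g : O →+* V := (algebraMap O Ω).codRestrict V.toSubring hV
  have : IsIntegral V α := by
    refine ⟨p.map g, hp.map g, ?_⟩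
    rw [eval₂_map]
    exact hp0
  obtain ⟨y, hy⟩ := (IsIntegrallyClosed.isIntegral_iff (R := V) (K := Ω)).1 this
  rw [← hy]; exact y.2

theorem thmT [Algebra O Ω] (h : TwoDim O x s) (hinj : Function.Injective (algebraMap O Ω))
    (V : ValuationSubring Ω) (hV : ∀ a : O, algebraMap O Ω a ∈ V)
    (hu : ∀ a : O, ¬ x ∣ a → (algebraMap O Ω a)⁻¹ ∈ V) (hx : (algebraMap O Ω x)⁻¹ ∉ V)
    (α : Ω) (hα : IsIntegral O α) (hα' : ∀ a, algebraMap O Ω a ≠ α)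
    (P : O[X]) (hP : aeval α P = 0) (hP' : aeval α (derivative P) ≠ 0) :
    ∃ M : ℕ, ∀ (k : ℕ) (f y : O),
      (∃ v ∈ V, algebraMap O Ω y - algebraMap O Ω f * α = algebraMap O Ω x ^ (M * k) * v) →
      f ∈ Ideal.span {x, s ^ k} := by
  have hn := h.normal
  have : FaithfulSMul O Ω := (faithfulSMul_iff_algebraMap_injective O Ω).2 hinj
  have : IsDomain (Algebra.adjoin O {α}) := inferInstance
  let pb := Algebra.adjoin.powerBasis' hα
  have hgen : (pb.gen : Ω) = α := by
    simp only [pb]; rw [Algebra.adjoin.powerBasis'_gen]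
  have hdim : 2 ≤ pb.dim := by
    change 2 ≤ (minpoly O α).natDegree
    by_contra hlt
    have h1 : (minpoly O α).natDegree = 1 := by
      have := minpoly.natDegree_pos hα
      omega
    have h2 := minpoly.monic hα
    have h3 := minpoly.aeval O α
    rw [h2.eq_X_add_C h1] at h3
    simp only [map_add, aeval_X, aeval_C] at h3
    exact hα' (-(minpoly O α).coeff 0) (by rw [map_neg]; linear_combination -h3)
  let ι : Algebra.adjoin O {α} →+* Ω := (Algebra.adjoin O {α}).val.toRingHom
  have hιa : ∀ a : O, ι (algebraMap O _ a) = algebraMap O Ω a := fun a => rfl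
  have hιg : ι pb.gen = α := hgen
  have haev : ∀ q : O[X], ι (aeval pb.gen q) = aeval α q := by
    intro q
    have := Polynomial.aeval_algHom_apply (Algebra.adjoin O {α}).val pb.gen q
    change aeval (ι pb.gen) q = _ at this
    rw [hιg] at this
    exact this.symm
  have hVB : ∀ b, ι b ∈ V := by
    intro b
    obtain ⟨q, rfl⟩ := pb.exists_eq_aeval' b
    rw [haev]
    exact mem_of_integral V hV (by
      rw [aeval_eq_sum_range]
      exact IsIntegral.sum _ fun i _ => (hα.pow i).smul _)
  obtain ⟨M, hM⟩ := thmT' (V := V) (ι := ι) h Subtype.val_injective pb hVB hdim hu hx P (by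
    apply Subtype.val_injective
    exact (haev P).trans (hP.trans (map_zero ι).symm)) (by
      intro h0
      apply hP'
      rw [← haev, h0, map_zero])
  refine ⟨M, fun k f y hh => hM k f y ?_⟩
  obtain ⟨v, hv, hh⟩ := hh
  refine ⟨v, hv, ?_⟩
  rw [map_sub, map_mul, hιg]
  exact hh

end ThmT
end PartP7d

section PartP5a
open IsLocalRing

lemma exists_val {T : Type*} [CommRing T] [IsDomain T] (x : T) (hx : Prime x) :
    ∃ V : ValuationSubring (AlgebraicClosure (FractionRing T)),
      (∀ a : T, algebraMap T (AlgebraicClosure (FractionRing T)) a ∈ V) ∧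
      (∀ a : T, ¬ x ∣ a → (algebraMap T (AlgebraicClosure (FractionRing T)) a)⁻¹ ∈ V) ∧
      (algebraMap T (AlgebraicClosure (FractionRing T)) x)⁻¹ ∉ V := by
  set Ω := AlgebraicClosure (FractionRing T)
  have hinj : Function.Injective (algebraMap T Ω) := by
    rw [IsScalarTower.algebraMap_eq T (FractionRing T) Ω]
    exact (algebraMap (FractionRing T) Ω).injective.comp (IsFractionRing.injective T _)
  have hp : (Ideal.span {x} : Ideal T).IsPrime := (Ideal.span_singleton_prime hx.ne_zero).2 hx
  let L := Localization.AtPrime (Ideal.span {x})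
  have hu : ∀ y : (Ideal.span {x} : Ideal T).primeCompl, IsUnit (algebraMap T Ω y) := by
    intro y
    rw [isUnit_iff_ne_zero, Ne, map_eq_zero_iff _ hinj]
    intro h0
    apply y.2
    rw [h0]
    exact zero_mem _
  let f : L →+* Ω := IsLocalization.lift (M := (Ideal.span {x} : Ideal T).primeCompl) hu
  have hf : ∀ a, f (algebraMap T L a) = algebraMap T Ω a := fun a => IsLocalization.lift_eq hu a
  obtain ⟨V, hV, hloc⟩ := IsLocalRing.exists_factor_valuationRing f
  have hV' : ∀ a : T, algebraMap T Ω a ∈ V := fun a => by rw [← hf]; exact hV _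
  refine ⟨V, hV', fun a ha => ?_, fun hc => ?_⟩
  · have : IsUnit (algebraMap T L a) := by
      refine IsLocalization.map_units L (⟨a, ?_⟩ : (Ideal.span {x} : Ideal T).primeCompl)
      intro h
      exact ha (Ideal.mem_span_singleton.1 h)
    obtain ⟨b, hb⟩ := this.exists_right_inv
    have : f b = (algebraMap T Ω a)⁻¹ := by
      apply eq_inv_of_mul_eq_one_right
      rw [← hf, ← map_mul, hb, map_one]
    rw [← this]
    exact hV _
  · have hun : IsUnit (algebraMap T L x) := by
      apply hloc.1
      rw [isUnit_iff_exists_inv]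
      refine ⟨⟨_, hc⟩, ?_⟩
      apply Subtype.ext
      change f (algebraMap T L x) * (algebraMap T Ω x)⁻¹ = 1
      rw [hf, mul_inv_cancel₀]
      rw [Ne, map_eq_zero_iff _ hinj]
      exact hx.ne_zero
    have := (IsLocalization.AtPrime.isUnit_to_map_iff L (Ideal.span {x}) x).1 hun
    exact this (Ideal.mem_span_singleton_self x)

/-- a valuation on a field over `Q`, compatible with the grading -/
structure VData {Q k σ Ω Γ : Type*} [CommRing Q] [Field k] [Field Ω]
    [LinearOrderedCommGroupWithZero Γ] (t : Q) (ψ : Q →+* MvPolynomial σ k) (ι : Q →+* Ω)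
    (v : Valuation Ω Γ) : Prop where
  le_one : ∀ q, v (ι q) ≤ 1
  eq_one : ∀ q, ψ q ≠ 0 → v (ι q) = 1
  pos : 0 < v (ι t)
  lt_one : v (ι t) < 1

namespace VData
variable {A Q k σ Ω Γ : Type*} [CommRing A] [IsLocalRing A] [CommRing Q] [Field k] [Field Ω]
    [LinearOrderedCommGroupWithZero Γ]
    {x : σ → A} {u : σ → Q} {t : Q} {φ : A →+* Q} {ψ : Q →+* MvPolynomial σ k} {res : A →+* k}
    {ι : Q →+* Ω} {v : Valuation Ω Γ}

lemma val_le (h : BlowData x u t φ ψ res) (hv : VData t ψ ι v) {n : ℕ} {f : A}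
    (hf : f ∈ maximalIdeal A ^ n) : v (ι (φ f)) ≤ v (ι t) ^ n := by
  obtain ⟨g, h1, -⟩ := h.form_of_mem hf
  rw [h1, map_mul, map_mul, map_pow, map_pow]
  exact mul_le_of_le_one_right' (hv.le_one g)

lemma val_eq (hv : VData t ψ ι v) {n : ℕ} {f : A} {g : Q}
    (hf : φ f = t ^ n * g) (hg : ψ g ≠ 0) : v (ι (φ f)) = v (ι t) ^ n := by
  rw [hf, map_mul, map_mul, map_pow, map_pow, hv.eq_one g hg, mul_one]

lemma pow_le_pow (hv : VData t ψ ι v) {m n : ℕ} (h : v (ι t) ^ m ≤ v (ι t) ^ n) : n ≤ m := by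
  by_contra hc
  push Not at hc
  exact absurd h (not_le.2 (pow_lt_pow_right_of_lt_one₀ hv.pos hv.lt_one hc))

lemma pow_anti (hv : VData t ψ ι v) {m n : ℕ} (h : n ≤ m) : v (ι t) ^ m ≤ v (ι t) ^ n :=
  pow_le_pow_right_of_le_one' hv.lt_one.le h

lemma mem_of_val (h : BlowData x u t φ ψ res) (hv : VData t ψ ι v) {n : ℕ} {f : A}
    (hf : v (ι (φ f)) ≤ v (ι t) ^ n) : f ∈ maximalIdeal A ^ n := by
  induction n with
  | zero => simp
  | succ n ih =>
    obtain ⟨g, h1, -, h3⟩ := h.form_of_mem (ih (hf.trans (hv.pow_anti (by omega))))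
    apply h3
    by_contra h0
    rw [hv.val_eq h1 h0] at hf
    have := hv.pow_le_pow hf
    omega

open Polynomial in
lemma near (h : BlowData x u t φ ψ res) (hv : VData t ψ ι v) [IsAlgClosed Ω] (P : A[X]) (hP : P.Monic)
    (hD : 1 ≤ P.natDegree) {y f : A} (hf : ι (φ f) ≠ 0) (M : ℕ)
    (hF : (P.scaleRoots f).eval y ∈ maximalIdeal A ^ (P.natDegree * M)) :
    ∃ α ∈ (P.map (ι.comp φ)).roots, v (ι (φ y) - ι (φ f) * α) ≤ v (ι t) ^ M := by
  have hval := hv.val_le h hF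
  have hPm := hP.map (ι.comp φ)
  have hsp := IsAlgClosed.splits (P.map (ι.comp φ))
  have h1 : ι (φ ((P.scaleRoots f).eval y)) =
      (((P.map (ι.comp φ)).roots.map (fun α => ι (φ y) - ι (φ f) * α))).prod := by
    have e1 : ι (φ ((P.scaleRoots f).eval y)) = ((P.scaleRoots f).map (ι.comp φ)).eval (ι (φ y)) := by
      rw [eval_map, ← RingHom.comp_apply ι φ y, Polynomial.eval₂_at_apply]; rfl
    have e2 : ι (φ y) = ι (φ f) * (ι (φ y) / ι (φ f)) := by field_simp
    rw [e1, map_scaleRoots _ _ _ (by rw [hP.leadingCoeff, map_one]; exact one_ne_zero)]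
    conv_lhs => rw [e2]
    rw [RingHom.comp_apply, scaleRoots_eval_mul]
    conv_lhs => rw [hsp.eq_prod_roots_of_monic hPm]
    rw [natDegree_multiset_prod_X_sub_C_eq_card, eval_multiset_prod, Multiset.map_map]
    rw [← Multiset.prod_replicate, ← Multiset.map_const', ← Multiset.prod_map_mul]
    congr 1
    apply Multiset.map_congr rfl
    intro α _
    simp
    field_simp
  by_contra! hc
  have hcard : Multiset.card (P.map (ι.comp φ)).roots = P.natDegree := by
    rw [← hsp.natDegree_eq_card_roots, hP.natDegree_map]
  have key : ∀ s : Multiset Ω, (∀ α ∈ s, v (ι t) ^ M < v (ι (φ y) - ι (φ f) * α)) → 1 ≤ Multiset.card s →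
      v (ι t) ^ (Multiset.card s * M) < v ((s.map (fun α => ι (φ y) - ι (φ f) * α)).prod) := by
    intro s
    induction s using Multiset.induction with
    | empty => simp
    | cons a s ih =>
      intro hs _
      rw [Multiset.map_cons, Multiset.prod_cons, Multiset.card_cons, add_mul, one_mul, pow_add, map_mul, mul_comm]
      have ha := hs a (by simp)
      rcases Nat.eq_zero_or_pos (Multiset.card s) with h0 | h0
      · rw [Multiset.card_eq_zero] at h0
        subst h0
        simpa using ha
      · exact mul_lt_mul'' ha (ih (fun α hα => hs α (by simp [hα])) h0) (pow_nonneg zero_le' _) (pow_nonneg zero_le' _)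
  have := key _ hc (by omega)
  rw [← h1, hcard] at this
  exact absurd hval (not_le.2 this)

end VData
end PartP5a

section PartP5b
open IsLocalRing

namespace VData
variable {A Q k σ Ω Γ : Type*} [CommRing A] [IsLocalRing A] [CommRing Q] [Field k] [Field Ω]
    [LinearOrderedCommGroupWithZero Γ]
    {x : σ → A} {u : σ → Q} {t : Q} {φ : A →+* Q} {ψ : Q →+* MvPolynomial σ k} {res : A →+* k}
    {ι : Q →+* Ω} {v : Valuation Ω Γ}

open Polynomial in
lemma pigeon (h : BlowData x u t φ ψ res) (hv : VData t ψ ι v) [IsAlgClosed Ω] (P : A[X]) (hP : P.Monic)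
    (hD : 1 ≤ P.natDegree) (S : ℕ → A → A → ℕ → Prop)
    (hanti : ∀ C C' y f n, C ≤ C' → S C' y f n → S C y f n)
    (hS : ∀ C, ∃ y f n, S C y f n)
    (hS1 : ∀ C y f n, S C y f n → f ∉ maximalIdeal A ^ (n+1))
    (hS2 : ∀ C y f n, S C y f n →
      (P.scaleRoots f).eval y ∈ maximalIdeal A ^ (P.natDegree * (C * (n+1)))) :
    ∃ α ∈ (P.map (ι.comp φ)).roots, ∀ C, ∃ y f n, S C y f n ∧
      v (ι (φ y) - ι (φ f) * α) ≤ v (ι t) ^ (C * (n+1)) := by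
  classical
  by_contra! hc
  choose! B hB using hc
  set R := (P.map (ι.comp φ)).roots.toFinset
  obtain ⟨y, f, n, hs⟩ := hS (R.sup B)
  have hf0 : ι (φ f) ≠ 0 := by
    intro h0
    apply hS1 _ _ _ _ hs
    apply hv.mem_of_val h
    rw [h0, map_zero]
    exact zero_le
  obtain ⟨α, hα, hle⟩ := hv.near h P hP hD hf0 _ (hS2 _ _ _ _ hs)
  have hBα : B α ≤ R.sup B := Finset.le_sup (by rw [Multiset.mem_toFinset]; exact hα)
  have := hB α hα y f n (hanti _ _ _ _ _ hBα hs)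
  refine absurd (hle.trans (hv.pow_anti ?_)) (not_le.2 this)
  exact Nat.mul_le_mul_right _ hBα

open Polynomial in
/-- best approximation of a root by elements of `A` -/
lemma best (h : BlowData x u t φ ψ res) (hv : VData t ψ ι v) (hcomp : IsAdicComplete (maximalIdeal A) A)
    (P : A[X]) (hnr : ∀ a, P.eval a ≠ 0) (α : Ω) (hα : P.eval₂ (ι.comp φ) α = 0) (hα1 : v α ≤ 1) :
    ∃ (M : ℕ) (a : A), v (α - ι (φ a)) ≤ v (ι t) ^ M ∧
      ∀ b, ¬ v (α - ι (φ b)) ≤ v (ι t) ^ (M+1) := by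
  by_contra! hc
  have hall : ∀ M, ∃ a, v (α - ι (φ a)) ≤ v (ι t) ^ M := by
    intro M
    induction M with
    | zero => exact ⟨0, by simpa using hα1⟩
    | succ M ih =>
      obtain ⟨a, ha⟩ := ih
      exact hc M a ha
  choose a ha using hall
  have hCau : ∀ {m n}, m ≤ n → a m ≡ a n [SMOD (maximalIdeal A ^ m • ⊤ : Submodule A A)] := by
    intro m n hmn
    rw [SModEq.sub_mem, smul_eq_mul, Ideal.mul_top]
    apply hv.mem_of_val h
    have : ι (φ (a m - a n)) = (α - ι (φ (a n))) - (α - ι (φ (a m))) := by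
      rw [map_sub, map_sub]; ring
    rw [this]
    exact (v.map_sub_le ((ha n).trans (hv.pow_anti hmn)) (ha m))
  obtain ⟨L, hL⟩ := IsPrecomplete.prec hcomp.toIsPrecomplete hCau
  apply hnr L
  refine IsHausdorff.haus hcomp.toIsHausdorff _ (fun n => ?_)
  rw [SModEq.zero, smul_eq_mul, Ideal.mul_top]
  have h1 : P.eval (a n) ∈ maximalIdeal A ^ n := by
    apply hv.mem_of_val h
    have e : ι (φ (P.eval (a n))) = P.eval₂ (ι.comp φ) (ι (φ (a n))) := by
      rw [← RingHom.comp_apply ι φ (a n), Polynomial.eval₂_at_apply]; rfl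
    have hdiff : ∃ w, v w ≤ 1 ∧ P.eval₂ (ι.comp φ) α - P.eval₂ (ι.comp φ) (ι (φ (a n))) =
        (α - ι (φ (a n))) * w := by
      have hintg : ∀ z : Ω, v z ≤ 1 ↔ z ∈ v.integer := fun z => Iff.rfl
      let ψ0 : A →+* v.integer := (ι.comp φ).codRestrict v.integer (fun a => hv.le_one _)
      have hmem : ∀ z : Ω, P.eval₂ (ι.comp φ) z = (P.map (ι.comp φ)).eval z := by
        intro z; rw [eval_map]
      obtain ⟨w, hw⟩ := Polynomial.sub_dvd_eval_sub (⟨α, hα1⟩ : v.integer) (ψ0 (a n)) (P.map ψ0)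
      refine ⟨w, w.2, ?_⟩
      have := congrArg (v.integer.subtype) hw
      rw [map_sub, map_mul, map_sub] at this
      have e2 : ∀ z : v.integer, v.integer.subtype ((P.map ψ0).eval z) = P.eval₂ (ι.comp φ) z := by
        intro z
        rw [Polynomial.eval_map, Polynomial.hom_eval₂]
        rfl
      rw [e2, e2] at this
      exact this
    obtain ⟨w, hw, hw2⟩ := hdiff
    rw [hα, zero_sub] at hw2
    rw [e, ← Valuation.map_neg, hw2, map_mul]
    exact (mul_le_of_le_one_right' hw).trans (ha n)
  have h2 : P.eval L - P.eval (a n) ∈ maximalIdeal A ^ n := by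
    obtain ⟨w, hw⟩ := Polynomial.sub_dvd_eval_sub L (a n) P
    rw [hw]
    apply Ideal.mul_mem_right
    have := (hL n).symm
    rwa [SModEq.sub_mem, smul_eq_mul, Ideal.mul_top] at this
  have := Ideal.add_mem _ h2 h1
  simpa using this

end VData
end PartP5b

section PartP5c
open IsLocalRing

lemma MvPolynomial.homog_dvd {k σ : Type*} [Field k] {n M : ℕ} {F Y : MvPolynomial σ k}
    (hF : F.IsHomogeneous n) (hY : Y.IsHomogeneous (n + M)) (hd : F ∣ Y) :
    ∃ H : MvPolynomial σ k, H.IsHomogeneous M ∧ Y = F * H := by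
  classical
  have := MvPolynomial.gradedAlgebra (σ := σ) (R := k)
  obtain ⟨H, rfl⟩ := hd
  have h1 := DirectSum.coe_decompose_mul_add_of_left_mem (MvPolynomial.homogeneousSubmodule σ k)
    (i := n) (j := M) (a := F) (b := H) hF
  refine ⟨_, (DirectSum.decompose (MvPolynomial.homogeneousSubmodule σ k) H M).2, ?_⟩
  rw [← h1]
  exact (DirectSum.decompose_of_mem_same _ hY).symm

namespace VData
variable {A Q k σ Ω Γ : Type*} [CommRing A] [IsLocalRing A] [CommRing Q] [Field k] [Field Ω]
    [LinearOrderedCommGroupWithZero Γ]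
    {x : σ → A} {u : σ → Q} {t : Q} {φ : A →+* Q} {ψ : Q →+* MvPolynomial σ k} {res : A →+* k}
    {ι : Q →+* Ω} {v : Valuation Ω Γ}

lemma forms (h : BlowData x u t φ ψ res) (hv : VData t ψ ι v) {α : Ω} {M : ℕ} {a : A}
    (h1 : v (α - ι (φ a)) ≤ v (ι t) ^ M) (h2 : ∀ b, ¬ v (α - ι (φ b)) ≤ v (ι t) ^ (M+1))
    {y f : A} {n : ℕ} (hf : f ∈ maximalIdeal A ^ n) (hf' : f ∉ maximalIdeal A ^ (n+1))
    (hy : v (ι (φ y) - ι (φ f) * α) ≤ v (ι t) ^ ((M+1) * (n+1))) :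
    ∃ Y F, φ (y - a * f) = t ^ (n + M) * Y ∧ φ f = t ^ n * F ∧ ψ F ≠ 0 ∧ ¬ ψ F ∣ ψ Y := by
  obtain ⟨F, hF, -, hF0⟩ := h.form_of_mem hf
  have hF0 : ψ F ≠ 0 := fun h0 => hf' (hF0 h0)
  have hfv := hv.val_eq hF hF0
  have hge : n + M + 1 ≤ (M+1) * (n+1) := by nlinarith
  have hym : y - a * f ∈ maximalIdeal A ^ (n + M) := by
    apply hv.mem_of_val h
    have e : ι (φ (y - a * f)) = (ι (φ y) - ι (φ f) * α) + ι (φ f) * (α - ι (φ a)) := by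
      simp only [map_sub, map_mul]; ring
    rw [e]
    refine v.map_add_le (hy.trans (hv.pow_anti (by omega))) ?_
    rw [map_mul, hfv, pow_add]
    exact mul_le_mul_right h1 _
  obtain ⟨Y, hY, -⟩ := h.form_of_mem hym
  refine ⟨Y, F, hY, hF, hF0, fun hd => ?_⟩
  obtain ⟨H, hH, he⟩ := MvPolynomial.homog_dvd (h.homog_of_form hF) (h.homog_of_form hY) hd
  obtain ⟨b, B, hb, rfl⟩ := h.lift H hH
  apply h2 (a + b)
  have hm : y - a * f - b * f ∈ maximalIdeal A ^ (n + M + 1) := by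
    refine h.mem_succ_of_form (g := Y - B * F) ?_ ?_
    · rw [map_sub, hY, map_mul, hb, hF]; ring
    · rw [map_sub, map_mul, he]; ring
  have hm' := hv.val_le h hm
  have e : ι (φ f) * (α - ι (φ (a + b))) = ι (φ (y - a * f - b * f)) - (ι (φ y) - ι (φ f) * α) := by
    simp only [map_sub, map_mul, map_add]; ring
  have hle : v (ι (φ f) * (α - ι (φ (a + b)))) ≤ v (ι t) ^ (n + M + 1) := by
    rw [e]
    exact v.map_sub_le hm' (hy.trans (hv.pow_anti hge))
  rw [map_mul, hfv, show n + M + 1 = n + (M + 1) by ring, pow_add] at hle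
  exact le_of_mul_le_mul_left hle (pow_pos hv.pos _)

lemma forms_eq (h : BlowData x u t φ ψ res) (hv : VData t ψ ι v) {α : Ω} {M : ℕ} {a : A}
    {y f y' f' : A} {n n' : ℕ} {Y F Y' F' : Q}
    (hy : v (ι (φ y) - ι (φ f) * α) ≤ v (ι t) ^ ((M+1) * (n+1)))
    (hy' : v (ι (φ y') - ι (φ f') * α) ≤ v (ι t) ^ ((M+1) * (n'+1)))
    (hY : φ (y - a * f) = t ^ (n + M) * Y) (hF : φ f = t ^ n * F)
    (hY' : φ (y' - a * f') = t ^ (n' + M) * Y') (hF' : φ f' = t ^ n' * F') :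
    ψ Y * ψ F' = ψ Y' * ψ F := by
  rw [← map_mul, ← map_mul, ← sub_eq_zero, ← map_sub]
  by_contra h0
  have hge : n + M + 1 ≤ (M+1) * (n+1) := by nlinarith
  have hge' : n' + M + 1 ≤ (M+1) * (n'+1) := by nlinarith
  have hfv : v (ι (φ f)) ≤ v (ι t) ^ n := hv.val_le h (h.mem_of_form hF)
  have hfv' : v (ι (φ f')) ≤ v (ι t) ^ n' := hv.val_le h (h.mem_of_form hF')
  have e1 : φ (y * f' - y' * f) = t ^ (n + n' + M) * (Y * F' - Y' * F) := by
    have : y * f' - y' * f = (y - a * f) * f' - (y' - a * f') * f := by ring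
    rw [this, map_sub, map_mul, map_mul, hY, hY', hF, hF']; ring
  have e2 := hv.val_eq e1 h0
  have e3 : ι (φ (y * f' - y' * f)) = (ι (φ y) - ι (φ f) * α) * ι (φ f') -
    (ι (φ y') - ι (φ f') * α) * ι (φ f) := by
    simp only [map_sub, map_mul]; ring
  have e4 : v (ι (φ (y * f' - y' * f))) ≤ v (ι t) ^ (n + n' + M + 1) := by
    rw [e3]
    apply v.map_sub_le
    · rw [map_mul, show n + n' + M + 1 = (n + M + 1) + n' by ring, pow_add]
      exact mul_le_mul' (hy.trans (hv.pow_anti hge)) hfv'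
    · rw [map_mul, show n + n' + M + 1 = (n' + M + 1) + n by ring, pow_add]
      exact mul_le_mul' (hy'.trans (hv.pow_anti hge')) hfv
  rw [e2] at e4
  have := hv.pow_le_pow e4
  omega
end VData

lemma chart_vdata {A Q k σ T : Type*} [CommRing A] [IsLocalRing A] [CommRing Q] [Field k]
    {x : σ → A} {u : σ → Q} {t : Q} {φ : A →+* Q} {ψ : Q →+* MvPolynomial σ k} {res : A →+* k}
    (_h : BlowData x u t φ ψ res) {π : MvPolynomial σ k} (hπ : Prime π)
    [CommRing T] [IsDomain T] {j : Q →+* T} {s0 : Q} 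
    (hT2 : ∀ r n, j r ∈ Ideal.span {j t, j s0 ^ n} → π ^ n ∣ ψ r)
    (hprime : Prime (j t))
    (V : ValuationSubring (AlgebraicClosure (FractionRing T)))
    (hV : ∀ a : T, algebraMap T (AlgebraicClosure (FractionRing T)) a ∈ V)
    (hu : ∀ a : T, ¬ j t ∣ a → (algebraMap T (AlgebraicClosure (FractionRing T)) a)⁻¹ ∈ V)
    (hx : (algebraMap T (AlgebraicClosure (FractionRing T)) (j t))⁻¹ ∉ V) :
    (∀ q, ψ q ≠ 0 → ¬ j t ∣ j q) ∧
    VData t ψ ((algebraMap T (AlgebraicClosure (FractionRing T))).comp j) V.valuation := by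
  have hinj : Function.Injective (algebraMap T (AlgebraicClosure (FractionRing T))) := by
    rw [IsScalarTower.algebraMap_eq T (FractionRing T) _]
    exact (algebraMap (FractionRing T) _).injective.comp (IsFractionRing.injective T _)
  have hnd : ∀ q, ψ q ≠ 0 → ¬ j t ∣ j q := by
    intro q hq hd
    obtain ⟨n, hn⟩ := (FiniteMultiplicity.of_prime_left hπ hq)
    apply hn
    apply hT2
    obtain ⟨c, hc⟩ := hd
    rw [hc]
    exact Ideal.mul_mem_right _ _ (Ideal.subset_span (by simp))
  refine ⟨hnd, ?_, ?_, ?_, ?_⟩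
  · intro q
    rw [ValuationSubring.valuation_le_one_iff]
    exact hV _
  · intro q hq
    apply le_antisymm
    · rw [ValuationSubring.valuation_le_one_iff]; exact hV _
    · have := hu _ (hnd q hq)
      rw [← ValuationSubring.valuation_le_one_iff, map_inv₀] at this
      have h0 : V.valuation (algebraMap T (AlgebraicClosure (FractionRing T)) (j q)) ≠ 0 := by
        rw [Valuation.ne_zero_iff, Ne, map_eq_zero_iff _ hinj]
        intro h0; apply hnd q hq; rw [h0]; exact dvd_zero _
      exact (inv_le_one₀ (zero_lt_iff.2 h0)).1 this
  · rw [Valuation.pos_iff]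
    change algebraMap T _ (j t) ≠ 0
    rw [Ne, map_eq_zero_iff _ hinj]
    exact hprime.ne_zero
  · by_contra hc
    push Not at hc
    apply hx
    rw [← ValuationSubring.valuation_le_one_iff, map_inv₀]
    exact inv_le_one_of_one_le₀ hc
end PartP5c

section PartP5d
open IsLocalRing

open Polynomial in
theorem liouville {A Q k σ : Type*} [CommRing A] [IsLocalRing A] [CommRing Q] [Field k]
    {x : σ → A} {u : σ → Q} {t : Q} {φ : A →+* Q} {ψ : Q →+* MvPolynomial σ k} {res : A →+* k}
    (h : BlowData x u t φ ψ res) (hcomp : IsAdicComplete (maximalIdeal A) A) [hσ : Nonempty σ]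
    (P : A[X]) (hP : P.Monic) (hD : 1 ≤ P.natDegree) (hnr : ∀ a, P.eval a ≠ 0)
    (hsep : ∃ (U W : A[X]) (d : A), d ≠ 0 ∧ U * P + W * derivative P = C d) :
    ∃ N : ℕ, ∀ (y f : A) (n : ℕ), f ∉ maximalIdeal A ^ (n+1) →
      (P.scaleRoots f).eval y ∉ maximalIdeal A ^ (N * (n+1)) := by
  have H : ∀ f : A, (∀ n, f ∈ maximalIdeal A ^ n) → f = 0 := by
    intro f hf
    refine IsHausdorff.haus hcomp.toIsHausdorff _ (fun n => ?_)
    rw [SModEq.zero, smul_eq_mul, Ideal.mul_top]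
    exact hf n
  have hφinj := h.inj H
  by_contra! hbad
  -- bad triples
  let S0 : ℕ → A → A → ℕ → Prop := fun N y f n => f ∈ maximalIdeal A ^ n ∧
    f ∉ maximalIdeal A ^ (n+1) ∧ (P.scaleRoots f).eval y ∈ maximalIdeal A ^ (P.natDegree * (N * (n+1)))
  have hS0 : ∀ N, ∃ y f n, S0 N y f n := by
    intro N
    obtain ⟨y, f, n, h1, h2⟩ := hbad (P.natDegree * N)
    have hf0 : f ≠ 0 := by rintro rfl; exact h1 (zero_mem _)
    obtain ⟨m, hm1, hm2⟩ := BlowData.exists_ord H hf0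
    have hmn : m ≤ n := by
      by_contra hlt
      exact h1 (Ideal.pow_le_pow_right (by omega) hm1)
    refine ⟨y, f, m, hm1, hm2, Ideal.pow_le_pow_right ?_ h2⟩
    rw [← mul_assoc]
    exact Nat.mul_le_mul_left _ (by omega)
  have hS0anti : ∀ C C' y f n, C ≤ C' → S0 C' y f n → S0 C y f n := by
    rintro C C' y f n hCC ⟨h1, h2, h3⟩
    refine ⟨h1, h2, Ideal.pow_le_pow_right ?_ h3⟩
    exact Nat.mul_le_mul_left _ (Nat.mul_le_mul_right _ hCC)
  -- first chart
  obtain ⟨M, a, π, Z, G, ⟨hπ, hπG, hπZ⟩, S1, hS1anti, hS1, hS1S0, hS1forms⟩ :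
      ∃ (M : ℕ) (a : A) (π : MvPolynomial σ k) (Z G : MvPolynomial σ k),
        (Prime π ∧ π ∣ G ∧ ¬ π ∣ Z) ∧ ∃ S1 : ℕ → A → A → ℕ → Prop,
        (∀ C C' y f n, C ≤ C' → S1 C' y f n → S1 C y f n) ∧
        (∀ N, ∃ y f n, S1 N y f n) ∧ (∀ N y f n, S1 N y f n → S0 N y f n) ∧
        (∀ N y f n, M + 1 ≤ N → S1 N y f n → ∃ Y F, φ (y - a * f) = t ^ (n + M) * Y ∧
          φ f = t ^ n * F ∧ ψ F ≠ 0 ∧ Z * ψ F = ψ Y * G) := by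
    obtain ⟨i⟩ := hσ
    obtain ⟨T, _, _, _, _, j, s0, hs0, hT, hT2⟩ := h.chart (MvPolynomial.X i) MvPolynomial.X_prime
    obtain ⟨V, hV, hu, hx⟩ := exists_val (j t) hT.primeX
    obtain ⟨hnd, hv⟩ := chart_vdata h MvPolynomial.X_prime hT2 hT.primeX V hV hu hx
    set ι := (algebraMap T (AlgebraicClosure (FractionRing T))).comp j
    obtain ⟨α, hα, hαS⟩ := hv.pigeon h P hP hD S0 hS0anti hS0 (fun _ _ _ _ h => h.2.1)
      (fun _ _ _ _ h => h.2.2)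
    have hα0 : P.eval₂ (ι.comp φ) α = 0 := by
      rw [← eval_map]; exact (mem_roots'.1 hα).2
    have hα1 : V.valuation α ≤ 1 := by
      rw [ValuationSubring.valuation_le_one_iff]
      apply ThmT.mem_of_integral V hV
      refine ⟨P.map (j.comp φ), hP.map _, ?_⟩
      rw [eval₂_map]
      exact hα0
    obtain ⟨M, a, hM1, hM2⟩ := hv.best h hcomp P hnr α hα0 hα1
    let S1 : ℕ → A → A → ℕ → Prop := fun N y f n => S0 N y f n ∧
      V.valuation (ι (φ y) - ι (φ f) * α) ≤ V.valuation (ι t) ^ (N * (n+1))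
    obtain ⟨y1, f1, n1, hs1⟩ := hαS (M+1)
    obtain ⟨Y1, F1, hY1, hF1, hF10, hndvd⟩ := hv.forms h hM1 hM2 hs1.1.1 hs1.1.2.1 hs1.2
    obtain ⟨Z, G, d, hcop, hZ, hG⟩ := UniqueFactorizationMonoid.exists_reduced_factors' (ψ Y1) (ψ F1) hF10
    have hG0 : G ≠ 0 := by rintro rfl; apply hF10; rw [← hG, mul_zero]
    have hd0 : d ≠ 0 := by rintro rfl; apply hF10; rw [← hG, zero_mul]
    have hGu : ¬ IsUnit G := by
      intro hu
      apply hndvd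
      rw [← hG, ← hZ]
      exact mul_dvd_mul_left d hu.dvd
    obtain ⟨π, hπ, hπG⟩ := WfDvdMonoid.exists_irreducible_factor hGu hG0
    have hπp := UniqueFactorizationMonoid.irreducible_iff_prime.1 hπ
    refine ⟨M, a, π, Z, G, ⟨hπp, hπG, fun hπZ => hπp.not_isUnit (hcop hπZ hπG)⟩, S1, ?_, hαS, ?_, ?_⟩
    · rintro C C' y f n hCC ⟨h1, h2⟩
      exact ⟨hS0anti _ _ _ _ _ hCC h1, h2.trans (hv.pow_anti (Nat.mul_le_mul_right _ hCC))⟩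
    · exact fun _ _ _ _ h => h.1
    · intro N y f n hN hs
      have hle := hs.2.trans (hv.pow_anti (Nat.mul_le_mul_right (n+1) hN))
      obtain ⟨Y, F, hY, hF, hF0, -⟩ := hv.forms h hM1 hM2 hs.1.1 hs.1.2.1 hle
      refine ⟨Y, F, hY, hF, hF0, ?_⟩
      have := hv.forms_eq h hs1.2 hle hY1 hF1 hY hF
      rw [← hZ, ← hG] at this
      apply mul_left_cancel₀ hd0
      linear_combination this
  obtain ⟨T, _, _, _, _, j, s0, hs0, hT, hT2⟩ := h.chart π hπ
  obtain ⟨V, hV, hu, hx⟩ := exists_val (j t) hT.primeX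
  obtain ⟨hnd, hv⟩ := chart_vdata h hπ hT2 hT.primeX V hV hu hx
  set Ω := AlgebraicClosure (FractionRing T)
  have hinj : Function.Injective (algebraMap T Ω) := by
    rw [IsScalarTower.algebraMap_eq T (FractionRing T) _]
    exact (algebraMap (FractionRing T) _).injective.comp (IsFractionRing.injective T _)
  set ι := (algebraMap T Ω).comp j with hι
  have hιj : ∀ q, ι q = algebraMap T Ω (j q) := fun q => rfl
  have hιinj : ∀ f, ι (φ f) = 0 → f = 0 := by
    intro f hf
    apply H
    intro n
    apply hv.mem_of_val h
    rw [hf, map_zero]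
    exact zero_le
  obtain ⟨α, hα, hαS⟩ := hv.pigeon h P hP hD S1 hS1anti hS1 (fun _ _ _ _ h => (hS1S0 _ _ _ _ h).2.1)
    (fun _ _ _ _ h => (hS1S0 _ _ _ _ h).2.2)
  have hα0 : P.eval₂ (ι.comp φ) α = 0 := by
    rw [← eval_map]; exact (mem_roots'.1 hα).2
  have hαint : IsIntegral T α := by
    refine ⟨P.map (j.comp φ), hP.map _, ?_⟩
    rw [eval₂_map]
    exact hα0
  have htne : ι t ≠ 0 := by
    intro h0; have := hv.pos; rw [h0, map_zero] at this; exact lt_irrefl _ this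
  have hdiv : ∀ (m : ℕ) (b : T), V.valuation (algebraMap T Ω b) ≤ V.valuation (ι t) ^ m → j t ^ m ∣ b := by
    intro m b hb
    by_cases hb0 : b = 0
    · rw [hb0]; exact dvd_zero _
    obtain ⟨c, b', rfl, hb'⟩ := hT.exists_Xpow hb0
    refine (pow_dvd_pow _ ?_).trans (dvd_mul_right _ _)
    apply hv.pow_le_pow
    refine le_trans (le_of_eq ?_) hb
    have h1 : V.valuation (algebraMap T Ω b') = 1 := by
      apply le_antisymm
      · rw [ValuationSubring.valuation_le_one_iff]; exact hV _
      · have := hu _ hb'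
        rw [← ValuationSubring.valuation_le_one_iff, map_inv₀] at this
        refine (inv_le_one₀ (zero_lt_iff.2 ?_)).1 this
        rw [Valuation.ne_zero_iff, Ne, map_eq_zero_iff _ hinj]
        intro h0; apply hb'; rw [h0]; exact dvd_zero _
    rw [map_mul, map_mul, h1, mul_one, map_pow, map_pow]
    rfl
  set α' := α - ι (φ a) with hα'def
  -- value estimate
  have hest : ∀ (y f : A) (n : ℕ) (Y F : Q) (N : ℕ), φ (y - a * f) = t ^ (n + M) * Y → φ f = t ^ n * F →
      V.valuation (ι (φ y) - ι (φ f) * α) ≤ V.valuation (ι t) ^ ((N + 1) * (n + 1)) →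
      V.valuation (algebraMap T Ω (j (t ^ M * Y)) - algebraMap T Ω (j F) * α') ≤
        V.valuation (ι t) ^ (N * (n+1) + 1) := by
    intro y f n Y F N hY hF hle
    have e : ι (φ y) - ι (φ f) * α =
        ι t ^ n * (algebraMap T Ω (j (t ^ M * Y)) - algebraMap T Ω (j F) * α') := by
      have e1 : ι (φ (y - a * f)) = ι t ^ n * ι (t ^ M * Y) := by
        rw [hY, ← map_pow, ← map_mul]; congr 1; ring
      have e2 : ι (φ f) = ι t ^ n * ι F := by rw [hF, map_mul, map_pow]
      rw [← hιj, ← hιj, mul_sub, ← e1, hα'def]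
      simp only [map_sub, map_mul]
      rw [← mul_assoc, ← e2]
      ring
    rw [e, map_mul, map_pow, show (N + 1) * (n + 1) = n + (N * (n+1) + 1) by ring, pow_add] at hle
    exact le_of_mul_le_mul_left hle (pow_pos hv.pos _)
  have hα'T : ∀ b, algebraMap T Ω b ≠ α' := by
    intro β hβ
    obtain ⟨y, f, n, hs, hle⟩ := hαS (M+1)
    obtain ⟨Y, F, hY, hF, hF0, hZG⟩ := hS1forms _ _ _ _ le_rfl hs
    have h1 := hest y f n Y F M hY hF hle
    rw [← hβ, ← map_mul, ← map_sub] at h1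
    have h2 := hdiv _ _ (h1.trans (hv.pow_anti (show M + 1 ≤ M * (n+1) + 1 by nlinarith)))
    rw [map_mul, map_pow] at h2
    obtain ⟨c, hc⟩ := h2
    have h3 : j t ^ M ∣ j F * β := ⟨j Y - j t * c, by rw [pow_succ] at hc; linear_combination -hc⟩
    obtain ⟨β0, rfl⟩ := hT.primeX.pow_dvd_of_dvd_mul_left M (hnd F hF0) h3
    have h4 : j Y - j F * β0 = j t * c := by
      apply mul_left_cancel₀ (pow_ne_zero M hT.primeX.ne_zero)
      linear_combination hc
    obtain ⟨z, rfl⟩ := h.surj Z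
    obtain ⟨g, rfl⟩ := h.surj G
    obtain ⟨q', hq'⟩ := hπG
    obtain ⟨q, rfl⟩ := h.surj q'
    obtain ⟨r1, hr1⟩ := (h.ker (z * F - Y * g)).1 (by rw [map_sub, map_mul, map_mul, hZG, sub_self])
    obtain ⟨r2, hr2⟩ := (h.ker (g - s0 * q)).1 (by rw [map_sub, map_mul, hq', hs0, sub_self])
    have hr1' := congrArg j hr1
    have hr2' := congrArg j hr2
    simp only [map_sub, map_mul] at hr1' hr2'
    have h5 : j t ∣ j F * (β0 * j g - j z) := ⟨-c * j g - j r1, by linear_combination -hr1' - j g * h4⟩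
    obtain ⟨c', hc'⟩ := (hT.primeX.dvd_or_dvd h5).resolve_left (hnd F hF0)
    apply hπZ
    have := hT2 z 1 (by
      rw [pow_one, Ideal.mem_span_pair]
      exact ⟨β0 * j r2 - c', β0 * j q, by linear_combination hc' - β0 * hr2'⟩)
    rwa [pow_one] at this
  set P1 : T[X] := (P.map (j.comp φ)).comp (X + C (j (φ a))) with hP1
  have haev : ∀ R : A[X], aeval α' ((R.map (j.comp φ)).comp (X + C (j (φ a)))) = R.eval₂ (ι.comp φ) α := by
    intro R
    rw [aeval_comp, map_add, aeval_X, aeval_C, hα'def, hιj, sub_add_cancel, aeval_def, eval₂_map]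
    rfl
  have hP10 : aeval α' P1 = 0 := by rw [hP1, haev, hα0]
  have hP1' : aeval α' (derivative P1) ≠ 0 := by
    have : derivative P1 = ((derivative P).map (j.comp φ)).comp (X + C (j (φ a))) := by
      rw [hP1, derivative_comp, derivative_map]; simp
    rw [this, haev]
    intro h0
    obtain ⟨U, W, d, hd, hUW⟩ := hsep
    have := congrArg (eval₂ (ι.comp φ) α) hUW
    rw [eval₂_add, eval₂_mul, eval₂_mul, hα0, h0, eval₂_C, mul_zero, mul_zero, add_zero] at this
    exact hd (hιinj d this.symm)
  obtain ⟨Mt, hMt⟩ := ThmT.thmT hT hinj V hV hu hx α' (hαint.sub isIntegral_algebraMap) hα'T P1 hP10 hP1'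
  obtain ⟨y, f, n, hs, hle⟩ := hαS ((M + Mt)+1)
  obtain ⟨Y, F, hY, hF, hF0, hZG⟩ := hS1forms _ _ _ _ (by omega) hs
  have h1 := hest y f n Y F _ hY hF hle
  have h2 := hMt (n+1) (j F) (j (t ^ M * Y)) (by
    refine ⟨(algebraMap T Ω (j (t ^ M * Y)) - algebraMap T Ω (j F) * α') / ι t ^ (Mt * (n+1)), ?_, ?_⟩
    · rw [← ValuationSubring.valuation_le_one_iff, map_div₀, map_pow]
      apply div_le_one_of_le₀ _ zero_le
      refine h1.trans (hv.pow_anti ?_)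
      nlinarith
    · rw [← hιj t, mul_div_cancel₀]
      exact pow_ne_zero _ htne)
  have h3 := hT2 F (n+1) h2
  obtain ⟨R, hR⟩ := h3
  have hπR : R ≠ 0 := by rintro rfl; rw [mul_zero] at hR; exact hF0 hR
  have hdeg := congrArg MvPolynomial.totalDegree hR
  rw [MvPolynomial.totalDegree_mul_of_isDomain (pow_ne_zero _ hπ.ne_zero) hπR,
    (h.homog_of_form hF).totalDegree hF0] at hdeg
  have hpow : ∀ m, (π ^ m).totalDegree = m * π.totalDegree := by
    intro m
    induction m with
    | zero => simp
    | succ m ih => rw [pow_succ, MvPolynomial.totalDegree_mul_of_isDomain (pow_ne_zero _ hπ.ne_zero) hπ.ne_zero, ih]; ring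
  have hπdeg : π.totalDegree ≠ 0 := by
    intro h0
    rw [MvPolynomial.totalDegree_eq_zero_iff_eq_C] at h0
    apply hπ.not_isUnit
    rw [h0]
    apply IsUnit.map
    rw [isUnit_iff_ne_zero]
    intro h1
    rw [h1, map_zero] at h0
    exact hπ.ne_zero h0
  rw [hpow] at hdeg
  have : n + 1 ≤ (n+1) * π.totalDegree := Nat.le_mul_of_pos_right _ (by omega)
  omega
end PartP5d

section PartP4a
open IsLocalRing

lemma ufd_dvd {M : Type*} [CommRing M] [IsDomain M] [UniqueFactorizationMonoid M]
    {c f g : M} (hc : c ≠ 0) (hg : g ≠ 0) (h : ∀ n : ℕ, g ^ n ∣ c * f ^ n) : g ∣ f := by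
  obtain ⟨f', g', d, hcop, rfl, rfl⟩ := UniqueFactorizationMonoid.exists_reduced_factors' f g hg
  have hd : d ≠ 0 := left_ne_zero_of_mul hg
  by_cases hu : IsUnit g'
  · exact mul_dvd_mul_left d hu.dvd
  exfalso
  have hfin : FiniteMultiplicity g' c := FiniteMultiplicity.of_not_isUnit hu hc
  obtain ⟨n, hn⟩ := hfin
  apply hn
  have := h (n+1)
  rw [mul_pow, mul_pow, mul_left_comm] at this
  have h2 := (mul_dvd_mul_iff_left (pow_ne_zero (n+1) hd)).1 this
  have : IsRelPrime (g' ^ (n+1)) (f' ^ (n+1)) := IsRelPrime.pow hcop.symm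
  exact this.dvd_of_dvd_mul_right h2

lemma int_denom {O : Type*} [CommRing O] [IsDomain O] (g k : O)
    (hintg : IsIntegral O (algebraMap O (FractionRing O) g / algebraMap O (FractionRing O) k))
    (hk : k ≠ 0) : ∃ d : O, d ≠ 0 ∧ ∀ n : ℕ, k ^ n ∣ d * g ^ n := by
  have hka : algebraMap O (FractionRing O) k ≠ 0 := by simpa using hk
  have hfg := hintg.fg_adjoin_singleton
  obtain ⟨S, hS⟩ := hfg
  obtain ⟨b, hb⟩ := IsLocalization.exist_integer_multiples_of_finset (nonZeroDivisors O) S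
  refine ⟨b, nonZeroDivisors.ne_zero b.2, fun n => ?_⟩
  have hm : ∀ z ∈ Submodule.span O (S : Set (FractionRing O)),
      IsLocalization.IsInteger O (((b : O)) • z) := by
    intro z hz
    refine Submodule.span_induction ?_ ?_ ?_ ?_ hz
    · intro z hz; exact hb z hz
    · exact ⟨0, by simp⟩
    · rintro x y _ _ ⟨a, ha⟩ ⟨b', hb'⟩; exact ⟨a + b', by rw [map_add, ha, hb', smul_add]⟩
    · rintro r x _ ⟨a, ha⟩; exact ⟨r * a, by rw [map_mul, ha, smul_comm, Algebra.smul_def r]⟩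
  have hz : (algebraMap O (FractionRing O) g / algebraMap O (FractionRing O) k) ^ n ∈
      Submodule.span O (S : Set (FractionRing O)) := by
    rw [hS]
    exact Subalgebra.pow_mem _ (Algebra.self_mem_adjoin_singleton _ _) n
  obtain ⟨t, ht⟩ := hm _ hz
  refine ⟨t, ?_⟩
  apply IsFractionRing.injective O (FractionRing O)
  rw [map_mul, map_mul, map_pow, map_pow, ht, Algebra.smul_def, div_pow]
  field_simp

theorem BlowData.normal {A Q k σ : Type*} [CommRing A] [IsLocalRing A] [CommRing Q] [Field k]
    [IsDomain A] [IsNoetherianRing A]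
    {x : σ → A} {u : σ → Q} {t : Q} {φ : A →+* Q} {ψ : Q →+* MvPolynomial σ k} {res : A →+* k}
    (h : BlowData x u t φ ψ res) (H : ∀ f : A, (∀ n, f ∈ maximalIdeal A ^ n) → f = 0) :
    IsIntegrallyClosed A := by
  rw [isIntegrallyClosed_iff (FractionRing A)]
  intro z hz
  obtain ⟨a, b, hb0, rfl⟩ := IsFractionRing.div_surjective (A := A) z
  have hb : b ≠ 0 := nonZeroDivisors.ne_zero hb0
  have hba : algebraMap A (FractionRing A) b ≠ 0 := by simpa using hb
  obtain ⟨β, G, hG, hG0⟩ := h.exists_form H hb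
  have step : ∀ n, ∃ q, a - q * b ∈ maximalIdeal A ^ n := by
    intro n
    induction n with
    | zero => exact ⟨0, by simp⟩
    | succ n ih =>
      obtain ⟨q, hq⟩ := ih
      set a' := a - q * b
      have hintg : IsIntegral A (algebraMap A (FractionRing A) a' / algebraMap A (FractionRing A) b) := by
        have : algebraMap A (FractionRing A) a' / algebraMap A (FractionRing A) b =
            algebraMap A (FractionRing A) a / algebraMap A (FractionRing A) b - algebraMap A _ q := by
          simp only [a', map_sub, map_mul]; field_simp
        rw [this]
        exact hz.sub isIntegral_algebraMap
      obtain ⟨d, hd0, hd⟩ := int_denom a' b hintg hb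
      by_cases hn : a' ∈ maximalIdeal A ^ (n+1)
      · exact ⟨q, hn⟩
      obtain ⟨F, hF, hFh, hF0⟩ := h.form_of_mem hq
      have hF0 : ψ F ≠ 0 := fun h0 => hn (hF0 h0)
      obtain ⟨γ, C, hC, hC0⟩ := h.exists_form H hd0
      have hbpow : ∀ j : ℕ, φ (b ^ j) = t ^ (β * j) * G ^ j := by
        intro j; rw [map_pow, hG, mul_pow, ← pow_mul]
      have hapow : ∀ j : ℕ, φ (d * a' ^ j) = t ^ (γ + n * j) * (C * F ^ j) := by
        intro j; rw [map_mul, map_pow, hC, hF, mul_pow, ← pow_mul]; ring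
      have hβn : β ≤ n := by
        by_contra hlt
        push Not at hlt
        obtain ⟨s, hs⟩ := hd (γ + 1)
        have h1 : d * a' ^ (γ+1) ∉ maximalIdeal A ^ (γ + n * (γ+1) + 1) :=
          h.not_mem_of_form (hapow _) (by rw [map_mul, map_pow]; exact mul_ne_zero hC0 (pow_ne_zero _ hF0))
        apply h1
        rw [hs]
        apply Ideal.mul_mem_right
        exact Ideal.pow_le_pow_right (by nlinarith) (h.mem_of_form (hbpow (γ+1)))
      have hdvd : ψ G ∣ ψ F := by
        apply ufd_dvd hC0 hG0
        intro j
        obtain ⟨s, hs⟩ := hd j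
        have h1 : s ∈ maximalIdeal A ^ (γ + n * j - β * j) := by
          apply h.mul_mem (n := β * j) (f := b ^ j)
          · exact h.not_mem_of_form (hbpow j) (by rw [map_pow]; exact pow_ne_zero _ hG0)
          · rw [← hs, Nat.sub_add_cancel (by nlinarith)]
            exact h.mem_of_form (hapow j)
        obtain ⟨S, hS, -⟩ := h.form_of_mem h1
        refine ⟨ψ S, ?_⟩
        have := hapow j
        rw [hs, map_mul, hbpow, hS] at this
        have h2 : t ^ (γ + n * j) * (G ^ j * S) = t ^ (γ + n * j) * (C * F ^ j) := by
          rw [← this]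
          conv_lhs => rw [show γ + n * j = β * j + (γ + n * j - β * j) by
            rw [Nat.add_sub_cancel' (by nlinarith)], pow_add]
          ring
        have h3 := congrArg ψ (h.regpow _ h2)
        simp only [map_mul, map_pow] at h3
        exact h3.symm
      obtain ⟨e, rfl⟩ := Nat.exists_eq_add_of_le hβn
      obtain ⟨E, hE, hFE⟩ := MvPolynomial.homog_dvd (h.homog_of_form hG) hFh hdvd
      obtain ⟨c, c', hc, hc'⟩ := h.lift E hE
      refine ⟨q + c, ?_⟩
      apply h.mem_succ_of_form (g := F - G * c')
      · have : a - (q + c) * b = a' - c * b := by simp only [a']; ring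
        rw [this, map_sub, map_mul, hF, hc, hG]
        ring
      · rw [map_sub, map_mul, hc', hFE, sub_self]
  have hmem : a ∈ Ideal.span {b} := by
    by_cases hbu : IsUnit b
    · rw [Ideal.span_singleton_eq_top.2 hbu]; trivial
    have hne : (Ideal.span {b} : Ideal A) ≠ ⊤ := fun h => hbu (Ideal.span_singleton_eq_top.1 h)
    have : Nontrivial (A ⧸ Ideal.span {b}) := Ideal.Quotient.nontrivial_iff.2 hne
    have hl : IsLocalRing (A ⧸ Ideal.span {b}) := IsLocalRing.of_surjective' (Ideal.Quotient.mk _) Ideal.Quotient.mk_surjective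
    rw [← Ideal.Quotient.eq_zero_iff_mem]
    have h1 := Ideal.iInf_pow_smul_eq_bot_of_isLocalRing (M := A ⧸ Ideal.span {b}) (maximalIdeal A) (Ideal.IsPrime.ne_top inferInstance)
    rw [← Submodule.mem_bot A, ← h1]
    rw [Submodule.mem_iInf]
    intro n
    obtain ⟨q, hq⟩ := step n
    have : (Ideal.Quotient.mk (Ideal.span {b}) a) = (a - q * b) • (1 : A ⧸ Ideal.span {b}) := by
      rw [Algebra.smul_def, mul_one]
      change _ = Ideal.Quotient.mk _ _
      rw [Ideal.Quotient.eq]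
      rw [Ideal.mem_span_singleton]
      exact ⟨q, by ring⟩
    rw [this]
    exact Submodule.smul_mem_smul hq trivial
  obtain ⟨q, rfl⟩ := Ideal.mem_span_singleton.1 hmem
  exact ⟨q, by rw [map_mul]; field_simp⟩
end PartP4a

section PartP4b
open IsLocalRing

namespace ValPoly
open Polynomial
variable {Ω Γ : Type*} [Field Ω] [LinearOrderedCommGroupWithZero Γ] (v : Valuation Ω Γ)

lemma coeff_mul_le {p q : Polynomial Ω} {a b : Γ} (hp : ∀ k, v (p.coeff k) ≤ a) (hq : ∀ k, v (q.coeff k) ≤ b) (k : ℕ) :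
    v ((p * q).coeff k) ≤ a * b := by
  rw [coeff_mul]
  apply Valuation.map_sum_le
  intro i _
  rw [map_mul]
  exact mul_le_mul' (hp _) (hq _)

lemma eval_le {p : Polynomial Ω} {a : Γ} (hp : ∀ k, v (p.coeff k) ≤ a) {r : Ω} (hr : v r ≤ 1) : v (p.eval r) ≤ a := by
  rw [eval_eq_sum_range]
  apply Valuation.map_sum_le
  intro i _
  rw [map_mul, map_pow]
  exact mul_le_of_le_of_le_one (hp i) (pow_le_one' hr i)

lemma prod_coeff_le (M : Multiset Ω) (hM : ∀ r ∈ M, v r ≤ 1) (k : ℕ) :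
    v (((M.map (fun r => X - C r)).prod).coeff k) ≤ 1 := by
  induction M using Multiset.induction generalizing k with
  | empty =>
    simp only [Multiset.map_zero, Multiset.prod_zero, coeff_one]
    split_ifs <;> simp
  | cons a M ih =>
    rw [Multiset.map_cons, Multiset.prod_cons, ← one_mul (1 : Γ)]
    apply coeff_mul_le v
    · intro k
      rw [coeff_sub, coeff_X, coeff_C]
      refine (v.map_sub _ _).trans (max_le ?_ ?_)
      · split_ifs <;> simp
      · split_ifs
        · exact hM a (by simp)
        · simp
    · exact ih fun r hr => hM r (by simp [hr])

lemma near_coeff_le (M : Multiset Ω) {b : Γ} (hb : b ≤ 1) (hM : ∀ r ∈ M, v r ≤ b) (k : ℕ) :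
    v (((M.map (fun r => X - C r)).prod - X ^ (Multiset.card M)).coeff k) ≤ b := by
  induction M using Multiset.induction generalizing k with
  | empty => simp
  | cons a M ih =>
    rw [Multiset.map_cons, Multiset.prod_cons, Multiset.card_cons]
    have e : (X - C a) * (M.map (fun r => X - C r)).prod - X ^ (Multiset.card M + 1) =
      ((M.map (fun r => X - C r)).prod - X ^ (Multiset.card M)) * X - C a * (M.map (fun r => X - C r)).prod := by
      ring
    rw [e, coeff_sub]
    refine (v.map_sub _ _).trans (max_le ?_ ?_)
    · cases k with
      | zero => simp
      | succ k => rw [coeff_mul_X]; exact ih (fun r hr => hM r (by simp [hr])) k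
    · rw [coeff_C_mul, map_mul]
      exact mul_le_of_le_of_le_one (hM a (by simp))
        (prod_coeff_le v M (fun r hr => (hM r (by simp [hr])).trans hb) k)

lemma split_coeff (Mf Mn : Multiset Ω) {b : Γ} (hb : b ≤ 1) (hf : ∀ r ∈ Mf, v r ≤ 1) (hn : ∀ r ∈ Mn, v r ≤ b) (k : ℕ) :
    v (((Mf.map (fun r => X - C r)).prod * (Mn.map (fun r => X - C r)).prod).coeff (k + Multiset.card Mn)
      - ((Mf.map (fun r => X - C r)).prod).coeff k) ≤ b := by
  rw [← coeff_mul_X_pow ((Mf.map (fun r => X - C r)).prod) (Multiset.card Mn) k, ← coeff_sub, ← mul_sub]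
  rw [← one_mul b]
  exact coeff_mul_le v (prod_coeff_le v Mf hf) (near_coeff_le v Mn hb hn) _

lemma prod_ge (M : Multiset Ω) {a : Γ} (h : ∀ r ∈ M, a ≤ v r) :
    a ^ (Multiset.card M) ≤ v (((M.map (fun r => X - C r)).prod).coeff 0) := by
  induction M using Multiset.induction with
  | empty => simp
  | cons r M ih =>
    rw [Multiset.map_cons, Multiset.prod_cons, Multiset.card_cons, mul_coeff_zero, map_mul, pow_succ, mul_comm]
    refine mul_le_mul' ?_ (ih fun r hr => h r (by simp [hr]))
    simp only [coeff_sub, coeff_X_zero, coeff_C_zero, zero_sub, Valuation.map_neg]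
    exact h r (by simp)

/-- Step 7: the approximate idempotent polynomial. -/
lemma approx {A : Type*} [CommRing A] (κ : A →+* Ω) (P : A[X]) (hP : P.Monic)
    (hs : (P.map κ).Splits) (near : Ω → Prop)
    {a b : Γ} (ha1 : a ≤ 1) (D : ℕ) (hD : P.natDegree ≤ D) (hab : b < a ^ D)
    (h1 : ∀ r ∈ (P.map κ).roots, v r ≤ 1)
    (hn : ∀ r ∈ (P.map κ).roots, near r → v r ≤ b)
    (hf : ∀ r ∈ (P.map κ).roots, ¬ near r → a ≤ v r) :
    ∃ h : A[X], a ^ D ≤ v (κ (h.coeff 0)) ∧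
      (∀ r ∈ (P.map κ).roots, near r → v ((h.map κ).eval r - κ (h.coeff 0)) ≤ b) ∧
      (∀ r ∈ (P.map κ).roots, ¬ near r → v ((h.map κ).eval r) ≤ b) := by
  classical
  set M := (P.map κ).roots
  set Mn := M.filter near
  set Mf := M.filter (fun r => ¬ near r)
  have hM : Mn + Mf = M := Multiset.filter_add_not _ _
  have hb1 : b ≤ 1 := hab.le.trans (pow_le_one' ha1 _)
  have hPe : P.map κ = (Mf.map (fun r => X - C r)).prod * (Mn.map (fun r => X - C r)).prod := by
    conv_lhs => rw [hs.eq_prod_roots_of_monic (hP.map κ)]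
    change (M.map _).prod = _
    rw [← hM, Multiset.map_add, Multiset.prod_add, mul_comm]
  have hcard : Multiset.card M ≤ D := by
    refine le_trans ?_ hD
    refine (card_roots' _).trans ?_
    exact natDegree_map_le
  have hcf : Multiset.card Mf ≤ D := (Multiset.card_le_card (Multiset.filter_le _ _)).trans hcard
  have hMf1 : ∀ r ∈ Mf, v r ≤ 1 := fun r hr => h1 r (Multiset.mem_filter.1 hr).1
  set s := Multiset.card Mn
  set Hf := (Mf.map (fun r => X - C r)).prod
  let h : A[X] := ∑ k ∈ Finset.range (P.natDegree + 1), C (P.coeff (k + s)) * X ^ k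
  have hc : ∀ k, h.coeff k = P.coeff (k + s) := by
    intro k
    simp only [h, finsetSum_coeff, coeff_C_mul, coeff_X_pow]
    simp only [mul_ite, mul_one, mul_zero, Finset.sum_ite_eq, Finset.mem_range]
    split_ifs with hk
    · rfl
    · exact (coeff_eq_zero_of_natDegree_lt (by omega)).symm
  have hdiff : ∀ k, v ((h.map κ - Hf).coeff k) ≤ b := by
    intro k
    have := split_coeff v Mf Mn hb1 hMf1 (fun r hr => hn r (Multiset.mem_filter.1 hr).1 (Multiset.mem_filter.1 hr).2) k
    rw [← hPe] at this
    rw [coeff_sub, coeff_map, hc, ← coeff_map]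
    exact this
  have h0 : a ^ D ≤ v (Hf.coeff 0) :=
    (pow_le_pow_right_of_le_one' ha1 hcf).trans (prod_ge v Mf fun r hr => hf r (Multiset.mem_filter.1 hr).1 (Multiset.mem_filter.1 hr).2)
  refine ⟨h, ?_, ?_, ?_⟩
  · have h2 := hdiff 0
    rw [coeff_sub, coeff_map] at h2
    have h3 : v (κ (h.coeff 0)) = v (Hf.coeff 0) := by
      rw [show κ (h.coeff 0) = Hf.coeff 0 + (κ (h.coeff 0) - Hf.coeff 0) by ring]
      exact Valuation.map_add_eq_of_lt_left _ (h2.trans_lt (hab.trans_le h0))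
    rw [h3]; exact h0
  · intro r hr hnr
    have hrb := hn r hr hnr
    have : (h.map κ).eval r - κ (h.coeff 0) = r * ((h.map κ).divX.eval r) := by
      conv_lhs => rw [← divX_mul_X_add (h.map κ)]
      simp [mul_comm]
    rw [this, map_mul]
    refine mul_le_of_le_of_le_one hrb (eval_le v ?_ (h1 r hr))
    intro k
    rw [coeff_divX, coeff_map, hc, ← coeff_map, hPe, ← one_mul (1 : Γ)]
    apply coeff_mul_le v (prod_coeff_le v _ hMf1) (prod_coeff_le v _ _)
    exact fun r hr => h1 r (Multiset.mem_filter.1 hr).1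
  · intro r hr hnr
    have hz : Hf.eval r = 0 := by
      have hrM : r ∈ Mf := Multiset.mem_filter.2 ⟨hr, hnr⟩
      change eval r (Mf.map (fun r => X - C r)).prod = 0
      rw [eval_multiset_prod, Multiset.map_map]
      apply Multiset.prod_eq_zero
      rw [Multiset.mem_map]
      exact ⟨r, hrM, by simp⟩
    have : (h.map κ).eval r = (h.map κ - Hf).eval r := by rw [eval_sub, hz, sub_zero]
    rw [this]
    exact eval_le v hdiff (h1 r hr)

end ValPoly
end PartP4b

section PartP4c
open IsLocalRing
set_option linter.unusedSectionVars false

open Polynomial in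
/-- LiouvilleProp property of a local ring. -/
def LiouvilleProp (A : Type*) [CommRing A] [IsLocalRing A] : Prop :=
  ∀ P : A[X], P.Monic → 1 ≤ P.natDegree → (∀ a, P.eval a ≠ 0) →
    (∃ (U W : A[X]) (d : A), d ≠ 0 ∧ U * P + W * derivative P = C d) →
    ∃ N : ℕ, ∀ (y f : A) (n : ℕ), f ∉ maximalIdeal A ^ (n+1) →
      (P.scaleRoots f).eval y ∉ maximalIdeal A ^ (N * (n+1))

open Polynomial in
lemma hsep_of_sep {A K : Type*} [CommRing A] [IsDomain A] [Field K] [Algebra A K] [IsFractionRing A K]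
    (P : A[X]) (h : (P.map (algebraMap A K)).Separable) :
    ∃ (U W : A[X]) (d : A), d ≠ 0 ∧ U * P + W * derivative P = C d := by
  obtain ⟨a, b, hab⟩ := h
  have key : ∀ p : Polynomial K, ∃ (q : A[X]) (d : A), d ≠ 0 ∧ q.map (algebraMap A K) = C (algebraMap A K d) * p := by
    intro p
    obtain ⟨d, hd', hd⟩ := IsLocalization.integerNormalization_spec (nonZeroDivisors A) p
    refine ⟨_, d, nonZeroDivisors.ne_zero hd', hd.trans ?_⟩
    rw [← smul_eq_C_mul, algebraMap_smul]
  obtain ⟨U, d, hd, hU⟩ := key a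
  obtain ⟨W, e, he, hW⟩ := key b
  refine ⟨C e * U, C d * W, d * e, mul_ne_zero hd he, ?_⟩
  apply Polynomial.map_injective (algebraMap A K) (IsFractionRing.injective A K)
  simp only [Polynomial.map_add, Polynomial.map_mul, map_C, hU, hW, ← derivative_map, map_mul]
  rw [derivative_map] at *
  linear_combination (C (algebraMap A K d) * C (algebraMap A K e)) * hab

namespace SepIzumi
open Polynomial
variable {A K L Ω Γ : Type*} [CommRing A] [IsDomain A] [IsLocalRing A] [IsNoetherianRing A]
  [IsIntegrallyClosed A] [Field K] [Algebra A K] [IsFractionRing A K] [Field L] [Algebra K L] [Algebra A L]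
  [IsScalarTower A K L] [FiniteDimensional K L] [Algebra.IsSeparable K L]
  [Field Ω] [Algebra A Ω] [Algebra K Ω] [IsScalarTower A K Ω] [IsAlgClosed Ω]
  [LinearOrderedCommGroupWithZero Γ] {v : Valuation Ω Γ} {g : Γ}

/-- `v` restricts to the order function on `A`. -/
structure OrdV (A : Type*) {Ω Γ : Type*} [CommRing A] [IsLocalRing A] [Field Ω] [Algebra A Ω]
    [LinearOrderedCommGroupWithZero Γ] (v : Valuation Ω Γ) (g : Γ) : Prop where
  iff : ∀ (f : A) (n : ℕ), f ∈ maximalIdeal A ^ n ↔ v (algebraMap A Ω f) ≤ g ^ n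
  pos : 0 < g
  lt_one : g < 1

lemma int_le (hv : OrdV A v g) {z : Ω} (hz : IsIntegral A z) : v z ≤ 1 := by
  rw [← Valuation.mem_valuationSubring_iff]
  apply ThmT.mem_of_integral (O := A) v.valuationSubring _ hz
  intro a
  rw [Valuation.mem_valuationSubring_iff]
  have := (hv.iff a 0).1 (by simp)
  simpa using this

lemma lip (hv : OrdV A v g) (p : A[X]) {a b : Ω} (ha : v a ≤ 1) (hb : v b ≤ 1) :
    v (p.aeval a - p.aeval b) ≤ v (a - b) := by
  let V := v.valuationSubring
  let κ : A →+* V := (algebraMap A Ω).codRestrict V.toSubring (fun a => int_le hv (isIntegral_algebraMap (x := a)))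
  obtain ⟨c, hc⟩ := sub_dvd_eval_sub (⟨a, ha⟩ : V) ⟨b, hb⟩ (p.map κ)
  have key : ∀ (x : Ω) (hx : v x ≤ 1), ((((p.map κ).eval (⟨x, hx⟩ : V)) : V) : Ω) = p.aeval x := by
    intro x hx
    rw [eval_map, aeval_def]
    have := hom_eval₂ p κ V.subtype ⟨x, hx⟩
    exact this
  have h2 := congrArg (Subtype.val) hc
  have h3 : p.aeval a - p.aeval b = (a - b) * c := by
    rw [← key a ha, ← key b hb]
    exact h2
  rw [h3, map_mul]
  exact mul_le_of_le_of_le_one le_rfl c.2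

lemma trace_mem (z : L) (hz : IsIntegral A z) : ∃ a : A, algebraMap A K a = Algebra.trace K L z := by
  exact IsIntegrallyClosed.isIntegral_iff.1 (Algebra.isIntegral_trace hz)

open scoped Classical in
lemma claimG (hL : LiouvilleProp A) (hv : OrdV A v g) {ι : Type*} [Fintype ι] (b : Module.Basis ι K L)
    (hb : ∀ j, IsIntegral A (b j)) (G : Finset (L →ₐ[K] Ω)) (h1 : ∃ τ, τ ∈ G) (h2 : ∃ τ, τ ∉ G) :
    ∃ N : ℕ, ∀ (y : L) (f : A) (n : ℕ), IsIntegral A y → f ∉ maximalIdeal A ^ (n+1) →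
      ¬ ∀ τ : L →ₐ[K] Ω, v (τ y - if τ ∈ G then algebraMap A Ω f else 0) ≤ g ^ (N * (n+1)) := by
  let ε : ι → Ω := fun j => ∑ τ ∈ G, τ (b j)
  have hτint : ∀ (τ : L →ₐ[K] Ω) (z : L), IsIntegral A z → IsIntegral A (τ z) := by
    intro τ z hz
    exact hz.map (τ.restrictScalars A)
  have hεint : ∀ j, IsIntegral A (ε j) := fun j => IsIntegral.sum _ fun τ _ => hτint τ _ (hb j)
  obtain ⟨j, hj⟩ : ∃ j, ∀ z : K, algebraMap K Ω z ≠ ε j := by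
    by_contra! hc
    choose e he using hc
    let bd := (Algebra.traceForm K L).dualBasis (traceForm_nondegenerate K L) b
    let E : L := ∑ j, e j • bd j
    have hE : ∀ j, Algebra.trace K L (E * b j) = e j := by
      intro j
      have := LinearMap.BilinForm.dualBasis_repr_apply (traceForm_nondegenerate K L) b E j
      rw [Algebra.traceForm_apply] at this
      rw [← this]
      change bd.repr E j = _
      simp only [E, map_sum, map_smul, Module.Basis.repr_self]
      simp [Finsupp.single_apply]
    have hlin : (∑ τ : L →ₐ[K] Ω, (τ E - if τ ∈ G then 1 else 0) • τ.toLinearMap) = 0 := by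
      apply b.ext
      intro j
      simp only [LinearMap.sum_apply, LinearMap.smul_apply, smul_eq_mul, AlgHom.toLinearMap_apply, sub_mul,
        LinearMap.zero_apply, Finset.sum_sub_distrib, ite_mul, one_mul, zero_mul, ← map_mul]
      rw [← trace_eq_sum_embeddings (K := K) (L := L) Ω, hE, he]
      simp [ε]
    have hind := Fintype.linearIndependent_iff.1 (linearIndependent_toLinearMap K L Ω) _ hlin
    obtain ⟨τ1, hτ1⟩ := h1
    obtain ⟨τ2, hτ2⟩ := h2
    have e1 := hind τ1
    have e2 := hind τ2
    simp only [hτ1, hτ2, if_true, if_false, sub_zero] at e1 e2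
    have : E = 0 := by simpa using e2
    rw [this, map_zero, zero_sub, neg_eq_zero] at e1
    exact one_ne_zero e1
  set P := minpoly A (ε j)
  have hPm : P.Monic := minpoly.monic (hεint j)
  have hPK : minpoly K (ε j) = P.map (algebraMap A K) := minpoly.isIntegrallyClosed_eq_field_fractions' K (hεint j)
  have hsepε : IsSeparable K (ε j) := by
    have : ε j ∈ separableClosure K Ω := by
      refine sum_mem fun τ _ => ?_
      rw [mem_separableClosure_iff]
      have := Algebra.IsSeparable.isSeparable K (b j)
      unfold IsSeparable at *
      rwa [minpoly.algHom_eq τ τ.injective]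
    exact mem_separableClosure_iff.1 this
  obtain ⟨N, hN⟩ := hL P hPm (minpoly.natDegree_pos (hεint j)) (by
      intro a ha
      have hirr := minpoly.irreducible (A := K) (x := ε j) ((hεint j).tower_top)
      have hroot : (minpoly K (ε j)).IsRoot (algebraMap A K a) := by
        rw [hPK, IsRoot.def, eval_map_algebraMap, aeval_algebraMap_apply, coe_aeval_eq_eval, ha, map_zero]
      have hdeg := degree_eq_one_of_irreducible_of_root hirr hroot
      have := minpoly.mem_range_of_degree_eq_one K (ε j) hdeg
      obtain ⟨z, hz⟩ := this
      exact hj z hz)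
    (hsep_of_sep (K := K) P (by rw [← hPK]; exact hsepε))
  refine ⟨N, fun y f n hy hf hall => ?_⟩
  obtain ⟨yj, hyj⟩ := trace_mem (K := K) (y * b j) (hy.mul (hb j))
  apply hN yj f n hf
  rw [hv.iff]
  have hclose : v (algebraMap A Ω yj - algebraMap A Ω f * ε j) ≤ g ^ (N * (n+1)) := by
    have : algebraMap A Ω yj - algebraMap A Ω f * ε j =
        ∑ τ : L →ₐ[K] Ω, (τ y - if τ ∈ G then algebraMap A Ω f else 0) * τ (b j) := by
      rw [IsScalarTower.algebraMap_apply A K Ω yj, hyj, trace_eq_sum_embeddings (K := K) (L := L) Ω]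
      simp only [sub_mul, Finset.sum_sub_distrib, ite_mul, zero_mul, ← map_mul]
      congr 1
      simp [ε, Finset.mul_sum]
    rw [this]
    apply Valuation.map_sum_le
    intro τ _
    rw [map_mul]
    exact mul_le_of_le_of_le_one (hall τ) (int_le hv (hτint τ _ (hb j)))
  have hroot : (P.scaleRoots f).aeval (algebraMap A Ω f * ε j) = 0 :=
    scaleRoots_aeval_eq_zero (minpoly.aeval A (ε j))
  have he1 : v (algebraMap A Ω f * ε j) ≤ 1 := int_le hv (isIntegral_algebraMap.mul (hεint j))
  have := lip hv (P.scaleRoots f) (int_le hv (isIntegral_algebraMap (x := yj))) he1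
  rw [hroot, sub_zero, aeval_algebraMap_apply, coe_aeval_eq_eval] at this
  exact this.trans hclose

end SepIzumi
end PartP4c

section PartP4d
open IsLocalRing
set_option linter.unusedSectionVars false

/-- linear Izumi-Rees type property for an ideal. -/
def IzumiProp {S : Type*} [CommRing S] (I : Ideal S) : Prop :=
  ∃ c e : ℕ, ∀ (n : ℕ) (x y : S), x * y ∈ I ^ (c * n + e) → x ∈ I ^ n ∨ y ∈ I ^ n

/-- Artin-Rees cancellation. -/
lemma ar_cancel {S : Type*} [CommRing S] [IsDomain S] [IsNoetherianRing S] (I : Ideal S) (δ : S) (hδ : δ ≠ 0) :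
    ∃ c, ∀ n z, δ * z ∈ I ^ (n + c) → z ∈ I ^ n := by
  obtain ⟨k, hk⟩ := Ideal.exists_pow_inf_eq_pow_smul I (Ideal.span {δ} : Ideal S)
  refine ⟨k, fun n z hz => ?_⟩
  have h1 : δ * z ∈ (I ^ (n + k) • ⊤ ⊓ Ideal.span {δ} : Submodule S S) :=
    ⟨by simpa using hz, Ideal.mul_mem_right _ _ (Ideal.mem_span_singleton_self δ)⟩
  rw [hk (n + k) (by omega), Nat.add_sub_cancel] at h1
  have h2 : δ * z ∈ I ^ n • (Ideal.span {δ} : Ideal S) :=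
    Submodule.smul_mono le_rfl inf_le_right h1
  rw [smul_eq_mul, mul_comm, Ideal.mem_span_singleton_mul] at h2
  obtain ⟨w, hw, hw2⟩ := h2
  rwa [← mul_left_cancel₀ hδ hw2]

namespace SepIzumi
open Polynomial
variable {A K L Ω Γ : Type*} [CommRing A] [IsDomain A] [IsLocalRing A] [IsNoetherianRing A]
  [IsIntegrallyClosed A] [Field K] [Algebra A K] [IsFractionRing A K] [Field L] [Algebra K L] [Algebra A L]
  [IsScalarTower A K L] [FiniteDimensional K L] [Algebra.IsSeparable K L]
  [Field Ω] [Algebra A Ω] [Algebra K Ω] [IsScalarTower A K Ω] [IsAlgClosed Ω]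
  [LinearOrderedCommGroupWithZero Γ] {v : Valuation Ω Γ} {g : Γ}

lemma exists_basis (S : Subalgebra A L) (hS : ∀ z : L, ∃ a : A, a ≠ 0 ∧ a • z ∈ S) :
    ∃ (ι : Type) (_ : Fintype ι) (b : Module.Basis ι K L), ∀ j, b j ∈ S := by
  let b0 := Module.finBasis K L
  choose a ha haS using fun j => hS (b0 j)
  have hu : ∀ j, IsUnit (algebraMap A K (a j)) := fun j => by
    rw [isUnit_iff_ne_zero, Ne, map_eq_zero_iff _ (IsFractionRing.injective A K)]; exact ha j
  refine ⟨_, inferInstance, b0.isUnitSMul hu, fun j => ?_⟩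
  rw [Module.Basis.isUnitSMul_apply, algebraMap_smul]
  exact haS j

lemma common_den (S : Subalgebra A L) (hS : ∀ z : L, ∃ a : A, a ≠ 0 ∧ a • z ∈ S) {ι : Type} [Fintype ι] (z : ι → L) :
    ∃ a : A, a ≠ 0 ∧ ∀ j, a • z j ∈ S := by
  classical
  choose a ha haS using fun j => hS (z j)
  refine ⟨∏ j, a j, Finset.prod_ne_zero_iff.2 fun j _ => ha j, fun j => ?_⟩
  rw [← Finset.prod_erase_mul _ _ (Finset.mem_univ j), mul_smul]
  exact S.smul_mem (haS j) _

lemma val_of_mem (hv : OrdV A v g) (S : Subalgebra A L) [Module.Finite A S] (n : ℕ) (x : S)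
    (hx : x ∈ ((maximalIdeal A).map (algebraMap A S)) ^ n) (τ : L →ₐ[K] Ω) : v (τ x) ≤ g ^ n := by
  rw [← Ideal.map_pow, Ideal.map] at hx
  refine Submodule.span_induction (p := fun (x : S) _ => v (τ x) ≤ g ^ n) ?_ ?_ ?_ ?_ hx
  · rintro _ ⟨a, ha, rfl⟩
    have : τ ((algebraMap A S a : S) : L) = algebraMap A Ω a := by
      change τ (algebraMap A L a) = _
      rw [IsScalarTower.algebraMap_apply A K L, τ.commutes, ← IsScalarTower.algebraMap_apply A K Ω]
    rw [this]
    exact (hv.iff a n).1 ha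
  · simp
  · intro x y _ _ hx hy
    rw [S.coe_add, map_add]
    exact (v.map_add _ _).trans (max_le hx hy)
  · intro a x _ hx
    rw [smul_eq_mul, S.coe_mul, map_mul, map_mul]
    refine mul_le_of_le_one_of_le ?_ hx
    apply int_le hv
    have : IsIntegral A (a : L) := (IsIntegral.of_finite A a).map S.val
    exact this.map (τ.restrictScalars A)

lemma mem_of_val (hv : OrdV A v g) (S : Subalgebra A L) [Module.Finite A S]
    (hS : ∀ z : L, ∃ a : A, a ≠ 0 ∧ a • z ∈ S) :
    ∃ c0, ∀ n (x : S), (∀ τ : L →ₐ[K] Ω, v (τ x) ≤ g ^ (n + c0)) →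
      x ∈ ((maximalIdeal A).map (algebraMap A S)) ^ n := by
  classical
  have : IsNoetherianRing S := IsNoetherianRing.of_finite A S
  have hintg : ∀ x : S, IsIntegral A (x : L) := fun x => (IsIntegral.of_finite A x).map S.val
  obtain ⟨ι, _, b, hb⟩ := exists_basis (K := K) S hS
  let bd := (Algebra.traceForm K L).dualBasis (traceForm_nondegenerate K L) b
  obtain ⟨δ, hδ, hδS⟩ := common_den S hS (fun j => bd j)
  have hinj : Function.Injective (algebraMap A L) := by
    rw [IsScalarTower.algebraMap_eq A K L]
    exact (algebraMap K L).injective.comp (IsFractionRing.injective A K)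
  obtain ⟨c, hc⟩ := ar_cancel ((maximalIdeal A).map (algebraMap A S)) (algebraMap A S δ) (by
    intro h
    apply hδ
    apply hinj
    rw [map_zero]
    exact congrArg Subtype.val h)
  refine ⟨c, fun n x hx => hc n x ?_⟩
  choose a ha using fun j => trace_mem (K := K) ((x : L) * b j) ((hintg x).mul (hintg ⟨_, hb j⟩))
  have e : algebraMap A S δ * x = ∑ j, algebraMap A S (a j) * ⟨δ • bd j, hδS j⟩ := by
    apply Subtype.ext
    rw [S.coe_mul]
    have h1 : (x : L) = ∑ j, algebraMap A K (a j) • bd j := by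
      conv_lhs => rw [← bd.sum_repr (x : L)]
      refine Finset.sum_congr rfl fun j _ => ?_
      rw [LinearMap.BilinForm.dualBasis_repr_apply, Algebra.traceForm_apply, ha]
    rw [h1, Finset.mul_sum, AddSubmonoidClass.coe_finsetSum]
    refine Finset.sum_congr rfl fun j _ => ?_
    rw [S.coe_mul]
    simp only [Subalgebra.coe_algebraMap, Algebra.smul_def, ← IsScalarTower.algebraMap_apply A K L]
    ring
  rw [e]
  refine sum_mem fun j _ => Ideal.mul_mem_right _ _ ?_
  rw [← Ideal.map_pow]
  apply Ideal.mem_map_of_mem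
  rw [hv.iff, IsScalarTower.algebraMap_apply A K Ω, ha, trace_eq_sum_embeddings (K := K) (L := L) Ω]
  apply Valuation.map_sum_le
  intro τ _
  rw [map_mul, map_mul]
  refine mul_le_of_le_of_le_one (hx τ) (int_le hv ?_)
  exact (hintg ⟨_, hb j⟩).map (τ.restrictScalars A)

lemma window {E : Type*} [Fintype E] (g1 : g < 1) (f : E → Γ) (w0 C : ℕ) (hC : 1 ≤ C) :
    ∃ w, w0 ≤ w ∧ w ≤ w0 * C ^ (Fintype.card E) ∧ ∀ τ, g ^ w ≤ f τ ∨ f τ ≤ g ^ (C * w) := by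
  by_contra! hc
  have h1 : ∀ k : Fin (Fintype.card E + 1), ∃ τ, f τ < g ^ (w0 * C ^ (k : ℕ)) ∧ g ^ (w0 * C ^ ((k : ℕ) + 1)) < f τ := by
    intro k
    have := hc (w0 * C ^ (k : ℕ)) (Nat.le_mul_of_pos_right _ (pow_pos hC _))
      (Nat.mul_le_mul_left _ (Nat.pow_le_pow_right hC (by omega)))
    obtain ⟨τ, h2, h3⟩ := this
    refine ⟨τ, h2, ?_⟩
    rwa [show w0 * C ^ ((k : ℕ) + 1) = C * (w0 * C ^ (k : ℕ)) by ring]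
  choose τ h2 h3 using h1
  have key : ∀ k k' : Fin (Fintype.card E + 1), k < k' → τ k ≠ τ k' := by
    intro k k' hlt he
    have h4 := h3 k
    have h5 := h2 k'
    rw [he] at h4
    have : g ^ (w0 * C ^ (k' : ℕ)) ≤ g ^ (w0 * C ^ ((k : ℕ) + 1)) :=
      pow_le_pow_right_of_le_one' g1.le (Nat.mul_le_mul_left _ (Nat.pow_le_pow_right hC hlt))
    exact lt_irrefl _ (h4.trans (h5.trans_le this))
  have hinj : Function.Injective τ := by
    intro k k' he
    by_contra hne
    rcases lt_or_gt_of_ne hne with h | h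
    · exact key _ _ h he
    · exact key _ _ h he.symm
  have := Fintype.card_le_of_injective τ hinj
  simp at this

end SepIzumi

open scoped Classical in
open Polynomial SepIzumi in
theorem SepIzumi.main {A L Ω Γ : Type*} (K : Type*) [CommRing A] [IsDomain A] [IsLocalRing A] [IsNoetherianRing A]
    [IsIntegrallyClosed A] [Field K] [Algebra A K] [IsFractionRing A K] [Field L] [Algebra K L] [Algebra A L]
    [IsScalarTower A K L] [FiniteDimensional K L] [Algebra.IsSeparable K L]
    [Field Ω] [Algebra A Ω] [Algebra K Ω] [IsScalarTower A K Ω] [IsAlgClosed Ω]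
    [LinearOrderedCommGroupWithZero Γ] {v : Valuation Ω Γ} {g : Γ} (hL : LiouvilleProp A) (hv : OrdV A v g) (S : Subalgebra A L) [Module.Finite A S]
    (hS : ∀ z : L, ∃ a : A, a ≠ 0 ∧ a • z ∈ S) :
    IzumiProp ((maximalIdeal A).map (algebraMap A S)) := by
  obtain ⟨ι, _, b, hb⟩ := exists_basis (K := K) S hS
  have hintg : ∀ x : S, IsIntegral A (x : L) := fun x => (IsIntegral.of_finite A x).map S.val
  have hanti : ∀ {m n : ℕ}, n ≤ m → g ^ m ≤ g ^ n := fun h => pow_le_pow_right_of_le_one' hv.lt_one.le h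
  have hG : ∃ N : ℕ, ∀ (G : Finset (L →ₐ[K] Ω)), (∃ τ, τ ∈ G) → (∃ τ, τ ∉ G) →
    ∀ (y : L) (f : A) (n : ℕ), IsIntegral A y → f ∉ maximalIdeal A ^ (n+1) →
      ¬ ∀ τ : L →ₐ[K] Ω, v (τ y - if τ ∈ G then algebraMap A Ω f else 0) ≤ g ^ (N * (n+1)) := by
    have : ∀ G : Finset (L →ₐ[K] Ω), ∃ N : ℕ, (∃ τ, τ ∈ G) → (∃ τ, τ ∉ G) →
      ∀ (y : L) (f : A) (n : ℕ), IsIntegral A y → f ∉ maximalIdeal A ^ (n+1) →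
      ¬ ∀ τ : L →ₐ[K] Ω, v (τ y - if τ ∈ G then algebraMap A Ω f else 0) ≤ g ^ (N * (n+1)) := by
      intro G
      by_cases h : (∃ τ, τ ∈ G) ∧ (∃ τ, τ ∉ G)
      · obtain ⟨N, hN⟩ := claimG hL hv b (fun j => hintg ⟨_, hb j⟩) G h.1 h.2
        exact ⟨N, fun _ _ => hN⟩
      · exact ⟨0, fun h1 h2 => absurd ⟨h1, h2⟩ h⟩
    choose N hN using this
    refine ⟨∑ G, N G, fun G h1 h2 y f n hy hf hall => hN G h1 h2 y f n hy hf fun τ => (hall τ).trans (hanti ?_)⟩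
    exact Nat.mul_le_mul_right _ (Finset.single_le_sum (f := N) (fun _ _ => Nat.zero_le _) (Finset.mem_univ G))
  obtain ⟨N, hN⟩ := hG
  obtain ⟨c0, hc0⟩ := mem_of_val (K := K) hv S hS
  set D := Fintype.card (L →ₐ[K] Ω) with hDdef
  set C := N * (D + 1) + D + 1 with hCdef
  refine ⟨1 + C ^ (D+1), c0 + C ^ (D+1) * (c0 + 1), fun n x y hxy => ?_⟩
  by_contra! hcon
  obtain ⟨τ1, hτ1⟩ : ∃ τ : L →ₐ[K] Ω, g ^ (n + c0) < v (τ x) := by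
    by_contra! hh; exact hcon.1 (hc0 n x hh)
  obtain ⟨τ2, hτ2⟩ : ∃ τ : L →ₐ[K] Ω, g ^ (n + c0) < v (τ y) := by
    by_contra! hh; exact hcon.2 (hc0 n y hh)
  have hval := val_of_mem hv S _ _ hxy τ2
  rw [S.coe_mul, map_mul, map_mul] at hval
  have hτ2x : v (τ2 x) ≤ g ^ (C ^ (D+1) * (n + c0 + 1)) := by
    by_contra! hh
    have h1 : g ^ (C ^ (D+1) * (n + c0 + 1)) * g ^ (n + c0) < v (τ2 x) * v (τ2 y) :=
      mul_lt_mul'' hh hτ2 zero_le zero_le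
    rw [← pow_add] at h1
    refine absurd (h1.trans_le hval) (not_lt.2 (le_of_eq ?_))
    congr 1
    ring
  obtain ⟨w, hw1, hw2, hw3⟩ := window hv.lt_one (fun τ : L →ₐ[K] Ω => v (τ x)) (n + c0 + 1) C (by omega)
  have hwpos : 1 ≤ w := by omega
  have hPK : minpoly K (x : L) = (minpoly A (x : L)).map (algebraMap A K) :=
    minpoly.isIntegrallyClosed_eq_field_fractions' K (hintg x)
  have hroots : ∀ r, r ∈ ((minpoly A (x : L)).map (algebraMap A Ω)).roots ↔ ∃ τ : L →ₐ[K] Ω, τ x = r := by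
    intro r
    have h1 := Algebra.IsAlgebraic.range_eval_eq_rootSet_minpoly (F := K) (K := L) Ω (x : L)
    have h2 : r ∈ (minpoly K (x : L)).rootSet Ω ↔ r ∈ ((minpoly A (x : L)).map (algebraMap A Ω)).roots := by
      rw [mem_rootSet', hPK, mem_roots', Polynomial.map_map, ← IsScalarTower.algebraMap_eq A K Ω, IsRoot.def,
        aeval_map_algebraMap, eval_map_algebraMap]
    rw [← h2, ← h1]
    rfl
  obtain ⟨h, hh1, hh2, hh3⟩ := ValPoly.approx v (algebraMap A Ω) (minpoly A (x : L)) (minpoly.monic (hintg x))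
    (IsAlgClosed.splits _) (fun r => v r ≤ g ^ (C * w)) (a := g ^ w) (b := g ^ (C * w)) (pow_le_one' hv.lt_one.le _) D (by
      rw [hDdef, AlgHom.card]
      have : (minpoly K (x : L)).natDegree ≤ Module.finrank K L := minpoly.natDegree_le (x : L)
      rwa [hPK, (minpoly.monic (hintg x)).natDegree_map] at this) (by
      rw [← pow_mul]
      apply pow_lt_pow_right_of_lt_one₀ hv.pos hv.lt_one
      rw [mul_comm]
      exact Nat.mul_lt_mul_of_pos_right (by omega) hwpos)
    (by
      intro r hr
      obtain ⟨τ, rfl⟩ := (hroots r).1 hr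
      exact int_le hv ((hintg x).map (τ.restrictScalars A)))
    (fun r _ h => h)
    (by
      intro r hr hnr
      obtain ⟨τ, rfl⟩ := (hroots r).1 hr
      exact (hw3 τ).resolve_right hnr)
  have hev : ∀ τ : L →ₐ[K] Ω, (h.map (algebraMap A Ω)).eval (τ x) = τ ((aeval x h : S) : L) := by
    intro τ
    rw [eval_map_algebraMap]
    have e1 : ((aeval x h : S) : L) = aeval (x : L) h := by
      exact (aeval_algHom_apply S.val x h).symm
    rw [e1]
    exact aeval_algHom_apply (τ.restrictScalars A) (x : L) h
  refine hN (Finset.univ.filter fun τ : L →ₐ[K] Ω => v (τ x) ≤ g ^ (C * w)) ⟨τ2, ?_⟩ ⟨τ1, ?_⟩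
    ((aeval x h : S) : L) (h.coeff 0) (w * D) (hintg _) ?_ ?_
  · rw [Finset.mem_filter]
    refine ⟨Finset.mem_univ _, hτ2x.trans (hanti ?_)⟩
    calc C * w ≤ C * ((n + c0 + 1) * C ^ D) := Nat.mul_le_mul_left _ hw2
      _ = _ := by ring
  · rw [Finset.mem_filter, not_and, not_le]
    intro _
    refine lt_of_le_of_lt (hanti ?_) hτ1
    have : 1 * w ≤ C * w := Nat.mul_le_mul_right _ (by omega)
    omega
  · rw [hv.iff, not_le]
    rw [← pow_mul] at hh1
    exact lt_of_lt_of_le (pow_lt_pow_right_of_lt_one₀ hv.pos hv.lt_one (by omega)) hh1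
  · intro τ
    have hle : g ^ (C * w) ≤ g ^ (N * (w * D + 1)) := by
      apply hanti
      rw [hCdef]
      nlinarith [Nat.mul_le_mul_left N hwpos]
    refine le_trans ?_ hle
    rw [← hev τ]
    simp only [Finset.mem_filter, Finset.mem_univ, true_and]
    split_ifs with hn
    · exact hh2 _ ((hroots _).2 ⟨τ, rfl⟩) hn
    · rw [sub_zero]
      exact hh3 _ ((hroots _).2 ⟨τ, rfl⟩) hn
end PartP4d

section PartP4e
open IsLocalRing
set_option linter.unusedSectionVars false

/-- `q`-inverse-linear maps separate points -/
def QSep (A : Type*) [CommRing A] (q : ℕ) : Prop :=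
  ∀ a : A, a ≠ 0 → ∃ l : A →+ A, (∀ f b, l (f ^ q * b) = f * l b) ∧ l a ≠ 0

lemma QSep.one (A : Type*) [CommRing A] : QSep A 1 := fun a ha =>
  ⟨AddMonoidHom.id A, fun f b => by simp, ha⟩

lemma QSep.pow {A : Type*} [CommRing A] {p : ℕ} (h : QSep A p) (e : ℕ) : QSep A (p ^ e) := by
  induction e with
  | zero => rw [pow_zero]; exact QSep.one A
  | succ e ih =>
    intro a ha
    obtain ⟨l1, h1, h2⟩ := h a ha
    obtain ⟨l2, h3, h4⟩ := ih _ h2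
    refine ⟨l2.comp l1, fun f b => ?_, h4⟩
    simp only [AddMonoidHom.comp_apply]
    rw [pow_succ, pow_mul, h1, h3]

lemma qpow_bound {A : Type*} [CommRing A] [IsNoetherianRing A] (m : Ideal A) (q : ℕ) (hq : q ≠ 0) :
    ∃ κ, ∀ n (l : A →+ A), (∀ f b, l (f ^ q * b) = f * l b) → ∀ a ∈ m ^ (κ * n), l a ∈ m ^ n := by
  let J : Ideal A := Ideal.span ((fun x => x ^ q) '' (m : Set A))
  have hJ : m ≤ J.radical := by
    intro x hx
    exact ⟨q, Ideal.subset_span ⟨x, hx, rfl⟩⟩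
  obtain ⟨κ, hκ⟩ := Ideal.exists_pow_le_of_le_radical_of_fg hJ (IsNoetherian.noetherian m)
  refine ⟨κ, fun n l hl a ha => ?_⟩
  have h1 : a ∈ J ^ n := by
    rw [pow_mul] at ha
    exact Ideal.pow_right_mono hκ n ha
  have h2 : ∀ n, J ^ n ≤ Ideal.span ((fun x => x ^ q) '' ((m ^ n : Ideal A) : Set A)) := by
    intro n
    induction n with
    | zero =>
      rw [pow_zero, pow_zero, Ideal.one_eq_top, top_le_iff, Ideal.eq_top_iff_one]
      exact Ideal.subset_span ⟨1, trivial, one_pow q⟩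
    | succ n ih =>
      rw [pow_succ]
      refine (Ideal.mul_mono_left ih).trans ?_
      rw [Ideal.span_mul_span']
      refine Ideal.span_mono ?_
      rintro _ ⟨_, ⟨x, hx, rfl⟩, _, ⟨y, hy, rfl⟩, rfl⟩
      refine ⟨x * y, ?_, mul_pow x y q⟩
      rw [pow_succ]
      exact Ideal.mul_mem_mul hx hy
  have h3 := h2 n h1
  refine Submodule.span_induction (p := fun a _ => ∀ b, l (b * a) ∈ m ^ n) ?_ ?_ ?_ ?_ h3 1 |> fun h => by simpa using h
  · rintro _ ⟨x, hx, rfl⟩ b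
    simp only
    rw [mul_comm, hl]
    exact Ideal.mul_mem_right _ _ hx
  · intro b; simp
  · intro x y _ _ hx hy b
    rw [mul_add, map_add]; exact add_mem (hx b) (hy b)
  · intro c x _ hx b
    rw [smul_eq_mul, ← mul_assoc]; exact hx _

/-- Coordinates with bounded denominators. -/
lemma exists_coords {A : Type*} (K : Type*) {L : Type*} [CommRing A] [IsDomain A] [Field K] [Algebra A K] [IsFractionRing A K]
    [Field L] [Algebra K L] [Algebra A L] [IsScalarTower A K L] [FiniteDimensional K L]
    (S : Subalgebra A L) [Module.Finite A S] {ι : Type} [Fintype ι] (b : Module.Basis ι K L) :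
    ∃ (δ : A) (μ : ι → S →ₗ[A] A), δ ≠ 0 ∧ ∀ (x : S), δ • (x : L) = ∑ j, μ j x • b j := by
  obtain ⟨s, hs⟩ := Module.Finite.fg_top (R := A) (M := S)
  classical
  obtain ⟨δ, hδ⟩ := IsLocalization.exist_integer_multiples_of_finset (nonZeroDivisors A)
    ((s ×ˢ (Finset.univ : Finset ι)).image fun x => b.repr (x.1 : L) x.2)
  have hintg : ∀ (x : S) j, ∃ a : A, algebraMap A K a = (δ : A) • b.repr (x : L) j := by
    intro x j
    have hx : x ∈ Submodule.span A (s : Set S) := by rw [hs]; trivial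
    refine Submodule.span_induction (p := fun (x : S) _ => ∃ a : A, algebraMap A K a = (δ : A) • b.repr (x : L) j)
      ?_ ?_ ?_ ?_ hx
    · intro x hx
      exact hδ _ (Finset.mem_image.2 ⟨(x, j), Finset.mem_product.2 ⟨hx, Finset.mem_univ _⟩, rfl⟩)
    · exact ⟨0, by simp⟩
    · rintro x y _ _ ⟨a, ha⟩ ⟨c, hc⟩
      exact ⟨a + c, by rw [map_add, ha, hc, S.coe_add, map_add, Finsupp.add_apply, smul_add]⟩
    · rintro r x _ ⟨a, ha⟩
      refine ⟨r * a, ?_⟩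
      have : ((r • x : S) : L) = algebraMap A K r • (x : L) := by rw [algebraMap_smul]; rfl
      rw [this, map_smul, Finsupp.smul_apply, map_mul, ha, smul_eq_mul, mul_smul_comm]
  have hinj := IsFractionRing.injective A K
  choose f hf using hintg
  refine ⟨δ, fun j => { toFun := fun x => f x j, map_add' := ?_, map_smul' := ?_ }, nonZeroDivisors.ne_zero δ.2, ?_⟩
  · intro x y
    apply hinj
    rw [map_add, hf, hf, hf, S.coe_add, map_add, Finsupp.add_apply, smul_add]
  · intro r x
    apply hinj
    have : ((r • x : S) : L) = algebraMap A K r • (x : L) := by rw [algebraMap_smul]; rfl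
    rw [hf, this, map_smul, Finsupp.smul_apply, RingHom.id_apply, smul_eq_mul r, map_mul, hf, smul_eq_mul, mul_smul_comm]
  · intro x
    conv_lhs => rw [← b.sum_repr (x : L), Finset.smul_sum]
    refine Finset.sum_congr rfl fun j _ => ?_
    simp only [LinearMap.coe_mk, AddHom.coe_mk]
    rw [← algebraMap_smul K (f x j), hf, smul_assoc]

lemma exists_basis' {A : Type*} {K : Type*} {L : Type*} [CommRing A] [IsDomain A]
    [Field K] [Algebra A K] [IsFractionRing A K]
    [Field L] [Algebra K L] [Algebra A L] [IsScalarTower A K L] [FiniteDimensional K L]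
    (S : Subalgebra A L) (hS : ∀ z : L, ∃ a : A, a ≠ 0 ∧ a • z ∈ S) :
    ∃ (ι : Type) (_ : Fintype ι) (b : Module.Basis ι K L), ∀ j, b j ∈ S := by
  let b0 := Module.finBasis K L
  choose a ha haS using fun j => hS (b0 j)
  have hu : ∀ j, IsUnit (algebraMap A K (a j)) := fun j => by
    rw [isUnit_iff_ne_zero, Ne, map_eq_zero_iff _ (IsFractionRing.injective A K)]; exact ha j
  refine ⟨_, inferInstance, b0.isUnitSMul hu, fun j => ?_⟩
  rw [Module.Basis.isUnitSMul_apply, algebraMap_smul]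
  exact haS j

theorem insep_claim {A : Type*} (K : Type*) {L : Type*} [CommRing A] [IsDomain A] [IsLocalRing A] [IsNoetherianRing A]
    [Field K] [Algebra A K] [IsFractionRing A K]
    [Field L] [Algebra K L] [Algebra A L] [IsScalarTower A K L] [FiniteDimensional K L]
    (S : Subalgebra A L) [Module.Finite A S] (hS : ∀ z : L, ∃ a : A, a ≠ 0 ∧ a • z ∈ S)
    (p e : ℕ) [hp : ExpChar A p] (hq : QSep A (p ^ e)) :
    ∃ κ c, ∀ n (x : S), x ^ (p ^ e) ∈ ((maximalIdeal A).map (algebraMap A S)) ^ (κ * n + c) →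
      x ∈ ((maximalIdeal A).map (algebraMap A S)) ^ n := by
  classical
  have : IsNoetherianRing S := IsNoetherianRing.of_finite A S
  have hinjL : Function.Injective (algebraMap A L) := by
    rw [IsScalarTower.algebraMap_eq A K L]
    exact (algebraMap K L).injective.comp (IsFractionRing.injective A K)
  have hinjS : Function.Injective (algebraMap A S) := fun a b h => hinjL (congrArg Subtype.val h)
  have : ExpChar S p := expChar_of_injective_algebraMap hinjS p
  set q := p ^ e with hqdef
  have hq0 : q ≠ 0 := pow_ne_zero _ (expChar_pos A p).ne'
  set m := maximalIdeal A
  obtain ⟨ι, _, b, hb⟩ := exists_basis' (K := K) S hS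
  obtain ⟨δ, μ, hδ, hμ⟩ := exists_coords K S b
  obtain ⟨κ, hκ⟩ := qpow_bound m q hq0
  -- the functionals
  let F : Set (S →ₗ[A] A) := {ω | (∀ n (x : S), x ^ q ∈ (m.map (algebraMap A S)) ^ (κ * n) → ω x ∈ m ^ n)}
  let T : Set (S →ₗ[A] A) := {ω | ∃ (j : ι) (l : A →+ A), (∀ f b, l (f ^ q * b) = f * l b) ∧ ∀ x, ω x = l (μ j (x ^ q))}
  have hμmem : ∀ j n (x : S), x ∈ (m.map (algebraMap A S)) ^ n → μ j x ∈ m ^ n := by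
    intro j n x hx
    have h1 : x ∈ (m ^ n • ⊤ : Submodule A S) := by
      rw [Ideal.smul_top_eq_map, Ideal.map_pow]; exact hx
    have h2 := Submodule.mem_map_of_mem (f := μ j) h1
    rw [Submodule.map_smul''] at h2
    have := Submodule.smul_mono le_rfl (le_top (a := Submodule.map (μ j) ⊤)) h2
    simpa using this
  have hTF : ∀ ω ∈ T, ω ∈ F := by
    rintro ω ⟨j, l, hl, hω⟩ n x hx
    rw [hω]
    exact hκ n l hl _ (hμmem j _ _ hx)
  have hTsep : ∀ x : S, (∀ ω ∈ T, ω x = 0) → x = 0 := by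
    intro x hx
    have h0 : ∀ j, μ j (x ^ q) = 0 := by
      intro j
      by_contra hne
      obtain ⟨l, hl, hl0⟩ := hq _ hne
      apply hl0
      refine hx { toFun := fun x => l (μ j (x ^ q)), map_add' := ?_, map_smul' := ?_ } ⟨j, l, hl, fun _ => rfl⟩
      · intro x y
        rw [hqdef, add_pow_expChar_pow, map_add, map_add]
      · intro r x
        rw [Algebra.smul_def, mul_pow, ← map_pow, ← Algebra.smul_def, map_smul, smul_eq_mul, hl]
        rfl
    have h1 := hμ (x ^ q)
    simp only [h0, zero_smul, Finset.sum_const_zero] at h1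
    rw [Algebra.smul_def, mul_eq_zero, map_eq_zero_iff _ hinjL] at h1
    have h2 : (x ^ q : S) = 0 := Subtype.ext (h1.resolve_left hδ)
    exact pow_eq_zero_iff hq0 |>.1 h2
  -- span over K
  let z : ι → S := fun j => ⟨b j, hb j⟩
  let vec : (S →ₗ[A] A) → (ι → K) := fun ω j => algebraMap A K (ω (z j))
  have hspan : Submodule.span K (vec '' T) = ⊤ := by
    by_contra hne
    obtain ⟨ℓ, hℓ0, hℓ⟩ := Submodule.exists_le_ker_of_lt_top _ (lt_top_iff_ne_top.2 hne)
    obtain ⟨d, hd⟩ := IsLocalization.exist_integer_multiples_of_finset (nonZeroDivisors A)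
      (Finset.univ.image fun j : ι => ℓ (Pi.single j 1))
    have hd' : ∀ j, ∃ a : A, algebraMap A K a = (d : A) • ℓ (Pi.single j 1) := fun j =>
      hd _ (Finset.mem_image.2 ⟨j, Finset.mem_univ _, rfl⟩)
    choose a ha using hd'
    have hℓv : ∀ w : ι → K, ℓ w = ∑ j, w j * ℓ (Pi.single j 1) := by
      intro w
      conv_lhs => rw [← Finset.univ_sum_single w]
      rw [map_sum]
      refine Finset.sum_congr rfl fun j _ => ?_
      rw [← smul_eq_mul, ← map_smul]
      congr 1
      ext i
      by_cases h : i = j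
      · subst h; simp
      · simp [h]
    have hx0 : (∑ j, a j • z j) = 0 := by
      apply hTsep
      intro ω hω
      have h1 : ℓ (vec ω) = 0 := hℓ (Submodule.subset_span ⟨ω, hω, rfl⟩)
      apply IsFractionRing.injective A K
      rw [map_sum, map_sum, map_zero]
      rw [hℓv] at h1
      have h2 : ∑ j, algebraMap A K (ω (a j • z j)) = (d : A) • ∑ j, vec ω j * ℓ (Pi.single j 1) := by
        rw [Finset.smul_sum]
        refine Finset.sum_congr rfl fun j _ => ?_
        rw [map_smul, smul_eq_mul, map_mul, ha, smul_mul_assoc, mul_comm (ℓ _), mul_comm]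
      rw [h2, h1, smul_zero]
    have hx1 : ∑ j, algebraMap A K (a j) • b j = 0 := by
      have := congrArg Subtype.val hx0
      rw [AddSubmonoidClass.coe_finsetSum] at this
      simp only [algebraMap_smul]
      exact this
    have hli := Fintype.linearIndependent_iff.1 b.linearIndependent _ hx1
    apply hℓ0
    ext j
    have h3 := hli j
    rw [ha, Algebra.smul_def, mul_eq_zero, map_eq_zero_iff _ (IsFractionRing.injective A K)] at h3
    have h4 := h3.resolve_left (nonZeroDivisors.ne_zero d.2)
    simpa using h4
  -- functionals over A
  have hspanA : ∀ w ∈ Submodule.span K (vec '' T), ∃ (d : A) (ω : S →ₗ[A] A), d ≠ 0 ∧ ω ∈ F ∧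
      ∀ j, algebraMap A K (ω (z j)) = d • w j := by
    intro w hw
    refine Submodule.span_induction (p := fun w _ => ∃ (d : A) (ω : S →ₗ[A] A), d ≠ 0 ∧ ω ∈ F ∧
      ∀ j, algebraMap A K (ω (z j)) = d • w j) ?_ ?_ ?_ ?_ hw
    · rintro _ ⟨ω, hω, rfl⟩
      exact ⟨1, ω, one_ne_zero, hTF ω hω, fun j => by simp [vec]⟩
    · exact ⟨1, 0, one_ne_zero, fun n x _ => by simp, fun j => by simp⟩
    · rintro w w' _ _ ⟨d, ω, hd, hω, h⟩ ⟨d', ω', hd', hω', h'⟩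
      refine ⟨d * d', d' • ω + d • ω', mul_ne_zero hd hd', ?_, ?_⟩
      · intro n x hx
        exact add_mem (Ideal.mul_mem_left _ _ (hω n x hx)) (Ideal.mul_mem_left _ _ (hω' n x hx))
      · intro j
        simp only [LinearMap.add_apply, LinearMap.smul_apply, smul_eq_mul, map_add, map_mul, h, h', Pi.add_apply,
          Algebra.smul_def]
        ring
    · rintro r w _ ⟨d, ω, hd, hω, h⟩
      obtain ⟨r1, r2, hr2, rfl⟩ := IsFractionRing.div_surjective (A := A) r
      have hr2' : algebraMap A K r2 ≠ 0 := by
        rw [Ne, map_eq_zero_iff _ (IsFractionRing.injective A K)]; exact nonZeroDivisors.ne_zero hr2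
      refine ⟨r2 * d, r1 • ω, mul_ne_zero (nonZeroDivisors.ne_zero hr2) hd, ?_, ?_⟩
      · intro n x hx
        exact Ideal.mul_mem_left _ _ (hω n x hx)
      · intro j
        simp only [LinearMap.smul_apply, smul_eq_mul, map_mul, h, Pi.smul_apply, Algebra.smul_def]
        field_simp
  choose d ω hd hω hdω using fun i : ι => hspanA (Pi.single i 1) (by rw [hspan]; trivial)
  let Δ := ∏ i, d i
  have hΔ : Δ ≠ 0 := Finset.prod_ne_zero_iff.2 fun i _ => hd i
  have hΔi : ∀ i, ∃ c, Δ = c * d i := fun i => ⟨_, (Finset.prod_erase_mul _ _ (Finset.mem_univ i)).symm⟩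
  choose c hc using hΔi
  obtain ⟨cc, hcc⟩ := ar_cancel (m.map (algebraMap A S)) (algebraMap A S (Δ * δ)) (by
    rw [Ne, map_eq_zero_iff _ hinjS]; exact mul_ne_zero hΔ hδ)
  refine ⟨κ, κ * cc, fun n x hx => hcc n x ?_⟩
  have hx' : ∀ i, ω i x ∈ m ^ (n + cc) := fun i => hω i _ x (by rw [mul_add]; exact hx)
  -- key identity
  have hid : δ • x = ∑ j, μ j x • z j := by
    apply Subtype.ext
    rw [AddSubmonoidClass.coe_finsetSum]
    exact hμ x
  have hcoord : ∀ i, d i * μ i x = δ * ω i x := by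
    intro i
    have h1 := congrArg (ω i) hid
    rw [map_smul, map_sum, smul_eq_mul] at h1
    rw [h1]
    apply IsFractionRing.injective A K
    rw [map_sum]
    simp only [map_smul, smul_eq_mul, map_mul, hdω]
    rw [Finset.sum_eq_single i]
    · simp [Algebra.smul_def, mul_comm]
    · intro j _ hj; simp [hj]
    · simp
  have hfin : algebraMap A S (Δ * δ) * x = ∑ j, algebraMap A S (c j * (δ * ω j x)) * z j := by
    rw [map_mul, mul_assoc, ← Algebra.smul_def δ, hid, Finset.mul_sum]
    refine Finset.sum_congr rfl fun j _ => ?_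
    rw [← hcoord, Algebra.smul_def, ← mul_assoc, ← map_mul, ← mul_assoc, ← hc]
  rw [hfin, ← Ideal.map_pow]
  exact sum_mem fun j _ => Ideal.mul_mem_right _ _ (Ideal.mem_map_of_mem _
    (Ideal.mul_mem_left _ _ (Ideal.mul_mem_left _ _ (hx' j))))
end PartP4e

section PartP6d
open IsLocalRing
set_option linter.unusedSectionVars false

namespace MvPS
open MvPowerSeries Finsupp

lemma mem_span_X_pow {τ D : Type*} [CommRing D] [Finite τ] (f : MvPowerSeries τ D) (n : ℕ)
    (h : ∀ d : τ →₀ ℕ, d.degree < n → coeff d f = 0) :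
    f ∈ (Ideal.span (Set.range (X : τ → MvPowerSeries τ D))) ^ n := by
  have hmap : Ideal.map (toAdicCompletionAlgEquiv τ D).toRingEquiv (Ideal.span (Set.range X)) =
    (MvPolynomial.idealOfVars τ D).map (algebraMap _ (AdicCompletion (MvPolynomial.idealOfVars τ D) (MvPolynomial τ D))) := by
    simp_rw [Ideal.map_span, ← Set.range_comp]
    congr 2; ext1
    simp [AdicCompletion.algebraMap_apply, ← MvPolynomial.coe_X, toAdicCompletion_coe]
  have h1 : toAdicCompletionAlgEquiv τ D f ∈ (AdicCompletion.eval (MvPolynomial.idealOfVars τ D) (MvPolynomial τ D) n).ker := by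
    rw [LinearMap.mem_ker]
    have : truncTotal n f = 0 := by
      ext d
      rw [coeff_truncTotal_eq_ite]
      split_ifs with hd
      · simpa using h d hd
      · simp
    rw [toAdicCompletionAlgEquiv_apply]
    change (toAdicCompletion τ D f).val n = 0
    rw [toAdicCompletion_apply_eq_mk_truncTotal, this]
    exact map_zero _
  rw [← AdicCompletion.pow_smul_top_eq_ker_eval (MvPolynomial.idealOfVars_fg τ D), Ideal.smul_top_eq_map, Ideal.map_pow, ← hmap] at h1
  have h2 := Ideal.mem_map_of_mem (toAdicCompletionAlgEquiv τ D).toRingEquiv.symm h1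
  rw [Ideal.map_pow] at h2
  have h3 : Ideal.map (toAdicCompletionAlgEquiv τ D).toRingEquiv.symm (Ideal.map (toAdicCompletionAlgEquiv τ D).toRingEquiv (Ideal.span (Set.range (X : τ → MvPowerSeries τ D)))) = Ideal.span (Set.range X) := Ideal.map_of_equiv _
  rw [h3] at h2
  have h4 : (toAdicCompletionAlgEquiv τ D).toRingEquiv.symm (toAdicCompletionAlgEquiv τ D f) = f :=
    (toAdicCompletionAlgEquiv τ D).toRingEquiv.symm_apply_apply f
  rwa [h4] at h2

variable {τ D : Type*} [CommRing D] [Finite τ] [IsDomain D] [IsLocalRing D] {w : D}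

/-- the generators of the maximal ideal. -/
noncomputable def xs (τ : Type*) {D : Type*} [CommRing D] (w : D) : Option τ → MvPowerSeries τ D
  | none => C w
  | Option.some i => X i

lemma span_le : Ideal.span (Set.range (X : τ → MvPowerSeries τ D)) ≤ Ideal.span (Set.range (xs τ w)) := by
  rw [Ideal.span_le]
  rintro _ ⟨i, rfl⟩
  exact Ideal.subset_span ⟨Option.some i, rfl⟩

lemma maxIdeal_eq (hw : maximalIdeal D = Ideal.span {w}) :
    maximalIdeal (MvPowerSeries τ D) = Ideal.span (Set.range (xs τ w)) := by
  have hmem : ∀ f : MvPowerSeries τ D, f ∈ maximalIdeal (MvPowerSeries τ D) ↔ w ∣ constantCoeff f := by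
    intro f
    rw [← Ideal.mem_span_singleton, ← hw, mem_maximalIdeal, mem_nonunits_iff, mem_maximalIdeal, mem_nonunits_iff, isUnit_iff_constantCoeff]
  apply le_antisymm
  · intro f hf
    obtain ⟨c, hc⟩ := (hmem f).1 hf
    have h1 : f - C (w * c) ∈ (Ideal.span (Set.range (X : τ → MvPowerSeries τ D))) ^ 1 := by
      apply mem_span_X_pow
      intro d hd
      have : d = 0 := by
        rw [← Finsupp.degree_eq_zero_iff]; omega
      subst this
      rw [coeff_zero_eq_constantCoeff_apply, map_sub, constantCoeff_C, hc, sub_self]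
    rw [pow_one] at h1
    rw [← sub_add_cancel f (C (w * c))]
    refine add_mem (span_le h1) ?_
    rw [map_mul]
    exact Ideal.mul_mem_right _ _ (Ideal.subset_span ⟨none, rfl⟩)
  · rw [Ideal.span_le]
    rintro _ ⟨_ | i, rfl⟩
    · rw [SetLike.mem_coe, hmem]; simp [xs]
    · rw [SetLike.mem_coe, hmem]; simp [xs]

lemma mem_pow_iff (hw : maximalIdeal D = Ideal.span {w}) (n : ℕ) (f : MvPowerSeries τ D) :
    f ∈ maximalIdeal (MvPowerSeries τ D) ^ n ↔ ∀ d : τ →₀ ℕ, d.degree < n → w ^ (n - d.degree) ∣ coeff d f := by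
  classical
  rw [maxIdeal_eq hw]
  constructor
  · induction n generalizing f with
    | zero => intro _ d hd; omega
    | succ n ih =>
      intro hf
      rw [pow_succ] at hf
      refine Submodule.mul_induction_on hf ?_ ?_
      · intro a ha b hb
        have hb' : ∀ d : τ →₀ ℕ, d.degree < 1 → w ^ (1 - d.degree) ∣ coeff d b := by
          intro d hd
          have : d = 0 := by
            rw [← Finsupp.degree_eq_zero_iff]; omega
          subst this
          rw [← maxIdeal_eq hw, mem_maximalIdeal, mem_nonunits_iff, isUnit_iff_constantCoeff, ← mem_nonunits_iff, ← mem_maximalIdeal, hw, Ideal.mem_span_singleton] at hb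
          simpa using hb
        intro d hd
        rw [coeff_mul]
        refine Finset.dvd_sum fun x hx => ?_
        rw [Finset.HasAntidiagonal.mem_antidiagonal] at hx
        have hdeg : x.1.degree + x.2.degree = d.degree := by rw [← hx, map_add]
        by_cases h2 : x.2.degree < 1
        · have h3 := ih a ha x.1
          have h4 := hb' x.2 h2
          by_cases h5 : x.1.degree < n
          · refine (pow_dvd_pow w ?_).trans (pow_add w _ _ ▸ mul_dvd_mul (h3 h5) h4)
            omega
          · refine dvd_mul_of_dvd_right ((pow_dvd_pow w ?_).trans h4) _
            omega
        · refine dvd_mul_of_dvd_left ((pow_dvd_pow w ?_).trans (ih a ha x.1 (by omega))) _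
          omega
      · intro a b ha hb d hd
        rw [map_add]
        exact dvd_add (ha d hd) (hb d hd)
  · intro h
    have h1 : f - (truncTotal n f : MvPolynomial τ D) ∈ (Ideal.span (Set.range (X : τ → MvPowerSeries τ D))) ^ n := by
      apply mem_span_X_pow
      intro d hd
      rw [map_sub, MvPolynomial.coeff_coe, coeff_truncTotal _ hd, sub_self]
    rw [← sub_add_cancel f (truncTotal n f : MvPolynomial τ D)]
    refine add_mem (Ideal.pow_right_mono span_le n h1) ?_
    rw [(truncTotal n f).as_sum, ← MvPolynomial.coeToMvPowerSeries.ringHom_apply, map_sum]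
    refine Ideal.sum_mem _ fun d hd => ?_
    have hdn : d.degree < n := by
      by_contra hc
      rw [MvPolynomial.mem_support_iff, coeff_truncTotal_eq_zero _ (by omega)] at hd
      exact hd rfl
    rw [coeff_truncTotal _ hdn]
    obtain ⟨c, hc⟩ := h d hdn
    have hpow : n = (n - d.degree) + d.degree := by omega
    rw [hc, mul_comm, ← MvPolynomial.C_mul_monomial, map_mul, MvPolynomial.monomial_eq, map_mul]
    refine Ideal.mul_mem_left _ _ ?_
    conv_lhs => rw [hpow]
    rw [pow_add]
    refine Ideal.mul_mem_mul ?_ ?_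
    · rw [map_pow, map_pow]
      refine Ideal.pow_mem_pow ?_ _
      refine Ideal.subset_span ⟨none, ?_⟩
      simp [xs]
    · rw [map_finsuppProd, Finsupp.prod, Finsupp.degree_apply, ← Finset.prod_pow_eq_pow_sum]
      refine Ideal.prod_mem_prod fun i _ => ?_
      rw [map_pow]
      refine Ideal.pow_mem_pow ?_ _
      refine Ideal.subset_span ⟨Option.some i, ?_⟩
      simp [xs]

theorem complete (hw : maximalIdeal D = Ideal.span {w}) (hD : IsAdicComplete (maximalIdeal D) D) :
    IsAdicComplete (maximalIdeal (MvPowerSeries τ D)) (MvPowerSeries τ D) := by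
  have hpowD : ∀ (a : D) n, a ∈ maximalIdeal D ^ n ↔ w ^ n ∣ a := fun a n => by
    rw [hw, Ideal.span_singleton_pow, Ideal.mem_span_singleton]
  refine { haus' := ?_, prec' := ?_ }
  · intro f hf
    have hf' : ∀ n, f ∈ maximalIdeal (MvPowerSeries τ D) ^ n := fun n => by
      have := hf n
      rwa [SModEq.zero, smul_eq_mul, Ideal.mul_top] at this
    ext d
    rw [map_zero]
    refine IsHausdorff.haus hD.toIsHausdorff _ (fun n => ?_)
    rw [SModEq.zero, smul_eq_mul, Ideal.mul_top, hpowD]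
    have := (mem_pow_iff hw _ f).1 (hf' (n + d.degree + 1)) d (by omega)
    exact (pow_dvd_pow w (by omega)).trans this
  · intro f hf
    have hf' : ∀ {m n}, m ≤ n → f m - f n ∈ maximalIdeal (MvPowerSeries τ D) ^ m := fun {m n} h => by
      have := hf h
      rwa [SModEq.sub_mem, smul_eq_mul, Ideal.mul_top] at this
    have hlim : ∀ d : τ →₀ ℕ, ∃ L : D, ∀ n, coeff d (f (n + d.degree + 1)) - L ∈ maximalIdeal D ^ n := by
      intro d
      obtain ⟨L, hL⟩ := IsPrecomplete.prec hD.toIsPrecomplete (f := fun n => coeff d (f (n + d.degree + 1))) (by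
        intro m n hmn
        rw [SModEq.sub_mem, smul_eq_mul, Ideal.mul_top, ← map_sub, hpowD]
        have := (mem_pow_iff hw _ _).1 (hf' (show m + d.degree + 1 ≤ n + d.degree + 1 by omega)) d (by omega)
        exact (pow_dvd_pow w (by omega)).trans this)
      refine ⟨L, fun n => ?_⟩
      have := hL n
      rwa [SModEq.sub_mem, smul_eq_mul, Ideal.mul_top] at this
    choose L hL using hlim
    obtain ⟨F, hF⟩ : ∃ F : MvPowerSeries τ D, ∀ d, coeff d F = L d := ⟨fun d => L d, fun _ => rfl⟩
    refine ⟨F, fun n => ?_⟩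
    rw [SModEq.sub_mem, smul_eq_mul, Ideal.mul_top, mem_pow_iff hw]
    intro d hd
    rw [map_sub, hF]
    have h1 := (hpowD _ _).1 (hL d n)
    have h2 := (mem_pow_iff hw _ _).1 (hf' (show n ≤ n + d.degree + 1 by omega)) d hd
    rw [map_sub] at h2
    have := dvd_add h2 ((pow_dvd_pow w (show n - d.degree ≤ n by omega)).trans h1)
    rwa [sub_add_sub_cancel] at this

end MvPS
end PartP6d

section PartP6e
open IsLocalRing
set_option linter.unusedSectionVars false

namespace MvPS
open MvPowerSeries

variable {τ D : Type*} [CommRing D] [Finite τ]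

/-- homogeneous component as polynomial -/
noncomputable def hc (n : ℕ) (f : MvPowerSeries τ D) : MvPolynomial τ D := truncTotal (n+1) f - truncTotal n f

lemma coeff_hc (n : ℕ) (f : MvPowerSeries τ D) (d : τ →₀ ℕ) :
    (hc n f).coeff d = if d.degree = n then coeff d f else 0 := by
  rw [hc, MvPolynomial.coeff_sub, coeff_truncTotal_eq_ite, coeff_truncTotal_eq_ite]
  split_ifs with h1 h2 h3 h3 <;> first | omega | simp

/-- f ↦ Σ f_n t^n -/
noncomputable def hcHom : MvPowerSeries τ D →+* PowerSeries (MvPolynomial τ D) where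
  toFun f := PowerSeries.mk fun n => hc n f
  map_zero' := by ext n d; simp [coeff_hc]
  map_one' := by
    classical
    ext n d
    rw [PowerSeries.coeff_mk, coeff_hc, PowerSeries.coeff_one, coeff_one]
    by_cases hd : d = 0
    · subst hd
      by_cases hn : n = 0
      · subst hn; simp
      · simp [hn, Ne.symm hn]
    · rw [if_neg hd]
      split_ifs <;> simp [MvPolynomial.coeff_one, Ne.symm hd]
  map_add' f g := by
    ext n d
    simp only [PowerSeries.coeff_mk, coeff_hc, map_add, MvPolynomial.coeff_add]
    split_ifs <;> simp
  map_mul' f g := by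
    classical
    ext n d
    rw [PowerSeries.coeff_mk, coeff_hc, PowerSeries.coeff_mul, MvPolynomial.coeff_sum]
    simp only [PowerSeries.coeff_mk, MvPolynomial.coeff_mul, coeff_hc]
    rw [Finset.sum_comm, coeff_mul]
    have key : ∀ x ∈ Finset.HasAntidiagonal.antidiagonal d, (∑ p ∈ Finset.HasAntidiagonal.antidiagonal n,
        (if x.1.degree = p.1 then coeff x.1 f else 0) * (if x.2.degree = p.2 then coeff x.2 g else 0)) =
        if d.degree = n then coeff x.1 f * coeff x.2 g else 0 := by
      intro x hx
      rw [Finset.HasAntidiagonal.mem_antidiagonal] at hx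
      have hdeg : x.1.degree + x.2.degree = d.degree := by rw [← hx, map_add]
      split_ifs with hd
      · rw [Finset.sum_eq_single (x.1.degree, x.2.degree)]
        · simp
        · rintro ⟨a, b⟩ _ hne
          by_cases h1 : x.1.degree = a
          · by_cases h2 : x.2.degree = b
            · subst h1; subst h2; exact absurd rfl hne
            · simp [h2]
          · simp [h1]
        · intro h; exfalso; apply h; rw [Finset.HasAntidiagonal.mem_antidiagonal]; simp; omega
      · refine Finset.sum_eq_zero ?_
        rintro ⟨a, b⟩ hab
        rw [Finset.HasAntidiagonal.mem_antidiagonal] at hab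
        simp only at hab
        by_cases h1 : x.1.degree = a
        · have h2 : x.2.degree ≠ b := by omega
          simp [h2]
        · simp [h1]
    rw [Finset.sum_congr rfl key]
    split_ifs <;> simp

end MvPS
end PartP6e

section PartP6f
open IsLocalRing
set_option linter.unusedSectionVars false

namespace MvPS
open MvPowerSeries

variable {τ D : Type*} [CommRing D] [Finite τ] [IsDomain D] [IsLocalRing D] {w : D}

lemma hcHom_C (a : D) : hcHom (C a : MvPowerSeries τ D) = PowerSeries.C (MvPolynomial.C a) := by
  classical
  ext n d
  change MvPolynomial.coeff d (PowerSeries.coeff n (PowerSeries.mk _)) = _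
  rw [PowerSeries.coeff_mk, coeff_hc, PowerSeries.coeff_C, coeff_C]
  by_cases hd : d = 0
  · subst hd
    by_cases hn : n = 0
    · subst hn; simp
    · simp [hn, Ne.symm hn]
  · rw [if_neg hd]
    split_ifs <;> simp [MvPolynomial.coeff_C, Ne.symm hd]

lemma hcHom_X (i : τ) : hcHom (X i : MvPowerSeries τ D) = PowerSeries.X * PowerSeries.C (MvPolynomial.X i) := by
  classical
  ext n d
  change MvPolynomial.coeff d (PowerSeries.coeff n (PowerSeries.mk _)) = _
  rw [PowerSeries.coeff_mk, coeff_hc, coeff_X, PowerSeries.coeff_mul_C, PowerSeries.coeff_X]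
  by_cases hd : d = Finsupp.single i 1
  · subst hd
    by_cases hn : n = 1
    · subst hn; simp
    · simp [hn, Ne.symm hn]
  · rw [if_neg hd]
    split_ifs <;> simp [MvPolynomial.coeff_X, Ne.symm hd]

lemma constantCoeff_hcHom (f : MvPowerSeries τ D) :
    PowerSeries.constantCoeff (hcHom f) = MvPolynomial.C (constantCoeff f) := by
  classical
  rw [← PowerSeries.coeff_zero_eq_constantCoeff_apply]
  change (PowerSeries.coeff 0 (PowerSeries.mk fun n => hc n f)) = _
  ext d
  rw [PowerSeries.coeff_mk, coeff_hc, MvPolynomial.coeff_C]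
  by_cases h : d = 0
  · subst h; simp
  · have h' : d.degree ≠ 0 := fun h0 => h ((Finsupp.degree_eq_zero_iff d).1 h0)
    rw [if_neg h', if_neg (Ne.symm h)]

abbrev PR (τ D : Type*) [CommRing D] := PowerSeries (MvPolynomial (Option τ) D)

abbrev QR (τ : Type*) {D : Type*} [CommRing D] (w : D) :=
  PowerSeries (MvPolynomial (Option τ) D) ⧸
    Ideal.span {PowerSeries.C (MvPolynomial.C w) - PowerSeries.X * PowerSeries.C (MvPolynomial.X none : MvPolynomial (Option τ) D)}

theorem blow (hw : maximalIdeal D = Ideal.span {w}) (hw0 : w ≠ 0) :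
    ∃ (u : Option τ → QR τ w) (t : QR τ w) (φ : MvPowerSeries τ D →+* QR τ w)
      (ψ : QR τ w →+* MvPolynomial (Option τ) (ResidueField D)) (res : MvPowerSeries τ D →+* ResidueField D),
      BlowData (xs τ w) u t φ ψ res := by
  have hresw : residue D w = 0 := by
    rw [residue_eq_zero_iff, hw]; exact Ideal.mem_span_singleton_self w
  let g0 : PR τ D := PowerSeries.C (MvPolynomial.C w) - PowerSeries.X * PowerSeries.C (MvPolynomial.X none)
  let mk : PR τ D →+* QR τ w := Ideal.Quotient.mk _
  have hmk : ∀ r, mk r = 0 ↔ g0 ∣ r := fun r => by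
    rw [← Ideal.mem_span_singleton]; exact Ideal.Quotient.eq_zero_iff_mem
  have hmkg : mk (PowerSeries.C (MvPolynomial.C w)) = mk (PowerSeries.X * PowerSeries.C (MvPolynomial.X none)) := by
    rw [← sub_eq_zero, ← map_sub, hmk]
  let ψ0 : PR τ D →+* MvPolynomial (Option τ) (ResidueField D) := (MvPolynomial.map (residue D)).comp PowerSeries.constantCoeff
  have hψ0 : ∀ a ∈ Ideal.span {g0}, ψ0 a = 0 := by
    intro a ha
    rw [Ideal.mem_span_singleton] at ha
    obtain ⟨b, rfl⟩ := ha
    simp [ψ0, g0, hresw]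
  let φ0 : MvPowerSeries τ D →+* PR τ D := (PowerSeries.map (MvPolynomial.rename Option.some : MvPolynomial τ D →ₐ[D] MvPolynomial (Option τ) D).toRingHom).comp hcHom
  let ψ : QR τ w →+* MvPolynomial (Option τ) (ResidueField D) := Ideal.Quotient.lift _ ψ0 hψ0
  have hψ : ∀ r, ψ (mk r) = ψ0 r := fun r => Ideal.Quotient.lift_mk _ _ _
  refine ⟨fun i => mk (PowerSeries.C (MvPolynomial.X i)), mk PowerSeries.X, mk.comp φ0,
    ψ, (residue D).comp constantCoeff,
    { span_x := maxIdeal_eq hw, hx := ?_, hu := ?_, hφ := ?_, res_ker := ?_, res_surj := ?_, surj := ?_, ker := ?_, reg := ?_ }⟩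
  · rintro (_ | i)
    · rw [← map_mul, ← hmkg]
      simp [φ0, xs, hcHom_C]
    · rw [← map_mul]
      simp [φ0, xs, hcHom_X]
  · intro i
    rw [hψ]; simp [ψ0]
  · intro a
    rw [RingHom.comp_apply, hψ]
    simp only [ψ0, φ0, RingHom.comp_apply]
    rw [← PowerSeries.coeff_zero_eq_constantCoeff_apply, PowerSeries.coeff_map, PowerSeries.coeff_zero_eq_constantCoeff_apply, constantCoeff_hcHom]
    simp
  · intro a
    rw [RingHom.comp_apply, residue_eq_zero_iff, mem_maximalIdeal, mem_maximalIdeal, mem_nonunits_iff, mem_nonunits_iff, isUnit_iff_constantCoeff]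
  · exact residue_surjective.comp (fun a => ⟨C a, by simp⟩)
  · intro q
    obtain ⟨q', rfl⟩ := MvPolynomial.map_surjective _ residue_surjective q
    exact ⟨mk (PowerSeries.C q'), by rw [hψ]; simp [ψ0]⟩
  · intro r
    obtain ⟨r, rfl⟩ := Ideal.Quotient.mk_surjective r
    change ψ (mk r) = 0 ↔ mk _ ∣ mk r
    constructor
    · intro h
      rw [hψ] at h
      have h1 : MvPolynomial.C w ∣ PowerSeries.constantCoeff r := by
        rw [MvPolynomial.C_dvd_iff_dvd_coeff]
        intro d
        have := congrArg (MvPolynomial.coeff d) h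
        simp only [ψ0, RingHom.comp_apply, MvPolynomial.coeff_map, MvPolynomial.coeff_zero] at this
        rwa [residue_eq_zero_iff, hw, Ideal.mem_span_singleton] at this
      obtain ⟨c, hc⟩ := h1
      obtain ⟨r', hr'⟩ : PowerSeries.X ∣ r - PowerSeries.C (PowerSeries.constantCoeff r) := by
        rw [PowerSeries.X_dvd_iff]; simp
      rw [sub_eq_iff_eq_add, hc] at hr'
      rw [hr', map_mul PowerSeries.C, map_add, map_mul mk, map_mul mk, hmkg, map_mul mk]
      exact dvd_add (dvd_mul_right _ _) (dvd_mul_of_dvd_left (dvd_mul_right _ _) _)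
    · rintro ⟨s, hs⟩
      rw [hs, map_mul, hψ]
      simp [ψ0]
  · intro a ha
    obtain ⟨a, rfl⟩ := Ideal.Quotient.mk_surjective a
    change mk _ * mk a = 0 at ha
    change mk a = 0
    rw [← map_mul, hmk] at ha
    rw [hmk]
    obtain ⟨h, hh⟩ := ha
    have h1 := congrArg PowerSeries.constantCoeff hh
    simp only [g0, map_mul, map_sub, PowerSeries.constantCoeff_X, PowerSeries.constantCoeff_C, zero_mul, sub_zero] at h1
    have h2 : PowerSeries.constantCoeff h = 0 := (mul_eq_zero.1 h1.symm).resolve_left (by simpa using hw0)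
    obtain ⟨h', rfl⟩ := PowerSeries.X_dvd_iff.2 h2
    refine ⟨h', ?_⟩
    apply mul_left_cancel₀ (PowerSeries.X_ne_zero (R := MvPolynomial (Option τ) D))
    rw [hh]; ring

end MvPS
end PartP6f

section PartP3a
set_option linter.unusedSectionVars false

lemma QSep.field_aux {k V : Type*} [Field k] [AddCommGroup V] [Module k V] (e : k ≃+ V) (p : ℕ)
    (he : ∀ f b, e (f ^ p * b) = f • e b) : QSep k p := by
  intro a ha
  by_contra hcon
  push Not at hcon
  apply ha
  have : e a = 0 := by
    refine (Module.forall_dual_apply_eq_zero_iff k (e a)).1 fun l => ?_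
    exact hcon (l.toAddMonoidHom.comp e.toAddMonoidHom) (fun f b => by simp [he])
  simpa using this

/-- type synonym carrying the Frobenius module structure. -/
def FrobMod (k : Type*) : Type _ := k

lemma QSep.field (k : Type*) [Field k] (p : ℕ) [ExpChar k p] : QSep k p := by
  let : AddCommGroup (FrobMod k) := inferInstanceAs (AddCommGroup k)
  let m0 : Module k k := Module.compHom k (frobenius k p)
  let : Module k (FrobMod k) := m0
  exact QSep.field_aux (V := FrobMod k) (AddEquiv.refl k) p (fun f b => rfl)

lemma QSep.mvPowerSeries {τ D : Type*} [CommRing D] [Finite τ] (p : ℕ) [ExpChar D p] (h : QSep D p) :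
    QSep (MvPowerSeries τ D) p := by
  classical
  intro a ha
  have hp : p ≠ 0 := expChar_ne_zero D p
  obtain ⟨d0, hd0⟩ : ∃ d, MvPowerSeries.coeff d a ≠ 0 := by
    by_contra hc
    push Not at hc
    exact ha (MvPowerSeries.ext fun d => by rw [hc d, map_zero])
  obtain ⟨l, hl1, hl2⟩ := h _ hd0
  let e : τ →₀ ℕ := d0.mapRange (fun n => n % p) (Nat.zero_mod p)
  let g : τ →₀ ℕ := d0.mapRange (fun n => n / p) (Nat.zero_div p)
  have he : ∀ i, e i < p := fun i => by
    simp only [e, Finsupp.mapRange_apply]; exact Nat.mod_lt _ (Nat.pos_of_ne_zero hp)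
  have hg : p • g + e = d0 := by
    ext i; simp [g, e, Nat.div_add_mod]
  let L : MvPowerSeries τ D →+ MvPowerSeries τ D :=
    { toFun := fun b d => l (MvPowerSeries.coeff (p • d + e) b)
      map_zero' := by ext d; simp; rfl
      map_add' := fun b c => by
        ext d
        change l _ = l _ + l _
        rw [map_add, map_add] }
  have hL : ∀ b d, MvPowerSeries.coeff d (L b) = l (MvPowerSeries.coeff (p • d + e) b) := fun b d => rfl
  refine ⟨L, fun f b => ?_, fun h0 => hl2 ?_⟩
  · ext d
    rw [hL, MvPowerSeries.coeff_mul, MvPowerSeries.coeff_mul, map_sum]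
    symm
    have hpow : ∀ u, MvPowerSeries.coeff u (f ^ p) = (MvPowerSeries.coeff u (f.expand p hp)) ^ p := by
      intro u
      rw [← MvPowerSeries.map_frobenius_expand p hp, MvPowerSeries.coeff_map]; rfl
    refine Finset.sum_of_injOn (fun x => (p • x.1, p • x.2 + e)) ?_ ?_ ?_ ?_
    · rintro ⟨x1, x2⟩ - ⟨y1, y2⟩ - hxy
      simp only [Prod.mk.injEq, add_left_inj] at hxy
      have hinj : ∀ s t : τ →₀ ℕ, p • s = p • t → s = t := by
        intro s t hst
        ext i
        have := DFunLike.congr_fun hst i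
        simpa [hp] using this
      rw [hinj _ _ hxy.1, hinj _ _ hxy.2]
    · rintro ⟨x1, x2⟩ hx
      simp only [Finset.mem_coe, Finset.HasAntidiagonal.mem_antidiagonal] at hx ⊢
      rw [← hx, smul_add, add_assoc]
    · rintro ⟨x1, x2⟩ hx hx'
      rw [Finset.HasAntidiagonal.mem_antidiagonal] at hx
      simp only at hx
      rw [hpow]
      by_cases hdv : ∀ i, p ∣ x1 i
      · exfalso; apply hx'
        have h1 : ∀ i, x1 i = p * (x1 i / p) := fun i => (Nat.mul_div_cancel' (hdv i)).symm
        have h2 : ∀ i, x1 i + x2 i = p * d i + e i := fun i => by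
          have := DFunLike.congr_fun hx i
          simpa using this
        have h3 : ∀ i, x1 i / p ≤ d i := fun i => by
          by_contra hlt
          push Not at hlt
          have := h2 i; have := h1 i; have := he i
          have : p * (d i + 1) ≤ p * (x1 i / p) := Nat.mul_le_mul le_rfl hlt
          rw [mul_add] at this
          omega
        let v : τ →₀ ℕ := x1.mapRange (fun n => n / p) (Nat.zero_div p)
        have hv : ∀ i, v i = x1 i / p := fun i => by simp [v]
        refine ⟨(v, d - v), ?_, ?_⟩
        · simp only [Finset.mem_coe, Finset.HasAntidiagonal.mem_antidiagonal]
          exact add_tsub_cancel_of_le fun i => by rw [hv]; exact h3 i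
        · simp only [Prod.mk.injEq]
          refine ⟨?_, ?_⟩
          · ext i; simp [hv]; exact (h1 i).symm
          · ext i
            simp [hv, Nat.mul_sub]
            have := h2 i; have := h1 i
            have : p * (x1 i / p) ≤ p * d i := Nat.mul_le_mul le_rfl (h3 i)
            omega
      · push Not at hdv
        obtain ⟨i, hi⟩ := hdv
        rw [MvPowerSeries.coeff_expand_of_not_dvd p hp _ hi, zero_pow hp, zero_mul, map_zero]
    · rintro ⟨x1, x2⟩ hx
      simp only
      rw [hpow, MvPowerSeries.coeff_expand_smul, hl1, hL]
  · have := congrArg (MvPowerSeries.coeff g) h0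
    rw [hL, hg, map_zero] at this
    exact this

lemma expChar_mvPowerSeries (τ D : Type*) [CommRing D] [Nontrivial D] (p : ℕ) [ExpChar D p] :
    ExpChar (MvPowerSeries τ D) p :=
  expChar_of_injective_ringHom (f := (MvPowerSeries.C : D →+* MvPowerSeries τ D)) MvPowerSeries.C_injective p
end PartP3a

section PartP3b
set_option linter.unusedSectionVars false

theorem MvPS.exists_eval {τ D S : Type*} [CommRing D] [Finite τ] [CommRing S] (J : Ideal S)
    (hJ : IsAdicComplete J S) (θ : D →+* S) (x : τ → S) (hx : ∀ i, x i ∈ J) :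
    ∃ Φ : MvPowerSeries τ D →+* S, (∀ a, Φ (MvPowerSeries.C a) = θ a) ∧ ∀ i, Φ (MvPowerSeries.X i) = x i := by
  let ev : MvPolynomial τ D →+* S := MvPolynomial.eval₂Hom θ x
  have hev : ∀ n, (MvPolynomial.idealOfVars τ D) ^ n ≤ (J ^ n).comap ev := by
    intro n
    rw [← Ideal.map_le_iff_le_comap, Ideal.map_pow]
    apply Ideal.pow_right_mono
    rw [MvPolynomial.idealOfVars, Ideal.map_span, Ideal.span_le]
    rintro _ ⟨_, ⟨i, rfl⟩, rfl⟩
    simpa [ev] using hx i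
  let f : (n : ℕ) → MvPowerSeries τ D →+* S ⧸ J ^ n := fun n =>
    (Ideal.quotientMap (J ^ n) ev (hev n)).comp (MvPowerSeries.truncTotalAlgHom τ D n).toRingHom
  have hfp : ∀ n (p : MvPowerSeries τ D), f n p = Ideal.Quotient.mk (J ^ n) (ev (MvPowerSeries.truncTotal n p)) := by
    intro n p
    exact Ideal.quotientMap_mk (J := MvPolynomial.idealOfVars τ D ^ n) (I := J ^ n) (H := hev n)
  have hf : ∀ {m n : ℕ} (hle : m ≤ n), (Ideal.Quotient.factorPow J hle).comp (f n) = f m := by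
    intro m n hle
    ext p
    rw [RingHom.comp_apply, hfp, hfp, Ideal.Quotient.factorPow, Ideal.Quotient.factor_mk, Ideal.Quotient.mk_eq_mk_iff_sub_mem, ← map_sub]
    apply hev m
    exact MvPowerSeries.truncTotal_sub_truncTotal_mem_pow_idealOfVars hle le_rfl _
  let Φ := IsAdicComplete.liftRingHom J f hf
  have hΦ : ∀ q : MvPolynomial τ D, Φ (q : MvPowerSeries τ D) = ev q := by
    intro q
    rw [← sub_eq_zero]
    apply hJ.toIsHausdorff.haus
    intro n
    rw [SModEq.zero, smul_eq_mul, Ideal.mul_top, ← Ideal.Quotient.mk_eq_mk_iff_sub_mem]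
    have h1 : Ideal.Quotient.mk (J ^ n) (Φ (q : MvPowerSeries τ D)) = f n q := IsAdicComplete.mk_liftRingHom J f hf n _
    rw [h1]
    have h2 := (MvPowerSeries.truncTotalAlgHom τ D n).commutes q
    change Ideal.quotientMap (J ^ n) ev (hev n) (MvPowerSeries.truncTotalAlgHom τ D n (algebraMap _ _ q)) = _
    rw [h2]
    exact Ideal.quotientMap_mk (J := MvPolynomial.idealOfVars τ D ^ n) (I := J ^ n) (H := hev n)
  refine ⟨Φ, fun a => ?_, fun i => ?_⟩
  · rw [← MvPolynomial.coe_C, hΦ]; simp [ev]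
  · rw [← MvPolynomial.coe_X, hΦ]; simp [ev]

lemma pi_mem_smul_top {A ι : Type*} [CommRing A] [Fintype ι] (I : Ideal A) (v : ι → A) :
    v ∈ (I • ⊤ : Submodule A (ι → A)) ↔ ∀ i, v i ∈ I := by
  classical
  constructor
  · intro h i
    have : (I • ⊤ : Submodule A (ι → A)) ≤ Submodule.comap (LinearMap.proj i) I := by
      rw [Submodule.smul_le]
      intro r hr n _
      exact I.mul_mem_right _ hr
    exact this h
  · intro h
    rw [pi_eq_sum_univ' v]
    exact Submodule.sum_mem _ fun i _ => Submodule.smul_mem_smul (h i) trivial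

lemma pi_precomplete {A ι : Type*} [CommRing A] [Fintype ι] (I : Ideal A) [hI : IsPrecomplete I A] :
    IsPrecomplete I (ι → A) := by
  refine ⟨fun f hf => ?_⟩
  have : ∀ i, ∃ L : A, ∀ n, f n i ≡ L [SMOD (I ^ n • ⊤ : Submodule A A)] := by
    intro i
    apply hI.prec'
    intro m n hmn
    have := (SModEq.sub_mem.1 (hf hmn))
    rw [pi_mem_smul_top] at this
    rw [SModEq.sub_mem, smul_eq_mul, Ideal.mul_top]
    exact this i
  choose L hL using this
  refine ⟨L, fun n => ?_⟩
  rw [SModEq.sub_mem, pi_mem_smul_top]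
  intro i
  have := SModEq.sub_mem.1 (hL i n)
  rwa [smul_eq_mul, Ideal.mul_top] at this

theorem finite_of_complete {A S : Type*} [CommRing A] [CommRing S] [Algebra A S] (I : Ideal A)
    [IsPrecomplete I A] (J : Ideal S) (hIJ : I.map (algebraMap A S) ≤ J) [hJ : IsHausdorff J S]
    (M : Submodule A S) (hM : M.FG) (h : ∀ s : S, ∃ m ∈ M, s - m ∈ I.map (algebraMap A S)) :
    Module.Finite A S := by
  obtain ⟨n, v, rfl⟩ := Submodule.fg_iff_exists_fin_generating_family.1 hM
  have : IsPrecomplete I (Fin n → A) := pi_precomplete I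
  have : IsHausdorff I S := by
    refine ⟨fun x hx => hJ.haus' x fun k => ?_⟩
    have h1 := hx k
    rw [SModEq.zero] at h1 ⊢
    rw [smul_eq_mul, Ideal.mul_top]
    rw [Ideal.smul_top_eq_map, Ideal.map_pow] at h1
    exact Ideal.pow_right_mono hIJ k h1
  let f : (Fin n → A) →ₗ[A] S := Fintype.linearCombination A v
  have hf : Function.Surjective f := by
    apply surjective_of_mkQ_comp_surjective (I := I)
    intro y
    obtain ⟨s, rfl⟩ := Submodule.mkQ_surjective _ y
    obtain ⟨m, hm, hsm⟩ := h s
    rw [← Fintype.range_linearCombination] at hm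
    obtain ⟨c, rfl⟩ := hm
    refine ⟨c, ?_⟩
    rw [LinearMap.comp_apply, Submodule.mkQ_apply, Submodule.mkQ_apply, eq_comm, Submodule.Quotient.eq, Ideal.smul_top_eq_map]
    exact hsm
  exact Module.Finite.of_surjective f hf
end PartP3b

section PartP3c
open IsLocalRing
set_option linter.unusedSectionVars false

lemma dim_le_card {R ι : Type*} [CommRing R] [IsLocalRing R] [IsNoetherianRing R] [Fintype ι] (x : ι → R)
    (hx : ∀ i, x i ∈ maximalIdeal R) (N : ℕ) (h : maximalIdeal R ^ N ≤ Ideal.span (Set.range x)) :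
    ringKrullDim R ≤ Fintype.card ι := by
  have hle : Ideal.span (Set.range x) ≤ maximalIdeal R := by
    rw [Ideal.span_le]; rintro _ ⟨i, rfl⟩; exact hx i
  have hmin : maximalIdeal R ∈ (Ideal.span (Set.range x)).minimalPrimes := by
    refine ⟨⟨inferInstance, hle⟩, ?_⟩
    rintro q ⟨hq, hq2⟩ -
    exact hq.le_of_pow_le (h.trans hq2)
  rw [← maximalIdeal_height_eq_ringKrullDim]
  have h1 := Ideal.height_le_spanRank_toENat_of_mem_minimalPrimes _ _ hmin
  have h2 : (Ideal.span (Set.range x)).spanRank.toENat ≤ (Fintype.card ι : ℕ∞) := by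
    classical
    rw [Submodule.spanRank_toENat_eq_iInf_finset_card]
    refine (iInf_le _ ⟨Finset.univ.image x, by simp [Ideal.span]⟩).trans ?_
    exact_mod_cast Finset.card_image_le
  exact_mod_cast h1.trans h2

lemma exists_sop (R : Type*) [CommRing R] [IsLocalRing R] [IsNoetherianRing R] :
    ∃ (d : ℕ) (x : Fin d → R), (d : WithBot ℕ∞) = ringKrullDim R ∧ (∀ i, x i ∈ maximalIdeal R) ∧
      ∃ N, maximalIdeal R ^ N ≤ Ideal.span (Set.range x) := by
  obtain ⟨s, hs, hc⟩ := (maximalIdeal R).exists_finset_card_eq_height_of_isNoetherianRing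
  have hr : Set.range (fun i : Fin s.card => (s.equivFin.symm i : R)) = s := by
    ext y
    simp only [Set.mem_range, Finset.mem_coe]
    constructor
    · rintro ⟨i, rfl⟩; exact (s.equivFin.symm i).2
    · intro hy; exact ⟨s.equivFin ⟨y, hy⟩, by simp⟩
  refine ⟨s.card, fun i => s.equivFin.symm i, ?_, fun i => ?_, ?_⟩
  · rw [← maximalIdeal_height_eq_ringKrullDim, ← hc]; rfl
  · exact hs.1.2 (Ideal.subset_span (s.equivFin.symm i).2)
  · rw [hr]
    have : (Ideal.span (s : Set R)).radical = maximalIdeal R := by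
      apply le_antisymm
      · exact (hs.1.1.radical_le_iff).2 hs.1.2
      · rw [Ideal.radical_eq_sInf]
        refine le_sInf ?_
        rintro q ⟨hq1, hq2⟩
        exact hs.2 ⟨hq2, hq1⟩ (le_maximalIdeal hq2.ne_top)
    obtain ⟨n, hn⟩ := Ideal.exists_radical_pow_le_of_fg (Ideal.span (s : Set R)) (by rw [this]; exact IsNoetherian.noetherian _)
    rw [this] at hn
    exact ⟨n, hn⟩

lemma exists_sop_mod {R : Type*} [CommRing R] [IsDomain R] [IsLocalRing R] [IsNoetherianRing R] (w : R) (hw : w ∈ maximalIdeal R)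
    (hw0 : w ≠ 0) :
    ∃ (d : ℕ) (x : Fin d → R), (d : WithBot ℕ∞) + 1 ≤ ringKrullDim R ∧ (∀ i, x i ∈ maximalIdeal R) ∧
      ∃ N, maximalIdeal R ^ N ≤ Ideal.span {w} ⊔ Ideal.span (Set.range x) := by
  have hne : Ideal.span {w} ≠ ⊤ := by
    intro h
    have := (Ideal.span_singleton_le_iff_mem (maximalIdeal R)).2 hw
    rw [h, top_le_iff] at this
    exact Ideal.IsPrime.ne_top' this
  have : Nontrivial (R ⧸ Ideal.span {w}) := Ideal.Quotient.nontrivial_iff.2 hne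
  let π := Ideal.Quotient.mk (Ideal.span {w})
  have hπ : Function.Surjective π := Ideal.Quotient.mk_surjective
  have : IsLocalRing (R ⧸ Ideal.span {w}) := IsLocalRing.of_surjective' π hπ
  obtain ⟨d, x, hd, hx, N, hN⟩ := exists_sop (R ⧸ Ideal.span {w})
  have : IsLocalHom π := IsLocalHom.of_surjective π hπ
  choose y hy using fun i => hπ (x i)
  have hmap : (maximalIdeal R).map π = maximalIdeal (R ⧸ Ideal.span {w}) := by
    apply le_antisymm
    · exact ((local_hom_TFAE π).out 0 2).1 this
    · intro z hz
      obtain ⟨z, rfl⟩ := hπ z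
      exact Ideal.mem_map_of_mem _ (fun hu => hz (hu.map π))
  refine ⟨d, y, ?_, fun i => ?_, N, ?_⟩
  · rw [hd]; exact ringKrullDim_quotient_succ_le_of_nonZeroDivisor (mem_nonZeroDivisors_of_ne_zero hw0)
  · have := hx i
    rw [← hy i] at this
    exact fun hu => this (hu.map π)
  · intro z hz
    have h1 : π z ∈ Ideal.span (Set.range x) := by
      apply hN
      rw [← hmap, ← Ideal.map_pow]
      exact Ideal.mem_map_of_mem _ hz
    have h2 : Set.range x = π '' Set.range y := by
      rw [← Set.range_comp]; congr 1; ext i; exact (hy i).symm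
    rw [h2, ← Ideal.map_span] at h1
    obtain ⟨z', hz', h3⟩ := (Ideal.mem_map_iff_of_surjective π hπ).1 h1
    rw [← sub_add_cancel z z']
    apply Ideal.add_mem
    · apply Ideal.mem_sup_left
      rw [← Ideal.Quotient.mk_eq_mk_iff_sub_mem]; exact h3.symm
    · exact Ideal.mem_sup_right hz'
end PartP3c

section PartP4f
open IsLocalRing
set_option linter.unusedSectionVars false

/-- Artin-Rees for a subalgebra -/
lemma ar_sub {A S T : Type*} [CommRing A] [IsNoetherianRing A] [CommRing S] [CommRing T] [Algebra A S] [Algebra A T]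
    [Module.Finite A S] (i : T →ₐ[A] S) (hi : Function.Injective i) (m : Ideal A) :
    ∃ k, ∀ n (z : T), i z ∈ (m.map (algebraMap A S)) ^ (n + k) → z ∈ (m.map (algebraMap A T)) ^ n := by
  obtain ⟨k, hk⟩ := Ideal.exists_pow_inf_eq_pow_smul m (LinearMap.range i.toLinearMap)
  refine ⟨k, fun n z hz => ?_⟩
  have h1 : i z ∈ (m ^ (n + k) • ⊤ ⊓ LinearMap.range i.toLinearMap : Submodule A S) := by
    refine ⟨?_, z, rfl⟩
    rw [Ideal.smul_top_eq_map, Ideal.map_pow]; exact hz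
  rw [hk (n + k) (by omega), Nat.add_sub_cancel] at h1
  have h2 : i z ∈ m ^ n • LinearMap.range i.toLinearMap :=
    Submodule.smul_mono le_rfl inf_le_right h1
  rw [LinearMap.range_eq_map, ← Submodule.map_smul''] at h2
  obtain ⟨w, hw, hwz⟩ := h2
  rw [hi hwz, Ideal.smul_top_eq_map, Ideal.map_pow] at hw
  exact hw

lemma map_pow_mem {A S T : Type*} [CommRing A] [CommRing S] [CommRing T] [Algebra A S] [Algebra A T]
    (i : S →ₐ[A] T) (m : Ideal A) (N : ℕ) (z : S) (hz : z ∈ (m.map (algebraMap A S)) ^ N) :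
    i z ∈ (m.map (algebraMap A T)) ^ N := by
  have := Ideal.mem_map_of_mem (i : S →+* T) hz
  rw [Ideal.map_pow, Ideal.map_map, AlgHom.comp_algebraMap_of_tower] at this
  exact this

theorem izumi_sub {A L Ω Γ : Type*} (K : Type*) [CommRing A] [IsDomain A] [IsLocalRing A] [IsNoetherianRing A]
    [IsIntegrallyClosed A] [Field K] [Algebra A K] [IsFractionRing A K] [Field L] [Algebra K L] [Algebra A L]
    [IsScalarTower A K L] [FiniteDimensional K L]
    [Field Ω] [Algebra A Ω] [Algebra K Ω] [IsScalarTower A K Ω] [IsAlgClosed Ω]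
    [LinearOrderedCommGroupWithZero Γ] {v : Valuation Ω Γ} {g : Γ} (hL : LiouvilleProp A)
    (hv : SepIzumi.OrdV A v g) (p : ℕ) [hp : ExpChar A p] (hQ : QSep A p)
    (S : Subalgebra A L) [Module.Finite A S]
    (hS : ∀ z : L, ∃ a : A, a ≠ 0 ∧ a • z ∈ S) :
    IzumiProp ((maximalIdeal A).map (algebraMap A S)) := by
  have : ExpChar K p := expChar_of_injective_algebraMap (IsFractionRing.injective A K) p
  let Ls := separableClosure K L
  have : ExpChar Ls p := expChar_of_injective_algebraMap (algebraMap K Ls).injective p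
  have : IsScalarTower A Ls L := IsScalarTower.of_algebraMap_eq fun x => rfl
  let Ss : Subalgebra A Ls := S.comap (IsScalarTower.toAlgHom A Ls L)
  let i : Ss →ₐ[A] S := ((IsScalarTower.toAlgHom A Ls L).comp Ss.val).codRestrict S (fun x => x.2)
  have hi : Function.Injective i := fun x y h => by
    apply Subtype.ext
    apply Subtype.ext
    exact congrArg (fun z : S => (z : L)) h
  have : Module.Finite A Ss := Module.Finite.of_injective i.toLinearMap hi
  have hSs : ∀ z : Ls, ∃ a : A, a ≠ 0 ∧ a • z ∈ Ss := fun z => by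
    obtain ⟨a, ha, h⟩ := hS (z : L)
    exact ⟨a, ha, h⟩
  obtain ⟨c, e, hce⟩ := SepIzumi.main K hL hv Ss hSs
  obtain ⟨k, hk⟩ := ar_sub i hi (maximalIdeal A)
  set ε := IsPurelyInseparable.exponent Ls L
  have hε : ∀ x : S, ∃ z : Ss, i z = x ^ (p ^ ε) := fun x => by
    obtain ⟨z, hz⟩ := IsPurelyInseparable.exponent_def' Ls p (x : L)
    refine ⟨⟨z, ?_⟩, Subtype.ext hz⟩
    change algebraMap Ls L z ∈ S
    rw [hz]
    exact S.pow_mem x.2 _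
  obtain ⟨κ, c0, hκ⟩ := insep_claim K S hS p ε (hQ.pow ε)
  refine ⟨c * κ, c * c0 + e + k, fun n x y hxy => ?_⟩
  obtain ⟨z, hz⟩ := hε x
  obtain ⟨w, hw⟩ := hε y
  have hmapI : ∀ N (z : Ss), z ∈ ((maximalIdeal A).map (algebraMap A Ss)) ^ N → i z ∈ ((maximalIdeal A).map (algebraMap A S)) ^ N := fun N z hz =>
    map_pow_mem i _ N z hz
  have h1 : i (z * w) ∈ ((maximalIdeal A).map (algebraMap A S)) ^ ((c * (κ * n + c0) + e) + k) := by
    rw [map_mul, hz, hw, ← mul_pow]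
    have h2 : c * (κ * n + c0) + e + k = c * κ * n + (c * c0 + e + k) := by ring
    rw [h2]
    exact Ideal.pow_mem_of_mem _ hxy _ (pow_pos (expChar_pos A p) _)
  rcases hce _ _ _ (hk _ _ h1) with h | h
  · left
    apply hκ; rw [← hz]; exact hmapI _ _ h
  · right
    apply hκ; rw [← hw]; exact hmapI _ _ h

/-- the case of an abstract finite extension domain -/
theorem izumi_fin {A S Ω Γ : Type*} [CommRing A] [IsDomain A] [IsLocalRing A] [IsNoetherianRing A]
    [IsIntegrallyClosed A] [CommRing S] [IsDomain S] [Algebra A S] [Module.Finite A S]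
    (hAS : Function.Injective (algebraMap A S))
    [Field Ω] [Algebra A Ω] (hAΩ : Function.Injective (algebraMap A Ω)) [IsAlgClosed Ω]
    [LinearOrderedCommGroupWithZero Γ] {v : Valuation Ω Γ} {g : Γ} (hL : LiouvilleProp A)
    (hv : SepIzumi.OrdV A v g) (p : ℕ) [hp : ExpChar A p] (hQ : QSep A p) :
    IzumiProp ((maximalIdeal A).map (algebraMap A S)) := by
  have : FaithfulSMul A S := (faithfulSMul_iff_algebraMap_injective A S).2 hAS
  have : FaithfulSMul A Ω := (faithfulSMul_iff_algebraMap_injective A Ω).2 hAΩ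
  let K := FractionRing A
  let L := FractionRing S
  let : Algebra K Ω := FractionRing.liftAlgebra A Ω
  have : IsScalarTower A K Ω := FractionRing.isScalarTower_liftAlgebra A Ω
  have : FaithfulSMul A L := FaithfulSMul.trans A S L
  let : Algebra K L := FractionRing.liftAlgebra A L
  have : IsScalarTower A K L := FractionRing.isScalarTower_liftAlgebra A L
  have key : ∀ z : L, ∃ a : A, a ≠ 0 ∧ a • z ∈ (IsScalarTower.toAlgHom A S L).range := by
    intro z
    obtain ⟨s, t, ht, rfl⟩ := IsFractionRing.div_surjective S z
    obtain ⟨a, ha, r, hr⟩ := ((Algebra.IsAlgebraic.of_finite A S).isAlgebraic t).exists_nonzero_dvd ht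
    refine ⟨a, ha, s * r, ?_⟩
    have h0 : algebraMap S L t ≠ 0 := by
      rw [Ne, map_eq_zero_iff _ (IsFractionRing.injective S L)]
      exact nonZeroDivisors.ne_zero ht
    rw [Algebra.smul_def, IsScalarTower.algebraMap_apply A S L, hr]
    change algebraMap S L _ = _
    rw [map_mul, map_mul]
    rw [mul_comm, mul_div_assoc', mul_assoc, mul_div_cancel_left₀ _ h0]
  have : FiniteDimensional K L := by
    have := Algebra.IsAlgebraic.of_finite A S
    exact .of_isLocalization A S (nonZeroDivisors A)
  let S' : Subalgebra A L := (IsScalarTower.toAlgHom A S L).range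
  have hi : Function.Injective (IsScalarTower.toAlgHom A S L) := IsFractionRing.injective S L
  let E : S ≃ₐ[A] S' := AlgEquiv.ofInjective _ hi
  have : Module.Finite A S' := Module.Finite.equiv E.toLinearEquiv
  obtain ⟨c, e, h⟩ := izumi_sub K hL hv p hQ S' key
  have hmap : ∀ N (x : S), x ∈ ((maximalIdeal A).map (algebraMap A S)) ^ N ↔ E x ∈ ((maximalIdeal A).map (algebraMap A S')) ^ N := by
    intro N x
    constructor
    · intro hx
      exact map_pow_mem (E : S →ₐ[A] S') _ N x hx
    · intro hx
      have := map_pow_mem (E.symm : S' →ₐ[A] S) _ N _ hx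
      simpa using this
  refine ⟨c, e, fun n x y hxy => ?_⟩
  rw [hmap, hmap n y]
  rw [hmap, map_mul] at hxy
  exact h n _ _ hxy
end PartP4f

section PartP4g
open IsLocalRing

theorem izumi_of_blow {A Q k σ S : Type*} [CommRing A] [IsLocalRing A] [CommRing Q] [Field k]
    [IsNoetherianRing A]
    {x : σ → A} {u : σ → Q} {t : Q} {φ : A →+* Q} {ψ : Q →+* MvPolynomial σ k} {res : A →+* k}
    (h : BlowData x u t φ ψ res) (hcomp : IsAdicComplete (maximalIdeal A) A) [hσ : Nonempty σ]
    (p : ℕ) [ExpChar A p] (hQ : QSep A p)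
    [CommRing S] [IsDomain S] [Algebra A S] [Module.Finite A S] (hAS : Function.Injective (algebraMap A S)) :
    IzumiProp ((maximalIdeal A).map (algebraMap A S)) := by
  have H : ∀ f : A, (∀ n, f ∈ maximalIdeal A ^ n) → f = 0 := by
    intro f hf
    refine IsHausdorff.haus hcomp.toIsHausdorff _ (fun n => ?_)
    rw [SModEq.zero, smul_eq_mul, Ideal.mul_top]
    exact hf n
  have : IsDomain A := h.isDomain H
  have : IsIntegrallyClosed A := h.normal H
  have hL : LiouvilleProp A := fun P h1 h2 h3 h4 => liouville h hcomp P h1 h2 h3 h4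
  have i : σ := hσ.some
  obtain ⟨T, _, _, _, _, j, s0, hs0, hT, hT2⟩ := h.chart (MvPolynomial.X i) MvPolynomial.X_prime
  obtain ⟨V, hV, hu, hx⟩ := exists_val (j t) hT.primeX
  obtain ⟨hnd, hv⟩ := chart_vdata h MvPolynomial.X_prime hT2 hT.primeX V hV hu hx
  set ι := (algebraMap T (AlgebraicClosure (FractionRing T))).comp j
  let : Algebra A (AlgebraicClosure (FractionRing T)) := (ι.comp φ).toAlgebra
  have hO : SepIzumi.OrdV A V.valuation (V.valuation (ι t)) :=
    ⟨fun f n => ⟨fun hf => hv.val_le h hf, fun hf => hv.mem_of_val h hf⟩, hv.pos, hv.lt_one⟩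
  refine izumi_fin hAS ?_ hL hO p hQ
  rw [injective_iff_map_eq_zero]
  intro a ha
  apply H
  intro n
  rw [hO.iff, ha, map_zero]
  exact zero_le
end PartP4g

section PartP3d
open IsLocalRing
set_option linter.unusedSectionVars false

/-- abstract properties of the completion. -/
structure ComplData (R S : Type*) [CommRing R] [IsLocalRing R] [CommRing S] [IsLocalRing S] [Algebra R S] : Prop where
  map : (maximalIdeal R).map (algebraMap R S) = maximalIdeal S
  dense : ∀ (z : S) (j : ℕ), ∃ o : R, z - algebraMap R S o ∈ maximalIdeal S ^ j
  contr : ∀ (o : R) (j : ℕ), algebraMap R S o ∈ maximalIdeal S ^ j → o ∈ maximalIdeal R ^ j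
  complete : IsAdicComplete (maximalIdeal S) S

lemma ComplData.fg {R S : Type*} [CommRing R] [IsLocalRing R] [IsNoetherianRing R] [CommRing S] [IsLocalRing S] [Algebra R S]
    (h : ComplData R S) : (maximalIdeal S).FG := by
  rw [← h.map]; exact Ideal.FG.map (IsNoetherian.noetherian (maximalIdeal R)) _

lemma ComplData.dim {R S : Type*} [CommRing R] [IsLocalRing R] [IsNoetherianRing R] [CommRing S] [IsLocalRing S] [Algebra R S]
    (h : ComplData R S) {d : ℕ} (y : Fin d → S) (hy : ∀ i, y i ∈ maximalIdeal S) (N : ℕ)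
    (hN : maximalIdeal S ^ N ≤ Ideal.span (Set.range y)) : ringKrullDim R ≤ d := by
  choose r hr using fun i => h.dense (y i) (N + 1)
  have hfg : (maximalIdeal S ^ N).FG := h.fg.pow
  have hrm : ∀ i, r i ∈ maximalIdeal R := by
    intro i
    rw [← pow_one (maximalIdeal R)]
    apply h.contr
    rw [pow_one, ← sub_sub_cancel (y i) (algebraMap R S (r i))]
    exact Ideal.sub_mem _ (hy i) (Ideal.pow_le_self (by omega) (hr i))
  let rr : Ideal S := Ideal.span (Set.range fun i => algebraMap R S (r i))
  have h1 : maximalIdeal S ^ N ≤ rr ⊔ maximalIdeal S • maximalIdeal S ^ N := by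
    refine hN.trans ?_
    rw [Ideal.span_le]
    rintro _ ⟨i, rfl⟩
    rw [← add_sub_cancel (algebraMap R S (r i)) (y i)]
    refine Ideal.add_mem _ (Ideal.mem_sup_left (Ideal.subset_span ⟨i, rfl⟩)) (Ideal.mem_sup_right ?_)
    rw [smul_eq_mul, ← pow_succ']
    exact hr i
  have h2 : maximalIdeal S ^ N ≤ rr :=
    Submodule.le_of_le_smul_of_le_jacobson_bot hfg (maximalIdeal_le_jacobson ⊥) h1
  have h3 : maximalIdeal R ^ N ≤ Ideal.span (Set.range r) := by
    intro a ha
    have ha' : algebraMap R S a ∈ rr := by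
      apply h2
      rw [← h.map, ← Ideal.map_pow]
      exact Ideal.mem_map_of_mem _ ha
    have key : ∀ n, a ∈ Ideal.span (Set.range r) ⊔ maximalIdeal R ^ n := by
      intro n
      obtain ⟨c, hc⟩ := (Ideal.mem_span_range_iff_exists_fun).1 ha'
      choose t ht using fun i => h.dense (c i) n
      rw [← add_sub_cancel (∑ i, t i * r i) a]
      refine Ideal.add_mem _ (Ideal.mem_sup_left ?_) (Ideal.mem_sup_right ?_)
      · exact Ideal.sum_mem _ fun i _ => Ideal.mul_mem_left _ _ (Ideal.subset_span ⟨i, rfl⟩)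
      · apply h.contr
        rw [map_sub, ← hc, map_sum, ← Finset.sum_sub_distrib]
        refine Ideal.sum_mem _ fun i _ => ?_
        rw [map_mul, ← sub_mul]
        exact Ideal.mul_mem_right _ _ (ht i)
    by_cases htop : Ideal.span (Set.range r) = ⊤
    · rw [htop]; trivial
    have : Nontrivial (R ⧸ Ideal.span (Set.range r)) := Ideal.Quotient.nontrivial_iff.2 htop
    have : IsLocalRing (R ⧸ Ideal.span (Set.range r)) := IsLocalRing.of_surjective' (Ideal.Quotient.mk _) Ideal.Quotient.mk_surjective
    have hH : IsHausdorff (maximalIdeal R) (R ⧸ Ideal.span (Set.range r)) := IsHausdorff.of_isLocalRing _ _ Ideal.IsPrime.ne_top'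
    rw [← Ideal.Quotient.eq_zero_iff_mem]
    apply hH.haus
    intro n
    rw [SModEq.zero, Ideal.smul_top_eq_map]
    obtain ⟨b, hb, c, hc, hbc⟩ := Submodule.mem_sup.1 (key n)
    rw [← hbc, map_add, Ideal.Quotient.eq_zero_iff_mem.2 hb, zero_add]
    exact Ideal.mem_map_of_mem (algebraMap R (R ⧸ Ideal.span (Set.range r))) hc
  simpa using dim_le_card r hrm N h3

theorem coh_izumi {R S D : Type*} [CommRing R] [IsDomain R] [IsLocalRing R] [IsNoetherianRing R] [CommRing S] [IsDomain S]
    [IsLocalRing S] [Algebra R S] (h : ComplData R S)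
    [CommRing D] [IsDomain D] [IsLocalRing D] [IsNoetherianRing D] (w : D) (hw : maximalIdeal D = Ideal.span {w}) (hw0 : w ≠ 0)
    (hD : IsAdicComplete (maximalIdeal D) D) (θ : D →+* S) (hθ : ∀ s, ∃ a, s - θ a ∈ maximalIdeal S)
    (w0 : R) (hw0m : w0 ∈ maximalIdeal R) (hw00 : w0 ≠ 0) (hww : θ w = algebraMap R S w0)
    (p : ℕ) [ExpChar D p] (hQ : QSep D p) : IzumiProp (maximalIdeal S) := by
  classical
  obtain ⟨d, x, hd, hx, N, hN⟩ := exists_sop_mod w0 hw0m hw00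
  have hmS : ∀ r ∈ maximalIdeal R, algebraMap R S r ∈ maximalIdeal S := fun r hr => by
    rw [← h.map]; exact Ideal.mem_map_of_mem _ hr
  obtain ⟨Φ, hΦC, hΦX⟩ := MvPS.exists_eval (maximalIdeal S) h.complete θ (fun i : Fin d => algebraMap R S (x i)) (fun i => hmS _ (hx i))
  let A := MvPowerSeries (Fin d) D
  let : Algebra A S := Φ.toAlgebra
  have hcompA : IsAdicComplete (maximalIdeal A) A := MvPS.complete hw hD
  have hmA : maximalIdeal A = Ideal.span (Set.range (MvPS.xs (Fin d) w)) := MvPS.maxIdeal_eq hw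
  have hNoeth : IsNoetherianRing A := MvPowerSeries.isNoetherianRing D
  have hmap : (maximalIdeal A).map (algebraMap A S) = (Ideal.span {w0} ⊔ Ideal.span (Set.range x)).map (algebraMap R S) := by
    rw [hmA, Ideal.map_sup, Ideal.map_span, Ideal.map_span, Ideal.map_span, ← Ideal.span_union]
    congr 1
    ext z
    simp only [Set.mem_image, Set.mem_range, Set.mem_union, Set.mem_singleton_iff]
    constructor
    · rintro ⟨_, ⟨(_ | i), rfl⟩, rfl⟩
      · left; exact ⟨w0, rfl, by rw [← hww]; exact (hΦC w).symm⟩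
      · right; exact ⟨x i, ⟨i, rfl⟩, (hΦX i).symm⟩
    · rintro (⟨_, rfl, rfl⟩ | ⟨_, ⟨i, rfl⟩, rfl⟩)
      · exact ⟨_, ⟨none, rfl⟩, by rw [← hww]; exact hΦC w⟩
      · exact ⟨_, ⟨some i, rfl⟩, hΦX i⟩
  have hle : (maximalIdeal A).map (algebraMap A S) ≤ maximalIdeal S := by
    rw [hmap, ← h.map]
    apply Ideal.map_mono
    rw [sup_le_iff, Ideal.span_le, Ideal.span_le]
    exact ⟨by simpa using hw0m, by rintro _ ⟨i, rfl⟩; exact hx i⟩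
  have hNle : maximalIdeal S ^ N ≤ (maximalIdeal A).map (algebraMap A S) := by
    rw [hmap, ← h.map, ← Ideal.map_pow]
    exact Ideal.map_mono hN
  have : IsDomain A := NoZeroDivisors.to_isDomain (MvPowerSeries (Fin d) D)
  have hfgS := h.fg
  have hind : ∀ j, ∃ M : Submodule A S, M.FG ∧ ∀ s, ∃ m ∈ M, s - m ∈ maximalIdeal S ^ j := by
    intro j
    induction j with
    | zero => exact ⟨⊥, Submodule.fg_bot, fun s => ⟨0, Submodule.zero_mem _, by simp⟩⟩
    | succ j ih =>
      obtain ⟨M, hM, hM2⟩ := ih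
      obtain ⟨T, hT⟩ := (hfgS.pow : (maximalIdeal S ^ j).FG)
      refine ⟨M ⊔ Submodule.span A (T : Set S), hM.sup ⟨T, rfl⟩, fun s => ?_⟩
      obtain ⟨m, hm, hsm⟩ := hM2 s
      have key : ∀ z ∈ Submodule.span S (T : Set S), ∃ m' ∈ Submodule.span A (T : Set S), z - m' ∈ maximalIdeal S ^ (j + 1) := by
        intro z hz
        obtain ⟨c, hc, rfl⟩ := Submodule.mem_span_set.1 hz
        choose a ha using fun t => hθ (c t)
        refine ⟨∑ t ∈ c.support, (MvPowerSeries.C (a t) : A) • t, Submodule.sum_mem _ fun t ht => Submodule.smul_mem _ _ (Submodule.subset_span (hc ht)), ?_⟩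
        rw [Finsupp.sum, ← Finset.sum_sub_distrib]
        refine Ideal.sum_mem _ fun t ht => ?_
        have h1 : (MvPowerSeries.C (a t) : A) • t = θ (a t) * t := by
          rw [Algebra.smul_def]; congr 1; exact hΦC _
        rw [h1, smul_eq_mul, ← sub_mul, pow_succ']
        refine Ideal.mul_mem_mul (ha t) ?_
        rw [← hT]; exact Ideal.subset_span (hc ht)
      obtain ⟨m', hm', hz⟩ := key (s - m) (by rw [← hT] at hsm; exact hsm)
      exact ⟨m + m', Submodule.add_mem_sup hm hm', by rwa [← sub_sub]⟩
  have hfin : Module.Finite A S := by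
    obtain ⟨M, hM, hM2⟩ := hind N
    have := h.complete.toIsHausdorff
    exact finite_of_complete (maximalIdeal A) (maximalIdeal S) hle M hM fun s => by
      obtain ⟨m, hm, hs⟩ := hM2 s
      exact ⟨m, hm, hNle hs⟩
  have hinj : Function.Injective (algebraMap A S) := by
    rw [injective_iff_map_eq_zero]
    intro f hf
    by_contra hf0
    have hfm : f ∈ maximalIdeal A := by
      intro hu
      have := hu.map (algebraMap A S)
      rw [hf] at this
      exact not_isUnit_zero this
    obtain ⟨d', y, hd', hy, K, hK⟩ := exists_sop_mod f hfm hf0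
    have h1 : ringKrullDim A ≤ (d : WithBot ℕ∞) + 1 := by
      have := dim_le_card (MvPS.xs (Fin d) w) (fun i => by rw [hmA]; exact Ideal.subset_span ⟨i, rfl⟩) 1 (by rw [pow_one]; exact hmA.le)
      simpa using this
    have h2 : ringKrullDim R ≤ d' := by
      refine h.dim (fun i => algebraMap A S (y i)) (fun i => hle (Ideal.mem_map_of_mem _ (hy i))) (N * K) ?_
      rw [pow_mul]
      refine (Ideal.pow_right_mono hNle K).trans ?_
      rw [← Ideal.map_pow]
      refine (Ideal.map_mono hK).trans ?_
      rw [Ideal.map_sup, Ideal.map_span, Ideal.map_span, Set.image_singleton, hf, ← Set.range_comp]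
      simp [Function.comp_def]
    have h3 := (hd.trans h2)
    have h4 := hd'.trans h1
    norm_cast at h3 h4
    omega
  obtain ⟨u, t, φ, ψ, res, hB⟩ := MvPS.blow (τ := Fin d) hw hw0
  have : ExpChar A p := expChar_mvPowerSeries (Fin d) D p
  obtain ⟨c, e, hce⟩ := izumi_of_blow hB hcompA p (hQ.mvPowerSeries p) hinj
  refine ⟨N * c, N * e, fun n a b hab => ?_⟩
  have : a * b ∈ (maximalIdeal A).map (algebraMap A S) ^ (c * n + e) := by
    rw [mul_assoc, ← mul_add, pow_mul] at hab
    exact Ideal.pow_right_mono hNle _ hab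
  exact (hce n a b this).imp (fun h => Ideal.pow_right_mono hle n h) (fun h => Ideal.pow_right_mono hle n h)
end PartP3d

section PartP2a
open IsLocalRing
set_option linter.unusedSectionVars false

theorem coeffField_izumi {R S k : Type*} [CommRing R] [IsDomain R] [IsLocalRing R] [IsNoetherianRing R] [CommRing S] [IsDomain S]
    [IsLocalRing S] [Algebra R S] (h : ComplData R S)
    [Field k] (κ : k →+* S) (hκ : ∀ s, ∃ a, s - κ a ∈ maximalIdeal S)
    (w0 : R) (hw0m : w0 ∈ maximalIdeal R) (hw00 : w0 ≠ 0) : IzumiProp (maximalIdeal S) := by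
  have hk : maximalIdeal k = Ideal.span {0} := by
    rw [Ideal.span_singleton_eq_bot.2 rfl]; exact maximalIdeal_eq_bot
  have hkc : IsAdicComplete (maximalIdeal k) k := by
    rw [maximalIdeal_eq_bot]; infer_instance
  obtain ⟨θ, hθC, hθX⟩ := MvPS.exists_eval (maximalIdeal S) h.complete κ (fun _ : Unit => algebraMap R S w0) (fun _ => by
    rw [← h.map]; exact Ideal.mem_map_of_mem _ hw0m)
  let D := MvPowerSeries Unit k
  have : IsDomain D := NoZeroDivisors.to_isDomain (MvPowerSeries Unit k)
  have : IsNoetherianRing D := MvPowerSeries.isNoetherianRing k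
  let p := ringExpChar k
  have : ExpChar k p := inferInstance
  have : ExpChar D p := expChar_mvPowerSeries Unit k p
  refine coh_izumi h (D := D) (MvPowerSeries.X ()) ?_ ?_ (MvPS.complete hk hkc) θ (fun s => ?_) w0 hw0m hw00 (hθX ()) p
    ((QSep.field k p).mvPowerSeries p)
  · have := MvPS.maxIdeal_eq (τ := Unit) hk
    rw [this]
    apply le_antisymm
    · rw [Ideal.span_le]
      rintro _ ⟨(_ | i), rfl⟩
      · simp [MvPS.xs]
      · exact Ideal.subset_span rfl
    · rw [Ideal.span_le]
      rintro _ rfl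
      exact Ideal.subset_span ⟨some (), rfl⟩
  · intro h0
    have := congrArg (MvPowerSeries.coeff (Finsupp.single () 1)) h0
    simp at this
  · obtain ⟨a, ha⟩ := hκ s
    exact ⟨MvPowerSeries.C a, by rw [hθC]; exact ha⟩
end PartP2a

section PartP2b
open IsLocalRing
set_option linter.unusedSectionVars false

lemma smooth_rat (L : Type*) [Field L] [Algebra ℚ L] : Algebra.FormallySmooth ℚ L := by
  obtain ⟨ι, x, hx⟩ := exists_isTranscendenceBasis' ℚ L
  have := hx.isAlgebraic_field
  exact Algebra.FormallySmooth.of_algebraicIndependent_of_isSeparable hx.1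

lemma lift_rat {L S : Type*} [Field L] [CommRing S] (I : Ideal S) (hI : IsAdicComplete I S) [Algebra ℚ L] [Algebra ℚ S]
    (f : L →ₐ[ℚ] S ⧸ I) : ∃ g : L →ₐ[ℚ] S, (Ideal.Quotient.mkₐ _ _).comp g = f := by
  have := smooth_rat L
  exact Algebra.FormallySmooth.exists_mkₐ_comp_eq_of_isAdicComplete f

theorem cohen_zero {S : Type*} [CommRing S] [IsLocalRing S] (hS : IsAdicComplete (maximalIdeal S) S)
    (h0 : CharZero (ResidueField S)) :
    ∃ κ : ResidueField S →+* S, ∀ s, ∃ a, s - κ a ∈ maximalIdeal S := by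
  have hQ : Nonempty (Algebra ℚ S) := by
    rw [EqualCharZero.nonempty_algebraRat_iff]
    intro I hI
    have h0' : CharZero (S ⧸ maximalIdeal S) := h0
    exact (Ideal.Quotient.factor (le_maximalIdeal hI) : S ⧸ I →+* S ⧸ maximalIdeal S).charZero
  obtain ⟨hQ⟩ := hQ
  let e : ResidueField S →+* S ⧸ maximalIdeal S := RingHom.id _
  let f : ResidueField S →ₐ[ℚ] S ⧸ maximalIdeal S := e.toRatAlgHom
  obtain ⟨g, hg⟩ := lift_rat (maximalIdeal S) hS f
  refine ⟨g, fun s => ⟨residue S s, ?_⟩⟩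
  rw [← Ideal.Quotient.mk_eq_mk_iff_sub_mem]
  have := DFunLike.congr_fun hg (residue S s)
  exact this.symm
end PartP2b

section PartP0
open IsLocalRing

lemma complData (R : Type*) [CommRing R] [IsLocalRing R] [IsNoetherianRing R] :
    ComplData R (AdicCompletion (maximalIdeal R) R) where
  map := AdicCompletion.maximalIdeal_eq_map.symm
  dense := AdicAux.dense (IsNoetherian.noetherian _)
  contr := AdicAux.contr (IsNoetherian.noetherian _)
  complete := AdicCompletion.isAdicComplete_of_fg (IsNoetherian.noetherian _)

lemma ComplData.izumi {R S : Type*} [CommRing R] [IsLocalRing R] [CommRing S] [IsLocalRing S] [Algebra R S]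
    (h : ComplData R S) (hI : IzumiProp (maximalIdeal S)) : IzumiProp (maximalIdeal R) := by
  obtain ⟨c, e, hce⟩ := hI
  refine ⟨c, e, fun n x y hxy => ?_⟩
  have hm : algebraMap R S (x * y) ∈ maximalIdeal S ^ (c * n + e) := by
    rw [← h.map, ← Ideal.map_pow]; exact Ideal.mem_map_of_mem _ hxy
  rw [map_mul] at hm
  exact (hce n _ _ hm).imp (h.contr _ _) (h.contr _ _)

lemma izumi_prod {R : Type*} [CommRing R] [IsLocalRing R] (hI : IzumiProp (maximalIdeal R)) (k : ℕ) :
    ∃ c e : ℕ, 1 ≤ c ∧ 1 ≤ e ∧ ∀ (n : ℕ) (g : Fin k → R), ∏ j, g j ∈ maximalIdeal R ^ (c * n + e) → ∃ j, g j ∈ maximalIdeal R ^ n := by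
  obtain ⟨c, e, hce⟩ := hI
  induction k with
  | zero =>
    refine ⟨1, 1, le_rfl, le_rfl, fun n g hg => ?_⟩
    exfalso
    have := Ideal.pow_le_self (by omega) hg
    simp only [Finset.univ_eq_empty, Finset.prod_empty] at this
    exact this isUnit_one
  | succ k ih =>
    obtain ⟨c', e', h1, h2, h3⟩ := ih
    refine ⟨(c + 1) * c', c * e' + e + 1, Nat.mul_pos (by omega) h1, by omega, fun n g hg => ?_⟩
    rw [Fin.prod_univ_succ] at hg
    have hle : c * (c' * n + e') + e ≤ (c + 1) * c' * n + (c * e' + e + 1) := by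
      have : (c + 1) * c' * n + (c * e' + e + 1) = c * (c' * n + e') + e + (c' * n + 1) := by ring
      omega
    rcases hce _ _ _ (Ideal.pow_le_pow_right hle hg) with h | h
    · refine ⟨0, Ideal.pow_le_pow_right ?_ h⟩
      nlinarith
    · obtain ⟨j, hj⟩ := h3 n _ h
      exact ⟨j.succ, hj⟩

theorem lap_of_izumi
    (R : Type*) [CommRing R] [IsLocalRing R] (hI : IzumiProp (maximalIdeal R))
    (N r : ℕ) (k : Fin r → ℕ) (F : (i : Fin r) → Fin (k i) → MvPolynomial (Fin N) R)
    (f : Fin r → MvPolynomial (Fin N) R) (hf : ∀ i, f i = ∏ j : Fin (k i), F i j)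
    (hfac : ∀ j : (i : Fin r) → Fin (k i),
      ∃ (β : ℕ → ℕ) (c e : ℕ),
        IsArtinBound (maximalIdeal R) (fun i => F i (j i)) β ∧ ∀ n, β n ≤ c * n + e) :
    ∃ (β : ℕ → ℕ) (c e : ℕ),
      IsArtinBound (maximalIdeal R) f β ∧ ∀ n, β n ≤ c * n + e := by
  classical
  choose β c e hβ hce using hfac
  choose C E hC hE hCE using fun i => izumi_prod hI (k i)
  let c0 := ∑ j, c j
  let e0 := ∑ j, e j
  let C0 := ∑ i, C i
  let E0 := ∑ i, E i
  refine ⟨fun n => C0 * (c0 * n + e0) + E0, C0 * c0, C0 * e0 + E0, ?_, fun n => by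
    apply le_of_eq; ring⟩
  intro n a ha
  have hex : ∀ i, ∃ j, MvPolynomial.eval a (F i j) ∈ maximalIdeal R ^ (c0 * n + e0) := by
    intro i
    apply hCE i
    rw [← map_prod, ← hf]
    refine Ideal.pow_le_pow_right ?_ (ha i)
    have h1 : C i ≤ C0 := Finset.single_le_sum (f := C) (fun _ _ => Nat.zero_le _) (Finset.mem_univ i)
    have h2 : E i ≤ E0 := Finset.single_le_sum (f := E) (fun _ _ => Nat.zero_le _) (Finset.mem_univ i)
    exact Nat.add_le_add (Nat.mul_le_mul h1 le_rfl) h2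
  choose j hj using hex
  obtain ⟨b, hb, hab⟩ := hβ j n a (fun i => by
    refine Ideal.pow_le_pow_right ((hce j n).trans ?_) (hj i)
    have h1 : c j ≤ c0 := Finset.single_le_sum (f := c) (fun _ _ => Nat.zero_le _) (Finset.mem_univ j)
    have h2 : e j ≤ e0 := Finset.single_le_sum (f := e) (fun _ _ => Nat.zero_le _) (Finset.mem_univ j)
    gcongr)
  refine ⟨b, fun i => ?_, hab⟩
  rw [hf, map_prod]
  exact Finset.prod_eq_zero (Finset.mem_univ (j i)) (hb i)
end PartP0

section PartP2f
open IsLocalRing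
set_option linter.unusedSectionVars false

namespace CohP
variable {S : Type*} [CommRing S] [IsDomain S] [IsLocalRing S] {p : ℕ} [hp : Fact p.Prime] {β : ResidueField S → S} {B : Set (ResidueField S)}

lemma PD.F (h : PD p β B) (M : ℕ) : ∀ l ∈ Lim (maximalIdeal S) p β B, l ∈ maximalIdeal S ^ M ∨
    ∃ (j : ℕ) (u : S), u ∉ maximalIdeal S ∧ l - p ^ j * u ∈ maximalIdeal S ^ M := by
  induction M with
  | zero => intro l _; left; simp
  | succ M ih =>
    intro l hl
    by_cases hlm : l ∈ maximalIdeal S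
    · obtain ⟨μ, hμ, hlμ⟩ := h.E (M + 1) l hl hlm
      rcases ih μ hμ with h1 | ⟨j, u, hu, h1⟩
      · left
        have : l = (l - p * μ) + p * μ := by ring
        rw [this]
        refine Ideal.add_mem _ hlμ ?_
        rw [pow_succ']
        exact Ideal.mul_mem_mul h.pm h1
      · right
        refine ⟨j + 1, u, hu, ?_⟩
        have : l - p ^ (j + 1) * u = (l - p * μ) + p * (μ - p ^ j * u) := by ring
        rw [this]
        refine Ideal.add_mem _ hlμ ?_
        rw [pow_succ']
        exact Ideal.mul_mem_mul h.pm h1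
    · right
      exact ⟨0, l, hlm, by simp⟩

lemma PD.Z (h : PD p β B) (hp0 : (p : S) ≠ 0) (N : ℕ) : ∃ M, N ≤ M ∧ ∀ l ∈ Lim (maximalIdeal S) p β B,
    p * l ∈ maximalIdeal S ^ M → l ∈ maximalIdeal S ^ N := by
  obtain ⟨M0, hM0⟩ : ∃ M, (p : S) ^ N ∉ maximalIdeal S ^ M := by
    by_contra hc
    push Not at hc
    exact pow_ne_zero N hp0 (haus0 h.compl _ hc)
  refine ⟨M0 + N, by omega, fun l hl hpl => ?_⟩
  rcases h.F (M0 + N) l hl with h1 | ⟨j, u, hu, h1⟩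
  · exact Ideal.pow_le_pow_right (by omega) h1
  · by_cases hj : N ≤ j
    · have : l = (l - p ^ j * u) + p ^ j * u := by ring
      rw [this]
      refine Ideal.add_mem _ (Ideal.pow_le_pow_right (by omega) h1) (Ideal.mul_mem_right _ _ ?_)
      exact Ideal.pow_le_pow_right hj (Ideal.pow_mem_pow h.pm j)
    · exfalso
      apply hM0
      have h2 : (p : S) ^ (j + 1) * u ∈ maximalIdeal S ^ (M0 + N) := by
        have : (p : S) ^ (j + 1) * u = p * l - p * (l - p ^ j * u) := by ring
        rw [this]
        exact Ideal.sub_mem _ hpl (Ideal.mul_mem_left _ _ h1)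
      have hu' : IsUnit u := by
        by_contra hc
        exact hu ((mem_maximalIdeal u).2 hc)
      obtain ⟨v, hv⟩ := hu'.exists_right_inv
      have h3 : (p : S) ^ N = p ^ (N - (j + 1)) * v * (p ^ (j + 1) * u) := by
        have : (p : S) ^ N = p ^ (N - (j + 1)) * p ^ (j + 1) := by rw [← pow_add]; congr 1; omega
        rw [this]
        linear_combination (-(p : S) ^ (N - (j + 1)) * p ^ (j + 1)) * hv
      rw [h3]
      exact Ideal.mul_mem_left _ _ (Ideal.pow_le_pow_right (by omega) h2)

lemma PD.div (h : PD p β B) (hp0 : (p : S) ≠ 0) {x : S} (hx : x ∈ Lim (maximalIdeal S) p β B) (hxm : x ∈ maximalIdeal S) :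
    ∃ l ∈ Lim (maximalIdeal S) p β B, x = p * l := by
  choose M hM hM2 using h.Z hp0
  choose μ hμ hμ2 using fun N => h.E (M N + M (N - 1)) x hx hxm
  obtain ⟨L, hL⟩ := exists_lim h.compl 0 μ (fun j => by
    rw [zero_add]
    refine hM2 j _ (Subring.sub_mem _ (hμ j) (hμ (j + 1))) ?_
    have : p * (μ j - μ (j + 1)) = (x - p * μ (j + 1)) - (x - p * μ j) := by ring
    rw [this]
    refine Ideal.sub_mem _ (Ideal.pow_le_pow_right ?_ (hμ2 (j + 1))) (Ideal.pow_le_pow_right (by omega) (hμ2 j))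
    simp)
  simp only [zero_add] at hL
  refine ⟨L, Lim_closed fun n => ⟨μ n, hμ n, ?_⟩, ?_⟩
  · rw [← neg_sub]; exact (Ideal.neg_mem_iff _).2 (hL n)
  · rw [← sub_eq_zero]
    refine haus0 h.compl _ fun n => ?_
    have : x - p * L = (x - p * μ n) + p * (μ n - L) := by ring
    rw [this]
    refine Ideal.add_mem _ (Ideal.pow_le_pow_right ?_ (hμ2 n)) (Ideal.mul_mem_left _ _ (hL n))
    have := hM n
    omega

variable {R : Type*} [CommRing R] [IsDomain R] [IsLocalRing R] [IsNoetherianRing R] [Algebra R S]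

lemma PD.izumi_zero (h : PD p β B) (hRS : ComplData R S) (hp0 : (p : S) = 0)
    (w0 : R) (hw0m : w0 ∈ maximalIdeal R) (hw00 : w0 ≠ 0) : IzumiProp (maximalIdeal S) := by
  have hF : IsField (Lim (maximalIdeal S) p β B) :=
    { exists_pair_ne := ⟨0, 1, zero_ne_one⟩
      mul_comm := mul_comm
      mul_inv_cancel := by
        rintro ⟨a, ha⟩ ha0
        obtain ⟨y, hy, hay⟩ := h.inv' ha (fun ham => ha0 (Subtype.ext (haus0 h.compl a fun n => by
          obtain ⟨l, -, hl⟩ := h.E n a ha ham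
          simpa [hp0] using hl)))
        exact ⟨⟨y, hy⟩, Subtype.ext hay⟩ }
  letI := hF.toField
  refine coeffField_izumi hRS (k := Lim (maximalIdeal S) p β B) (Lim (maximalIdeal S) p β B).subtype (fun s => ?_) w0 hw0m hw00
  obtain ⟨l, hl, hsl⟩ := h.surj s
  exact ⟨⟨l, hl⟩, hsl⟩

lemma PD.izumi_mixed (h : PD p β B) (hRS : ComplData R S) (hp0 : (p : S) ≠ 0) : IzumiProp (maximalIdeal S) := by
  let D : Subring S := Lim (maximalIdeal S) p β B
  have hunit : ∀ x : D, (x : S) ∉ maximalIdeal S → IsUnit x := by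
    rintro ⟨x, hx⟩ hxm
    obtain ⟨y, hy, hxy⟩ := h.inv' hx hxm
    exact IsUnit.of_mul_eq_one (⟨y, hy⟩ : D) (Subtype.ext hxy)
  have hloc : IsLocalRing D := by
    refine IsLocalRing.of_isUnit_or_isUnit_one_sub_self fun x => ?_
    by_cases hx : (x : S) ∈ maximalIdeal S
    · right
      refine hunit _ fun h1 => ?_
      have : (1 : S) ∈ maximalIdeal S := by
        have e : (1 : S) = ((1 - x : D) : S) + x := by simp
        rw [e]
        exact Ideal.add_mem _ h1 hx
      exact (Ideal.ne_top_iff_one _).1 (maximalIdeal.isMaximal S).ne_top this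
    · left
      exact hunit x hx
  have hmem : ∀ x : D, x ∈ maximalIdeal D → (x : S) ∈ maximalIdeal S := by
    intro x hx
    by_contra hc
    exact (mem_maximalIdeal x).1 hx (hunit x hc)
  have hw : maximalIdeal D = Ideal.span {(p : D)} := by
    apply le_antisymm
    · intro x hx
      obtain ⟨l, hl, e⟩ := h.div hp0 x.2 (hmem x hx)
      rw [Ideal.mem_span_singleton]
      exact ⟨⟨l, hl⟩, Subtype.ext (by simpa using e)⟩
    · rw [Ideal.span_singleton_le_iff_mem, mem_maximalIdeal]
      intro hu
      have := hu.map D.subtype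
      rw [map_natCast] at this
      exact (mem_maximalIdeal _).1 h.pm this
  have hpw : ∀ (n : ℕ) (x : D), x ∈ maximalIdeal D ^ n ↔ ∃ z : D, x = p ^ n * z := by
    intro n x
    rw [hw, Ideal.span_singleton_pow, Ideal.mem_span_singleton]
    rfl
  have hpS : ∀ (n : ℕ) (z : S), (p : S) ^ n * z ∈ maximalIdeal S ^ n := fun n z =>
    Ideal.mul_mem_right _ _ (Ideal.pow_mem_pow h.pm n)
  have hHaus : ∀ x : D, (∀ n, x ∈ maximalIdeal D ^ n) → x = 0 := by
    intro x hx
    refine Subtype.ext (haus0 h.compl _ fun n => ?_)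
    obtain ⟨z, hz⟩ := (hpw n x).1 (hx n)
    rw [hz]
    simpa using hpS n z
  have hpD : (p : D) ≠ 0 := fun h0 => hp0 (by simpa using congrArg D.subtype h0)
  have hD : IsAdicComplete (maximalIdeal D) D :=
    { haus' := fun x hx => hHaus x fun n => by
        have := hx n
        rwa [SModEq.zero, smul_eq_mul, Ideal.mul_top] at this
      prec' := by
        intro f hf
        have hg : ∀ n, ∃ g : D, f n - f (n + 1) = p ^ n * g := fun n => by
          have := hf (Nat.le_succ n)
          rw [SModEq.sub_mem, smul_eq_mul, Ideal.mul_top] at this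
          exact (hpw n _).1 this
        choose g hg using hg
        obtain ⟨L, hL⟩ := exists_lim h.compl 0 (fun n => (f n : S)) (fun n => by
          have := congrArg D.subtype (hg n)
          simp only [map_sub, map_mul, map_pow, map_natCast, Subring.subtype_apply] at this
          rw [this, zero_add]
          exact hpS n _)
        have hLD : L ∈ D := Lim_closed fun n => ⟨f n, (f n).2, by
          have := hL n
          rw [zero_add] at this
          rw [← neg_sub]; exact (Ideal.neg_mem_iff _).2 this⟩
        refine ⟨⟨L, hLD⟩, fun n => ?_⟩
        rw [SModEq.sub_mem, smul_eq_mul, Ideal.mul_top, hpw]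
        let t : ℕ → D := fun j => ∑ i ∈ Finset.range j, p ^ i * g (n + i)
        have ht : ∀ j, f n - f (n + j) = p ^ n * t j := by
          intro j
          induction j with
          | zero => simp [t]
          | succ j ih =>
            have e1 : t (j + 1) = t j + p ^ j * g (n + j) := Finset.sum_range_succ _ _
            have e2 := hg (n + j)
            rw [e1]
            rw [← add_assoc]
            linear_combination ih + e2
        obtain ⟨H, hH⟩ := exists_lim h.compl 0 (fun n => (t n : S)) (fun j => by
          have e1 : t (j + 1) = t j + p ^ j * g (n + j) := Finset.sum_range_succ _ _
          have e2 : (t j : S) - t (j + 1) = p ^ j * (-(g (n + j) : S)) := by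
            rw [e1]; push_cast; ring
          rw [e2, zero_add]
          exact hpS j _)
        have hHD : H ∈ D := Lim_closed fun n => ⟨t n, (t n).2, by
          have := hH n
          rw [zero_add] at this
          rw [← neg_sub]; exact (Ideal.neg_mem_iff _).2 this⟩
        refine ⟨⟨H, hHD⟩, Subtype.ext ?_⟩
        rw [← sub_eq_zero]
        refine haus0 h.compl _ fun j => ?_
        have e1 := congrArg D.subtype (ht j)
        simp only [map_sub, map_mul, map_pow, map_natCast, Subring.subtype_apply] at e1
        have e2 : ((f n - ⟨L, hLD⟩ : D) : S) - ((p ^ n * ⟨H, hHD⟩ : D) : S) = ((f (n + j) : S) - L) + p ^ n * ((t j : S) - H) := by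
          push_cast
          linear_combination e1
        rw [e2]
        refine Ideal.add_mem _ (Ideal.pow_le_pow_right (by omega) (hL (n + j))) (Ideal.mul_mem_left _ _ ?_)
        have := hH j
        rwa [zero_add] at this }
  have hPIR : IsPrincipalIdealRing D := by
    refine IsPrincipalIdealRing.of_prime fun P hP => ?_
    by_cases hpP : (p : D) ∈ P
    · have : P = Ideal.span {(p : D)} := by
        apply le_antisymm
        · rw [← hw]; exact le_maximalIdeal hP.ne_top
        · rwa [Ideal.span_singleton_le_iff_mem]
      rw [this]
      exact ⟨⟨p, rfl⟩⟩
    · have hPn : ∀ n, ∀ x ∈ P, x ∈ maximalIdeal D ^ n := by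
        intro n
        induction n with
        | zero => intro x _; simp
        | succ n ih =>
          intro x hx
          have h1 : x ∈ maximalIdeal D := le_maximalIdeal hP.ne_top hx
          rw [← pow_one (maximalIdeal D), hpw] at h1
          obtain ⟨z, hz⟩ := h1
          rw [pow_one] at hz
          have hzP : z ∈ P := (hP.mem_or_mem (hz ▸ hx)).resolve_left hpP
          obtain ⟨z', hz'⟩ := (hpw n z).1 (ih z hzP)
          rw [hpw]
          exact ⟨z', by rw [hz, hz']; ring⟩
      have : P = ⊥ := by
        rw [eq_bot_iff]
        intro x hx
        exact hHaus x fun n => hPn n x hx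
      rw [this]
      infer_instance
  have hc0 : CharZero S := by
    rcases CharP.exists S with ⟨q, hq⟩
    rcases CharP.char_is_prime_or_zero S q with h1 | h1
    · exfalso
      have hqm : (q : S) ∈ maximalIdeal S := by rw [CharP.cast_eq_zero]; exact Ideal.zero_mem _
      by_cases hqp : p = q
      · subst hqp; exact hp0 (CharP.cast_eq_zero S p)
      · have hcop := (Nat.coprime_primes hp.out h1).2 hqp
        have := (Nat.Coprime.isCoprime hcop).map (Int.castRingHom S)
        obtain ⟨a, b, hab⟩ := this
        have h1 : (1 : S) ∈ maximalIdeal S := by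
          rw [← hab]
          refine Ideal.add_mem _ (Ideal.mul_mem_left _ _ ?_) (Ideal.mul_mem_left _ _ ?_)
          · simpa using h.pm
          · simpa using hqm
        exact (Ideal.ne_top_iff_one _).1 (maximalIdeal.isMaximal S).ne_top h1
    · subst h1; exact CharP.charP_to_charZero S
  have hcD : CharZero D := ⟨fun a b hab => by
    have := congrArg D.subtype hab
    simpa using this⟩
  refine coh_izumi hRS (D := D) (p : D) hw hpD hD D.subtype (fun s => ?_) (p : R) ?_ ?_ ?_ 1 (QSep.one D)
  · obtain ⟨l, hl, hsl⟩ := h.surj s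
    exact ⟨⟨l, hl⟩, hsl⟩
  · have := hRS.contr (p : R) 1 (by simpa using h.pm)
    simpa using this
  · intro h0
    apply hp0
    rw [← map_natCast (algebraMap R S), h0, map_zero]
  · simp

theorem izumi_charp (hRS : ComplData R S) [CharP (ResidueField S) p] (w0 : R) (hw0m : w0 ∈ maximalIdeal R) (hw00 : w0 ≠ 0) :
    IzumiProp (maximalIdeal S) := by
  obtain ⟨B, hB, hB2⟩ := exists_pbasis (ResidueField S) p
  choose β hβ using residue_surjective (R := S)
  have h : PD p β B :=
    { pm := by rw [mem_max_iff, map_natCast, CharP.cast_eq_zero]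
      lift := hβ
      ind := hB
      span := hB2
      compl := hRS.complete }
  by_cases hp0 : (p : S) = 0
  · exact h.izumi_zero hRS hp0 w0 hw0m hw00
  · exact h.izumi_mixed hRS hp0

end CohP

theorem izumi_main (R : Type*) [CommRing R] [IsDomain R] [IsNoetherianRing R] [IsLocalRing R]
    (hirr : IsDomain (AdicCompletion (maximalIdeal R) R)) : IzumiProp (maximalIdeal R) := by
  by_cases hR : maximalIdeal R = ⊥
  · refine ⟨1, 1, fun n x y hxy => ?_⟩
    have hxy0 : x * y = 0 := by
      have : x * y ∈ maximalIdeal R := Ideal.pow_le_self (by omega) hxy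
      rwa [hR, Ideal.mem_bot] at this
    rcases mul_eq_zero.1 hxy0 with h | h
    · left; rw [h]; exact Ideal.zero_mem _
    · right; rw [h]; exact Ideal.zero_mem _
  · obtain ⟨w0, hw0m, hw00⟩ := Submodule.exists_mem_ne_zero_of_ne_bot hR
    refine (complData R).izumi ?_
    rcases CharP.exists (ResidueField (AdicCompletion (maximalIdeal R) R)) with ⟨q, hq⟩
    rcases CharP.char_is_prime_or_zero (ResidueField (AdicCompletion (maximalIdeal R) R)) q with h1 | h1
    · haveI : Fact q.Prime := ⟨h1⟩
      exact CohP.izumi_charp (p := q) (complData R) w0 hw0m hw00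
    · subst h1
      obtain ⟨κ, hκ⟩ := cohen_zero (complData R).complete (CharP.charP_to_charZero _)
      exact coeffField_izumi (complData R) κ hκ w0 hw0m hw00
end PartP2f

open MvPolynomial IsLocalRing

/-- **Lemma (decomposition).** Let `(R, m)` be an analytically irreducible Noetherian local
domain and `f = (f₁,…,f_r) ⊆ R[X₁,…,X_N]` with factorizations `fᵢ = f_{i1} ⋯ f_{i k_i}`.
If for every choice of indices `j₁,…,j_r` the system `(f_{1j₁},…,f_{rj_r})` admits an Artin
bound bounded above by a linear function, then so does the system `f`. -/
theorem lap_of_factors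
    (R : Type*) [CommRing R] [IsDomain R] [IsNoetherianRing R] [IsLocalRing R]
    (hirr : IsDomain (AdicCompletion (maximalIdeal R) R))
    (N r : ℕ) (k : Fin r → ℕ) (F : (i : Fin r) → Fin (k i) → MvPolynomial (Fin N) R)
    (f : Fin r → MvPolynomial (Fin N) R) (hf : ∀ i, f i = ∏ j : Fin (k i), F i j)
    (hfac : ∀ j : (i : Fin r) → Fin (k i),
      ∃ (β : ℕ → ℕ) (c e : ℕ),
        IsArtinBound (maximalIdeal R) (fun i => F i (j i)) β ∧ ∀ n, β n ≤ c * n + e) :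
    ∃ (β : ℕ → ℕ) (c e : ℕ),
      IsArtinBound (maximalIdeal R) f β ∧ ∀ n, β n ≤ c * n + e := by
  exact lap_of_izumi R (izumi_main R hirr) N r k F f hf hfac
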